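/- Let n ≥ 2, γ = 1, α > 1, and let f : ℝⁿ → ℂ be a Schwartz function. For each ε ∈ (0,1] let u^ε be a solution of (H) with datum f, and let u^ε_free be a solution of the linear equation iε∂_t u + (ε²/2)Δu = (|x|²/2)u with u(0,·) = f (same regularity class). Then for every T > 0 there exist C > 0 and ε₀ ∈ (0,1] such that for all ε ∈ (0,ε₀]: sup_{0 ≤ t ≤ T} ‖u^ε(t,·) − u^ε_free(t,·)‖_{L²(ℝⁿ)} ≤ C ε^{α−1} log(1/ε). -/

import Mathlib

open MeasureTheory Real Filter Topology
open scoped ENNReal NNReal ComplexConjugate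

noncomputable section

/-- Euclidean space ℝⁿ. -/
abbrev Rn (n : ℕ) := EuclideanSpace ℝ (Fin n)

/-- The gradient of a complex-valued function on ℝⁿ, as a ℂⁿ-valued function. -/
def grad {n : ℕ} (φ : Rn n → ℂ) (x : Rn n) : Fin n → ℂ :=
  fun j => fderiv ℝ φ x (EuclideanSpace.single j 1)

/-- The gradient, valued in the Euclidean space ℂⁿ (so that its pointwise norm is the
Euclidean norm). -/
def gradE {n : ℕ} (φ : Rn n → ℂ) (x : Rn n) : EuclideanSpace ℂ (Fin n) :=
  (WithLp.equiv 2 (Fin n → ℂ)).symm (grad φ x)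

/-- The Laplacian of a complex-valued function on ℝⁿ. -/
def lap {n : ℕ} (φ : Rn n → ℂ) (x : Rn n) : ℂ :=
  ∑ j, fderiv ℝ (fun y => fderiv ℝ φ y (EuclideanSpace.single j 1)) x (EuclideanSpace.single j 1)

/-- The operator J^ε(t) = (x/ε) sin t − i cos t ∇ₓ. -/
def Jop {n : ℕ} (ε t : ℝ) (φ : Rn n → ℂ) (x : Rn n) : Fin n → ℂ :=
  fun j => ((x j / ε : ℝ) : ℂ) * ((Real.sin t : ℝ) : ℂ) * φ x
    - Complex.I * ((Real.cos t : ℝ) : ℂ) * grad φ x j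

/-- The operator H^ε(t) = x cos t + iε sin t ∇ₓ. -/
def Hop {n : ℕ} (ε t : ℝ) (φ : Rn n → ℂ) (x : Rn n) : Fin n → ℂ :=
  fun j => ((x j : ℝ) : ℂ) * ((Real.cos t : ℝ) : ℂ) * φ x
    + Complex.I * (ε : ℂ) * ((Real.sin t : ℝ) : ℂ) * grad φ x j

/-- J^ε(t)φ viewed as valued in Euclidean ℂⁿ. -/
def JopE {n : ℕ} (ε t : ℝ) (φ : Rn n → ℂ) (x : Rn n) : EuclideanSpace ℂ (Fin n) :=
  (WithLp.equiv 2 (Fin n → ℂ)).symm (Jop ε t φ x)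

/-- H^ε(t)φ viewed as valued in Euclidean ℂⁿ. -/
def HopE {n : ℕ} (ε t : ℝ) (φ : Rn n → ℂ) (x : Rn n) : EuclideanSpace ℂ (Fin n) :=
  (WithLp.equiv 2 (Fin n → ℂ)).symm (Hop ε t φ x)

/-- Convolution (|x|^{−γ} ∗ ψ)(x) of a real-valued ψ with the kernel |x|^{−γ}. -/
def conv {n : ℕ} (γ : ℝ) (ψ : Rn n → ℝ) (x : Rn n) : ℝ :=
  ∫ y : Rn n, ‖x - y‖ ^ (-γ) * ψ y

/-- Convolution (|x|^{−γ} ∗ ψ)(x) of a complex-valued ψ with the kernel |x|^{−γ}. -/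
def convC {n : ℕ} (γ : ℝ) (ψ : Rn n → ℂ) (x : Rn n) : ℂ :=
  ∫ y : Rn n, ((‖x - y‖ ^ (-γ) : ℝ) : ℂ) * ψ y

/-- The Hartree potential |x|^{−γ} ∗ |u|². -/
def hartree {n : ℕ} (γ : ℝ) (u : Rn n → ℂ) (x : Rn n) : ℝ :=
  conv γ (fun y => Complex.normSq (u y)) x

/-- `u` is a (smooth, Schwartz-in-x) solution of the semiclassical Hartree equation with
harmonic potential: iε∂ₜu + (ε²/2)Δu = (|x|²/2)u + ε^α(|x|^{−γ}∗|u|²)u, u(0) = f. -/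
structure IsSolutionH (n : ℕ) (α γ ε : ℝ) (f : Rn n → ℂ) (u : ℝ → Rn n → ℂ) : Prop where
  smooth : ContDiff ℝ (⊤ : ℕ∞) (fun p : ℝ × Rn n => u p.1 p.2)
  schwartz : ∀ t, ∃ φ : SchwartzMap (Rn n) ℂ, u t = ⇑φ
  init : u 0 = f
  eq : ∀ t x, Complex.I * (ε : ℂ) * deriv (fun s => u s x) t
      + ((ε ^ 2 / 2 : ℝ) : ℂ) * lap (u t) x
    = ((‖x‖ ^ 2 / 2 : ℝ) : ℂ) * u t x
      + ((ε ^ α : ℝ) : ℂ) * ((hartree γ (u t) x : ℝ) : ℂ) * u t x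

/-- `u` is a (smooth, Schwartz-in-x) solution of the linear equation
iε∂ₜu + (ε²/2)Δu = (|x|²/2)u. -/
structure IsLinSol (n : ℕ) (ε : ℝ) (u : ℝ → Rn n → ℂ) : Prop where
  smooth : ContDiff ℝ (⊤ : ℕ∞) (fun p : ℝ × Rn n => u p.1 p.2)
  schwartz : ∀ t, ∃ φ : SchwartzMap (Rn n) ℂ, u t = ⇑φ
  eq : ∀ t x, Complex.I * (ε : ℂ) * deriv (fun s => u s x) t
      + ((ε ^ 2 / 2 : ℝ) : ℂ) * lap (u t) x
    = ((‖x‖ ^ 2 / 2 : ℝ) : ℂ) * u t x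

/-- The semiclassical harmonic-oscillator propagator U^ε(t), via Mehler's formula
(for 0 < t < π). -/
def Uprop (n : ℕ) (ε t : ℝ) (φ : Rn n → ℂ) (x : Rn n) : ℂ :=
  Complex.exp (-Complex.I * (n : ℂ) * (π : ℂ) / 4) *
    ((2 * π * ε * Real.sin t : ℝ) : ℂ) ^ (-(n : ℂ) / 2) *
    ∫ y : Rn n, Complex.exp ((Complex.I / ((ε * Real.sin t : ℝ) : ℂ)) *
      (((‖x‖ ^ 2 + ‖y‖ ^ 2) / 2 * Real.cos t - ∑ j, x j * y j : ℝ) : ℂ)) * φ y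

/-- The WKB approximation operator V^ε(t) (for t ∈ (0,π/2) ∪ (π/2,π)). -/
def Vprop (n : ℕ) (ε t : ℝ) (φ : Rn n → ℂ) (x : Rn n) : ℂ :=
  if t < π / 2 then
    ((Real.cos t ^ (-(n : ℝ) / 2) : ℝ) : ℂ) * φ ((Real.cos t)⁻¹ • x) *
      Complex.exp (-Complex.I * ((‖x‖ ^ 2 * Real.tan t / (2 * ε) : ℝ) : ℂ))
  else
    Complex.exp (-Complex.I * (n : ℂ) * ((π / 2 : ℝ) : ℂ)) *
      ((|Real.cos t| ^ (-(n : ℝ) / 2) : ℝ) : ℂ) * φ ((Real.cos t)⁻¹ • x) *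
      Complex.exp (-Complex.I * ((‖x‖ ^ 2 * Real.tan t / (2 * ε) : ℝ) : ℂ))

/-- The Σ-norm ‖φ‖_Σ = ‖φ‖_{L²} + ‖|x|φ‖_{L²} + ‖∇φ‖_{L²}, with values in ℝ≥0∞. -/
def SigmaNorm {n : ℕ} (φ : Rn n → ℂ) : ℝ≥0∞ :=
  eLpNorm φ 2 volume + eLpNorm (fun x => (‖x‖ : ℂ) * φ x) 2 volume
    + eLpNorm (gradE φ) 2 volume

/-- The H¹-norm (‖φ‖_{L²}² + ‖∇φ‖_{L²}²)^{1/2}, with values in ℝ≥0∞. -/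
def H1norm {n : ℕ} (φ : Rn n → ℂ) : ℝ≥0∞ :=
  (eLpNorm φ 2 volume ^ (2 : ℝ) + eLpNorm (gradE φ) 2 volume ^ (2 : ℝ)) ^ ((1 : ℝ) / 2)

/-- The nonlinear WKB phase g(t,x) = −(|x|^{−γ}∗|f|²)(x) ∫₀ᵗ |cos τ|^{−γ} dτ. -/
def gphase {n : ℕ} (γ : ℝ) (f : Rn n → ℂ) (t : ℝ) (x : Rn n) : ℝ :=
  -(conv γ (fun y => Complex.normSq (f y)) x) * ∫ τ in (0 : ℝ)..t, |Real.cos τ| ^ (-γ)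

/-- The Fourier transform Fφ(ξ) = (2π)^{−n/2} ∫ e^{−ix·ξ} φ(x) dx. -/
def FT {n : ℕ} (φ : Rn n → ℂ) (ξ : Rn n) : ℂ :=
  (((2 * π : ℝ) ^ (-(n : ℝ) / 2) : ℝ) : ℂ) *
    ∫ x : Rn n, Complex.exp (-Complex.I * ((∑ j, x j * ξ j : ℝ) : ℂ)) * φ x

/-- The inverse Fourier transform. -/
def FTinv {n : ℕ} (φ : Rn n → ℂ) (ξ : Rn n) : ℂ :=
  (((2 * π : ℝ) ^ (-(n : ℝ) / 2) : ℝ) : ℂ) *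
    ∫ x : Rn n, Complex.exp (Complex.I * ((∑ j, x j * ξ j : ℝ) : ℂ)) * φ x

set_option linter.deprecated false
set_option linter.unusedSimpArgs false
set_option linter.unusedVariables false
set_option linter.unnecessarySeqFocus false

/-- Schwartz functions on ℝⁿ. -/
abbrev Sn (n : ℕ) := SchwartzMap (Rn n) ℂ

/-- Unit vectors. -/
abbrev eb {n : ℕ} (j : Fin n) : Rn n := EuclideanSpace.single j 1

lemma coord_temperate {n : ℕ} (j : Fin n) :
    Function.HasTemperateGrowth (fun x : Rn n => ((x j : ℝ) : ℂ)) := by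
  have h := (Complex.ofRealCLM.comp (EuclideanSpace.proj (𝕜 := ℝ) j)).hasTemperateGrowth (E := Rn n)
  exact h

/-- multiplication by x_j -/
def Xo {n : ℕ} (j : Fin n) : Sn n →L[ℂ] Sn n :=
  SchwartzMap.smulLeftCLM ℂ (fun x : Rn n => ((x j : ℝ) : ℂ))

/-- derivative in direction j -/
def Do {n : ℕ} (j : Fin n) : Sn n →L[ℂ] Sn n :=
  LineDeriv.lineDerivOpCLM ℂ (Sn n) (eb j)

lemma Xo_apply {n : ℕ} (j : Fin n) (φ : Sn n) (x : Rn n) :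
    Xo j φ x = ((x j : ℝ) : ℂ) * φ x := by
  unfold Xo
  rw [SchwartzMap.smulLeftCLM_apply_apply (coord_temperate j)]
  rfl

lemma Do_apply {n : ℕ} (j : Fin n) (φ : Sn n) (x : Rn n) :
    Do j φ x = fderiv ℝ φ x (eb j) := rfl

lemma hasFDerivAt_coord {n : ℕ} (j : Fin n) (x : Rn n) :
    HasFDerivAt (fun x : Rn n => ((x j : ℝ) : ℂ))
      (Complex.ofRealCLM.comp (EuclideanSpace.proj (𝕜 := ℝ) j)) x :=
  (Complex.ofRealCLM.comp (EuclideanSpace.proj (𝕜 := ℝ) j)).hasFDerivAt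

lemma DX {n : ℕ} (j k : Fin n) (φ : Sn n) :
    Do j (Xo k φ) = (if j = k then (1 : ℂ) else 0) • φ + Xo k (Do j φ) := by
  ext x
  rw [Do_apply]
  have h1 : (⇑(Xo k φ) : Rn n → ℂ) = fun x => ((x k : ℝ) : ℂ) * φ x := by
    ext x; exact Xo_apply k φ x
  rw [h1]
  have h2 : HasFDerivAt (fun x : Rn n => ((x k : ℝ) : ℂ) * φ x) _ x :=
    (hasFDerivAt_coord k x).mul (φ.hasFDerivAt x)
  rw [HasFDerivAt.fderiv h2]
  simp only [SchwartzMap.add_apply, SchwartzMap.smul_apply, Xo_apply, Do_apply]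
  simp [EuclideanSpace.proj, PiLp.single_apply, eq_comm]
  split_ifs <;> simp <;> ring

lemma XX {n : ℕ} (j k : Fin n) (φ : Sn n) : Xo j (Xo k φ) = Xo k (Xo j φ) := by
  ext x; simp only [Xo_apply]; ring

lemma DD {n : ℕ} (j k : Fin n) (φ : Sn n) : Do j (Do k φ) = Do k (Do j φ) := by
  ext x
  have hsm : ContDiffAt ℝ 2 φ x := (φ.smooth 2).contDiffAt
  have h := hsm.isSymmSndFDerivAt (by simp)
  have key : ∀ a b : Fin n, Do a (Do b φ) x = fderiv ℝ (fderiv ℝ φ) x (eb a) (eb b) := by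
    intro a b
    rw [Do_apply]
    have : (⇑(Do b φ) : Rn n → ℂ) = fun y => fderiv ℝ φ y (eb b) := by ext y; rfl
    rw [this]
    have hd : DifferentiableAt ℝ (fderiv ℝ φ) x :=
      (hsm.fderiv_right (m := 1) (by norm_num)).differentiableAt (by norm_num)
    rw [fderiv_clm_apply hd (by fun_prop)]
    simp
  rw [key, key]
  exact h (eb j) (eb k)

/-- The harmonic oscillator. -/
def Ho {n : ℕ} (ε : ℝ) : Sn n →L[ℂ] Sn n :=
  ∑ j, (((-(ε ^ 2 / 2) : ℝ) : ℂ) • (Do j ∘L Do j) + ((1 / 2 : ℝ) : ℂ) • (Xo j ∘L Xo j))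

lemma Ho_eq {n : ℕ} (ε : ℝ) (φ : Sn n) : Ho ε φ =
    ∑ j, (((-(ε ^ 2 / 2) : ℝ) : ℂ) • (Do j (Do j φ)) + ((1 / 2 : ℝ) : ℂ) • (Xo j (Xo j φ))) := by
  simp [Ho, ContinuousLinearMap.sum_apply]

lemma sum_apply_S {n : ℕ} {ι : Type*} (s : Finset ι) (g : ι → Sn n) (x : Rn n) :
    (∑ i ∈ s, g i) x = ∑ i ∈ s, g i x := by
  classical
  induction s using Finset.induction_on with
  | empty => simp
  | insert a s ha ih => rw [Finset.sum_insert ha, Finset.sum_insert ha, SchwartzMap.add_apply, ih]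

lemma Ho_apply {n : ℕ} (ε : ℝ) (φ : Sn n) (x : Rn n) : Ho ε φ x =
    -((ε ^ 2 / 2 : ℝ) : ℂ) * lap φ x + ((‖x‖ ^ 2 / 2 : ℝ) : ℂ) * φ x := by
  rw [Ho_eq, sum_apply_S]
  simp only [SchwartzMap.add_apply, SchwartzMap.smul_apply, Xo_apply]
  rw [Finset.sum_add_distrib]
  congr 1
  · rw [← Finset.smul_sum]
    simp only [lap, smul_eq_mul]
    push_cast
    rfl
  · rw [EuclideanSpace.norm_sq_eq]
    push_cast
    rw [Finset.sum_div, Finset.sum_mul]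
    refine Finset.sum_congr rfl fun j _ => ?_
    simp only [smul_eq_mul, Real.norm_eq_abs]
    rw [← Complex.ofReal_pow, sq_abs]
    push_cast; ring

lemma HX {n : ℕ} (ε : ℝ) (j : Fin n) (φ : Sn n) :
    Ho ε (Xo j φ) = Xo j (Ho ε φ) - ((ε ^ 2 : ℝ) : ℂ) • Do j φ := by
  have key : ∀ i : Fin n, Do i (Do i (Xo j φ)) =
      Xo j (Do i (Do i φ)) + (if i = j then (2 : ℂ) else 0) • Do i φ := by
    intro i
    rw [DX, map_add, DX, map_smul]
    split_ifs <;> simp [two_smul]; abel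
  rw [Ho_eq, Ho_eq, map_sum]
  have : ((ε ^ 2 : ℝ) : ℂ) • Do j φ = ∑ i, (if i = j then ((ε ^ 2 : ℝ) : ℂ) else 0) • Do i φ := by
    simp
  rw [this, ← Finset.sum_sub_distrib]
  refine Finset.sum_congr rfl fun i _ => ?_
  rw [key i]
  ext x
  simp only [SchwartzMap.add_apply, SchwartzMap.smul_apply, SchwartzMap.sub_apply, Xo_apply,
    smul_eq_mul]
  split_ifs
  · push_cast; ring
  · ring

lemma HD {n : ℕ} (ε : ℝ) (j : Fin n) (φ : Sn n) :
    Ho ε (Do j φ) = Do j (Ho ε φ) - Xo j φ := by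
  have key : ∀ i : Fin n, Xo i (Xo i (Do j φ)) =
      Do j (Xo i (Xo i φ)) - (if i = j then (2 : ℂ) else 0) • Xo i φ := by
    intro i
    rw [DX, DX, map_add, map_smul]
    by_cases h : j = i
    · simp only [h, if_true]; simp [two_smul]
    · simp [h, Ne.symm h]
  rw [Ho_eq, Ho_eq, map_sum]
  have : Xo j φ = ∑ i, (if i = j then (1 : ℂ) else 0) • Xo i φ := by
    simp
  rw [this, ← Finset.sum_sub_distrib]
  refine Finset.sum_congr rfl fun i _ => ?_
  rw [key i, map_add, map_smul, map_smul, DD j i (Do i φ), DD j i φ]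
  ext x
  simp only [SchwartzMap.add_apply, SchwartzMap.smul_apply, SchwartzMap.sub_apply, Xo_apply,
    smul_eq_mul]
  split_ifs
  · push_cast; ring
  · ring

/-- L² pairing -/
def ip {n : ℕ} (f g : Rn n → ℂ) : ℂ := ∫ x, conj (f x) * g x

lemma ip_D {n : ℕ} (j : Fin n) (f g : Sn n) : ip f (Do j g) = - ip (Do j f) g := by
  have := SchwartzMap.integral_bilinear_lineDerivOp_right_eq_neg_left (μ := volume) f g
    ((ContinuousLinearMap.mul ℝ ℂ).comp (Complex.conjCLE : ℂ →L[ℝ] ℂ)) (eb j)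
  simpa [ip, Do] using this

lemma ip_X {n : ℕ} (j : Fin n) (f g : Sn n) : ip f (Xo j g) = ip (Xo j f) g := by
  unfold ip
  congr 1; ext x
  rw [Xo_apply, Xo_apply]
  simp; ring

lemma ip_eq_inner {n : ℕ} (f g : Sn n) : ip f g = inner ℂ (f.toLp 2 volume) (g.toLp 2 volume) := by
  rw [SchwartzMap.inner_toL2_toL2_eq f g volume]
  unfold ip; congr 1; ext x; simp [mul_comm]

lemma ip_H {n : ℕ} (ε : ℝ) (f g : Sn n) : ip f (Ho ε g) = ip (Ho ε f) g := by
  have hadd : ∀ (s : Finset (Fin n)) (c : Fin n → Sn n) (h : Sn n),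
      ip h (∑ i ∈ s, c i : Sn n) = ∑ i ∈ s, ip h (c i) := by
    intro s c h
    rw [ip_eq_inner]
    have : ((∑ i ∈ s, c i : Sn n)).toLp 2 volume = ∑ i ∈ s, (c i).toLp 2 volume := by
      exact map_sum (SchwartzMap.toLpCLM ℂ ℂ (2 : ℝ≥0∞) (volume : Measure (Rn n))) c s
    rw [this, inner_sum]
    simp [ip_eq_inner]
  have hadd' : ∀ (s : Finset (Fin n)) (c : Fin n → Sn n) (h : Sn n),
      ip (∑ i ∈ s, c i : Sn n) h = ∑ i ∈ s, ip (c i) h := by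
    intro s c h
    rw [ip_eq_inner]
    have : ((∑ i ∈ s, c i : Sn n)).toLp 2 volume = ∑ i ∈ s, (c i).toLp 2 volume := by
      exact map_sum (SchwartzMap.toLpCLM ℂ ℂ (2 : ℝ≥0∞) (volume : Measure (Rn n))) c s
    rw [this, sum_inner]
    simp [ip_eq_inner]
  have hlin : ∀ (a b : ℝ) (p q h : Sn n), ip h ((a : ℂ) • p + (b : ℂ) • q : Sn n)
      = a * ip h p + b * ip h q := by
    intro a b p q h
    have : ((a : ℂ) • p + (b : ℂ) • q : Sn n).toLp 2 volume =
        (a : ℂ) • p.toLp 2 volume + (b : ℂ) • q.toLp 2 volume := by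
      have := map_add (SchwartzMap.toLpCLM ℂ ℂ (2 : ℝ≥0∞) (volume : Measure (Rn n)))
        ((a : ℂ) • p) ((b : ℂ) • q)
      rw [map_smul, map_smul] at this
      exact this
    rw [ip_eq_inner, this, inner_add_right, inner_smul_right, inner_smul_right]
    simp [ip_eq_inner]
  have hlin' : ∀ (a b : ℝ) (p q h : Sn n), ip ((a : ℂ) • p + (b : ℂ) • q : Sn n) h
      = a * ip p h + b * ip q h := by
    intro a b p q h
    have : ((a : ℂ) • p + (b : ℂ) • q : Sn n).toLp 2 volume =
        (a : ℂ) • p.toLp 2 volume + (b : ℂ) • q.toLp 2 volume := by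
      have := map_add (SchwartzMap.toLpCLM ℂ ℂ (2 : ℝ≥0∞) (volume : Measure (Rn n)))
        ((a : ℂ) • p) ((b : ℂ) • q)
      rw [map_smul, map_smul] at this
      exact this
    rw [ip_eq_inner, this, inner_add_left, inner_smul_left, inner_smul_left]
    simp [ip_eq_inner]
  rw [Ho_eq, Ho_eq, hadd, hadd']
  refine Finset.sum_congr rfl fun j _ => ?_
  rw [hlin, hlin', ip_D, ip_D, ip_X, ip_X, neg_neg]


lemma poly_gauss_bound (ε : ℝ) (hε : 0 < ε) (N : ℕ) (r : ℝ) (hr : 0 ≤ r) :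
    (1 + r) ^ N * Real.exp (-(r ^ 2 / (2 * ε))) ≤ N.factorial * Real.exp (1 + ε / 2) := by
  have h1 : -(r ^ 2 / (2 * ε)) ≤ (1 + ε / 2) - (1 + r) := by
    have : 0 ≤ (r - ε) ^ 2 / (2 * ε) := by positivity
    have h2 : (r - ε) ^ 2 / (2 * ε) = r ^ 2 / (2 * ε) - r + ε / 2 := by
      field_simp; ring
    linarith
  have h2 : (1 + r) ^ N ≤ N.factorial * Real.exp (1 + r) := by
    have := Real.pow_div_factorial_le_exp (x := 1 + r) (by linarith) N
    rw [div_le_iff₀ (by positivity)] at this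
    linarith
  calc (1 + r) ^ N * Real.exp (-(r ^ 2 / (2 * ε)))
      ≤ (N.factorial * Real.exp (1 + r)) * Real.exp ((1 + ε / 2) - (1 + r)) := by
        gcongr
    _ = N.factorial * Real.exp (1 + ε / 2) := by
        rw [mul_assoc, ← Real.exp_add]; ring_nf

/-- The real Gaussian. -/
def gaussR (n : ℕ) (ε : ℝ) (x : Rn n) : ℝ := Real.exp (-(‖x‖ ^ 2 / (2 * ε)))

lemma gaussR_contDiff (n : ℕ) (ε : ℝ) : ContDiff ℝ (⊤ : ℕ∞) (gaussR n ε) := by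
  unfold gaussR
  exact Real.contDiff_exp.comp (((contDiff_norm_sq ℝ).div_const _).neg)

/-- The Gaussian as a Schwartz function. -/
def gs (n : ℕ) (ε : ℝ) (hε : 0 < ε) : Sn n where
  toFun x := ((gaussR n ε x : ℝ) : ℂ)
  smooth' := Complex.ofRealCLM.contDiff.comp (gaussR_contDiff n ε)
  decay' k m := by
    have hq : Function.HasTemperateGrowth (fun x : Rn n => -(‖x‖ ^ 2 / (2 * ε))) := by
      have h1 := Function.hasTemperateGrowth_norm_sq (H := Rn n)
      have h2 := (h1.mul (Function.HasTemperateGrowth.const ((2 * ε)⁻¹))).neg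
      exact h2
    obtain ⟨l, C0, hC0, hb⟩ := hq.norm_iteratedFDeriv_le_uniform m
    refine ⟨m.factorial * (1 + C0) ^ m * ((k + l * m).factorial * Real.exp (1 + ε / 2)), ?_⟩
    intro x
    have e1 : ‖iteratedFDeriv ℝ m (fun x : Rn n => ((gaussR n ε x : ℝ) : ℂ)) x‖
        = ‖iteratedFDeriv ℝ m (gaussR n ε) x‖ := by
      exact Complex.ofRealLI.norm_iteratedFDeriv_comp_left
        ((gaussR_contDiff n ε).contDiffAt) (by exact_mod_cast le_top)
    rw [e1]
    have e2 : ‖iteratedFDeriv ℝ m (gaussR n ε) x‖ ≤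
        m.factorial * gaussR n ε x * ((1 + C0) * (1 + ‖x‖) ^ l) ^ m := by
      refine norm_iteratedFDeriv_comp_le (g := Real.exp) (f := fun x : Rn n => -(‖x‖ ^ 2 / (2 * ε)))
        (N := (⊤ : ℕ∞)) Real.contDiff_exp (((contDiff_norm_sq ℝ).div_const _).neg)
        (by exact_mod_cast le_top) x ?_ ?_
      · intro i _
        rw [norm_iteratedFDeriv_eq_norm_iteratedDeriv, iteratedDeriv_eq_iterate, Real.iter_deriv_exp]
        simp [gaussR]
      · intro i hi1 hi
        refine (hb i hi x).trans ?_
        have h1 : C0 * (1 + ‖x‖) ^ l ≤ (1 + C0) * (1 + ‖x‖) ^ l := by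
          gcongr; linarith
        have h2 : 1 ≤ (1 + C0) * (1 + ‖x‖) ^ l := by
          have : (1:ℝ) ≤ (1 + ‖x‖) ^ l := one_le_pow₀ (by linarith [norm_nonneg x])
          nlinarith
        exact h1.trans (le_self_pow₀ h2 (by omega))
    calc ‖x‖ ^ k * ‖iteratedFDeriv ℝ m (gaussR n ε) x‖
        ≤ (1 + ‖x‖) ^ k * (m.factorial * gaussR n ε x * ((1 + C0) * (1 + ‖x‖) ^ l) ^ m) := by
          gcongr
          linarith
      _ = m.factorial * (1 + C0) ^ m *
            ((1 + ‖x‖) ^ (k + l * m) * Real.exp (-(‖x‖ ^ 2 / (2 * ε)))) := by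
          unfold gaussR; rw [mul_pow, ← pow_mul, pow_add]; ring
      _ ≤ _ := by
          exact mul_le_mul_of_nonneg_left (poly_gauss_bound ε hε _ _ (norm_nonneg x)) (by positivity)

lemma gs_apply (n : ℕ) (ε : ℝ) (hε : 0 < ε) (x : Rn n) :
    gs n ε hε x = ((gaussR n ε x : ℝ) : ℂ) := rfl

lemma D_gs (n : ℕ) (ε : ℝ) (hε : 0 < ε) (j : Fin n) :
    Do j (gs n ε hε) = ((-ε⁻¹ : ℝ) : ℂ) • Xo j (gs n ε hε) := by
  ext x
  rw [Do_apply]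
  have h0 : HasFDerivAt (fun x : Rn n => ‖x‖ ^ 2) (2 • (innerSL ℝ x)) x := by
    exact (hasStrictFDerivAt_norm_sq x).hasFDerivAt
  have h1 : HasFDerivAt (gaussR n ε)
      (gaussR n ε x • (-((2 * ε)⁻¹ • ((2 : ℕ) • (innerSL ℝ x : Rn n →L[ℝ] ℝ))))) x := by
    have := (((h0.const_mul ((2 * ε)⁻¹)).neg).exp)
    convert! this using 2 with y
    · unfold gaussR; simp [div_eq_inv_mul]
    · simp only [gaussR, Pi.neg_apply, div_eq_inv_mul]
  have h2 : HasFDerivAt (⇑(gs n ε hε)) (Complex.ofRealCLM.comp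
      (gaussR n ε x • (-((2 * ε)⁻¹ • ((2 : ℕ) • (innerSL ℝ x : Rn n →L[ℝ] ℝ)))))) x :=
    Complex.ofRealCLM.hasFDerivAt.comp x h1
  rw [h2.fderiv, SchwartzMap.smul_apply, Xo_apply, gs_apply]
  simp [EuclideanSpace.inner_single_right]
  ring

lemma H_gs (n : ℕ) (ε : ℝ) (hε : 0 < ε) :
    Ho ε (gs n ε hε) = ((ε * n / 2 : ℝ) : ℂ) • gs n ε hε := by
  rw [Ho_eq]
  have : ∀ j : Fin n, (((-(ε ^ 2 / 2) : ℝ) : ℂ) • (Do j (Do j (gs n ε hε))) +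
      ((1 / 2 : ℝ) : ℂ) • (Xo j (Xo j (gs n ε hε)))) = ((ε / 2 : ℝ) : ℂ) • gs n ε hε := by
    intro j
    rw [D_gs, map_smul, DX, D_gs, map_smul]
    ext x
    simp only [SchwartzMap.add_apply, SchwartzMap.smul_apply, Xo_apply, smul_eq_mul, if_true]
    push_cast
    have : (ε : ℂ) ≠ 0 := by exact_mod_cast hε.ne'
    field_simp
    ring
  rw [Finset.sum_congr rfl fun j _ => this j]
  ext x
  rw [sum_apply_S]
  simp
  ring

/-- Hermite spaces. -/
def Sp (n : ℕ) (ε : ℝ) (hε : 0 < ε) : ℕ → Submodule ℂ (Sn n)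
  | 0 => Submodule.span ℂ {gs n ε hε}
  | m + 1 => Sp n ε hε m ⊔ ⨆ j : Fin n, (Sp n ε hε m).map (Xo j : Sn n →L[ℂ] Sn n).toLinearMap

instance Sp_fin (n : ℕ) (ε : ℝ) (hε : 0 < ε) (m : ℕ) : FiniteDimensional ℂ (Sp n ε hε m) := by
  induction m with
  | zero =>
    change FiniteDimensional ℂ (Submodule.span ℂ {gs n ε hε})
    infer_instance
  | succ m ih =>
    change FiniteDimensional ℂ (Sp n ε hε m ⊔ ⨆ j : Fin n,
      (Sp n ε hε m).map (Xo j : Sn n →L[ℂ] Sn n).toLinearMap : Submodule ℂ (Sn n))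
    infer_instance

lemma Sp_mono_succ (n : ℕ) (ε : ℝ) (hε : 0 < ε) (m : ℕ) : Sp n ε hε m ≤ Sp n ε hε (m + 1) := by
  conv_rhs => unfold Sp
  exact le_sup_left

lemma Sp_X (n : ℕ) (ε : ℝ) (hε : 0 < ε) (m : ℕ) (j : Fin n) (φ : Sn n) (h : φ ∈ Sp n ε hε m) :
    Xo j φ ∈ Sp n ε hε (m + 1) := by
  unfold Sp
  refine Submodule.mem_sup_right ?_
  exact Submodule.mem_iSup_of_mem j ⟨φ, h, rfl⟩

lemma Sp_le_of (n : ℕ) (ε : ℝ) (hε : 0 < ε) (m : ℕ) (A : Submodule ℂ (Sn n))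
    (h1 : Sp n ε hε m ≤ A) (h2 : ∀ j, ∀ φ ∈ Sp n ε hε m, Xo j φ ∈ A) :
    Sp n ε hε (m + 1) ≤ A := by
  conv_lhs => unfold Sp
  refine sup_le h1 (iSup_le fun j => ?_)
  rintro _ ⟨φ, hφ, rfl⟩
  exact h2 j φ hφ

lemma Sp_D (n : ℕ) (ε : ℝ) (hε : 0 < ε) (m : ℕ) (i : Fin n) :
    ∀ φ ∈ Sp n ε hε m, Do i φ ∈ Sp n ε hε (m + 1) := by
  induction m with
  | zero =>
    intro φ hφ
    unfold Sp at hφ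
    obtain ⟨c, rfl⟩ := Submodule.mem_span_singleton.1 hφ
    rw [map_smul, D_gs]
    refine Submodule.smul_mem _ _ (Submodule.smul_mem _ _ (Sp_X n ε hε 0 i _ ?_))
    unfold Sp
    exact Submodule.mem_span_singleton_self _
  | succ m ih =>
    have := Sp_le_of n ε hε m ((Sp n ε hε (m + 1 + 1)).comap (Do i : Sn n →L[ℂ] Sn n).toLinearMap)
      (fun φ hφ => Sp_mono_succ n ε hε (m + 1) (ih φ hφ)) (fun j φ hφ => by
        change Do i (Xo j φ) ∈ Sp n ε hε (m + 1 + 1)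
        rw [DX]
        refine Submodule.add_mem _ (Submodule.smul_mem _ _ ?_) (Sp_X n ε hε (m + 1) j _ (ih φ hφ))
        exact Sp_mono_succ _ _ _ _ (Sp_mono_succ _ _ _ _ hφ))
    exact fun φ hφ => this hφ

lemma Sp_H (n : ℕ) (ε : ℝ) (hε : 0 < ε) (m : ℕ) :
    ∀ φ ∈ Sp n ε hε m, Ho ε φ ∈ Sp n ε hε m := by
  induction m with
  | zero =>
    intro φ hφ
    unfold Sp at hφ ⊢
    obtain ⟨c, rfl⟩ := Submodule.mem_span_singleton.1 hφ
    rw [map_smul, H_gs]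
    refine Submodule.smul_mem _ _ (Submodule.smul_mem _ _ ?_)
    exact Submodule.mem_span_singleton_self _
  | succ m ih =>
    have := Sp_le_of n ε hε m ((Sp n ε hε (m + 1)).comap (Ho ε : Sn n →L[ℂ] Sn n).toLinearMap)
      (fun φ hφ => Sp_mono_succ n ε hε m (ih φ hφ)) (fun j φ hφ => by
        change Ho ε (Xo j φ) ∈ Sp n ε hε (m + 1)
        rw [HX]
        exact Submodule.sub_mem _ (Sp_X n ε hε m j _ (ih φ hφ))
          (Submodule.smul_mem _ _ (Sp_D n ε hε m j φ hφ)))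
    exact fun φ hφ => this hφ

/-- powers of a linear form times the Gaussian lie in the Hermite spaces -/
lemma Sp_pow (n : ℕ) (ε : ℝ) (hε : 0 < ε) (ξ : Rn n) (k : ℕ) :
    ∃ φ ∈ Sp n ε hε k, ∀ x, φ x = (((∑ j, x j * ξ j : ℝ) : ℂ)) ^ k * gs n ε hε x := by
  induction k with
  | zero =>
    refine ⟨gs n ε hε, ?_, by simp⟩
    unfold Sp
    exact Submodule.mem_span_singleton_self _
  | succ k ih =>
    obtain ⟨φ, hφ, h⟩ := ih
    refine ⟨∑ j, (ξ j : ℂ) • Xo j φ, ?_, ?_⟩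
    · exact Submodule.sum_mem _ fun j _ => Submodule.smul_mem _ _ (Sp_X n ε hε k j φ hφ)
    · intro x
      rw [sum_apply_S]
      simp only [SchwartzMap.smul_apply, Xo_apply, h, smul_eq_mul]
      rw [pow_succ]
      push_cast
      rw [mul_comm _ (∑ i, (x i : ℂ) * ξ i), mul_assoc, Finset.sum_mul]
      refine Finset.sum_congr rfl fun j _ => ?_
      ring


lemma zero_of_fourier_zero {n : ℕ} (G : Rn n → ℂ) (hG : Integrable G)
    (h : ∀ w : Rn n, FourierTransform.fourier G w = (0 : ℂ)) : ∀ᵐ x, G x = 0 := by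
  refine ae_eq_zero_of_integral_contDiff_smul_eq_zero hG.locallyIntegrable ?_
  intro g hg1 hg2
  have hc : ContDiff ℝ (⊤ : ℕ∞) (fun x => ((g x : ℝ) : ℂ)) := Complex.ofRealCLM.contDiff.comp hg1
  have hs : HasCompactSupport (fun x => ((g x : ℝ) : ℂ)) := by
    exact hg2.comp_left (g := fun r : ℝ => (r : ℂ)) (by simp)
  set φ : Sn n := hs.toSchwartzMap hc with hφ
  set ψ : Sn n := FourierTransform.fourierInv φ with hψ
  have h1 : FourierTransform.fourier ψ = φ := FourierTransform.fourier_fourierInv_eq φ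
  have h2 := VectorFourier.integral_bilin_fourierIntegral_eq_flip (μ := volume) (ν := volume)
    (ContinuousLinearMap.mul ℂ ℂ)
    (L := innerₗ (Rn n)) Real.continuous_fourierChar continuous_inner hG ψ.integrable
  have h3 : ∀ x, VectorFourier.fourierIntegral Real.fourierChar volume (innerₗ (Rn n)).flip ψ x
      = g x := by
    intro x
    have : FourierTransform.fourier ψ x = φ x := by rw [h1]
    have e : φ x = ((g x : ℝ) : ℂ) := rfl
    rw [← e, ← this]
    simp
    rfl
  have h4 : ∀ x, VectorFourier.fourierIntegral Real.fourierChar volume (innerₗ (Rn n)) G x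
      = 0 := h
  simp only [h3, h4] at h2
  simp only [map_zero, ContinuousLinearMap.mul_apply', zero_mul, integral_zero] at h2
  have h5 : ∫ x, G x * (g x : ℂ) = 0 := by rw [← h2]; simp
  rw [← h5]
  congr 1; ext x; simp [mul_comm]

lemma gauss_exp_bound (n : ℕ) (ε : ℝ) (hε : 0 < ε) (c : ℝ) (x : Rn n) :
    gaussR n ε x * Real.exp (c * ‖x‖) ≤ Real.exp (c ^ 2 * ε) * gaussR n (2 * ε) x := by
  unfold gaussR
  rw [← Real.exp_add, ← Real.exp_add]
  apply Real.exp_le_exp.2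
  have : 0 ≤ (‖x‖ - 2 * ε * c) ^ 2 / (4 * ε) := by positivity
  have h2 : (‖x‖ - 2 * ε * c) ^ 2 / (4 * ε) =
    (c ^ 2 * ε + -(‖x‖ ^ 2 / (2 * (2 * ε)))) - (-(‖x‖ ^ 2 / (2 * ε)) + c * ‖x‖) := by
    field_simp; ring
  linarith

lemma gauss_int (n : ℕ) (ε : ℝ) (hε : 0 < ε) (c : ℝ) (g : Lp ℂ 2 (volume : Measure (Rn n))) :
    Integrable (fun x => ‖g x‖ * (gaussR n ε x * Real.exp (c * ‖x‖))) := by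
  have h1 : Integrable (fun x => ‖g x‖ * ‖gs n (2 * ε) (by positivity) x‖) :=
    (Lp.memLp g).norm.integrable_mul ((gs n (2 * ε) (by positivity)).memLp 2 volume).norm
  refine (h1.const_mul (Real.exp (c ^ 2 * ε))).mono' ?_ ?_
  · refine ((Lp.memLp g).1.norm).mul ?_
    exact (((gaussR_contDiff n ε).continuous).mul (by fun_prop)).aestronglyMeasurable
  · refine Eventually.of_forall fun x => ?_
    rw [gs_apply]
    have := gauss_exp_bound n ε hε c x
    have h3 : 0 ≤ gaussR n ε x := (Real.exp_pos _).le
    have h4 : 0 ≤ gaussR n (2 * ε) x := (Real.exp_pos _).le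
    rw [Real.norm_of_nonneg (by positivity), Complex.norm_real, Real.norm_of_nonneg h4]
    nlinarith [norm_nonneg (g x)]

lemma Sp_dense0 (n : ℕ) (ε : ℝ) (hε : 0 < ε) (g : Lp ℂ 2 (volume : Measure (Rn n)))
    (h : ∀ m, ∀ φ ∈ Sp n ε hε m, inner ℂ (φ.toLp 2 volume) g = (0 : ℂ)) : g = 0 := by
  set G : Rn n → ℂ := fun x => g x * gaussR n ε x with hGdef
  have hGm : AEStronglyMeasurable G volume := by
    refine (Lp.memLp g).1.mul ?_
    exact (Complex.continuous_ofReal.comp (gaussR_contDiff n ε).continuous).aestronglyMeasurable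
  have gpos : ∀ x, 0 < gaussR n ε x := fun x => Real.exp_pos _
  have hnG : ∀ x, ‖G x‖ = ‖g x‖ * gaussR n ε x := by
    intro x
    simp only [hGdef, norm_mul, Complex.norm_real, Real.norm_of_nonneg (gpos x).le]
  have hGint : Integrable G := by
    have := gauss_int n ε hε 0 g
    refine this.mono' hGm (Eventually.of_forall fun x => ?_)
    rw [hnG]; simp
  have hmom : ∀ (ξ : Rn n) (k : ℕ), ∫ x, (((∑ j, x j * ξ j : ℝ) : ℂ)) ^ k * G x = 0 := by
    intro ξ k
    obtain ⟨φ, hφ, hx⟩ := Sp_pow n ε hε ξ k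
    have := h k φ hφ
    rw [L2.inner_def] at this
    rw [← this]
    refine integral_congr_ae ?_
    filter_upwards [φ.coeFn_toLp 2 volume] with x hx2
    rw [hx2, hx, gs_apply]
    simp only [RCLike.inner_apply, map_mul, map_pow, Complex.conj_ofReal, hGdef]
    ring
  have hF : ∀ w : Rn n, FourierTransform.fourier G w = (0 : ℂ) := by
    intro w
    rw [Real.fourier_eq']
    have hs := hasSum_integral_of_dominated_convergence (μ := (volume : Measure (Rn n)))
      (F := fun (k : ℕ) x => ((k.factorial : ℂ)⁻¹ * (-2 * π * Complex.I) ^ k) *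
        ((((∑ j, x j * w j : ℝ) : ℂ)) ^ k * G x))
      (f := fun v => Complex.exp ((↑(-2 * π * inner ℝ v w) * Complex.I)) • G v)
      (fun k x => (2 * π * ‖w‖ * ‖x‖) ^ k / k.factorial * ‖G x‖) ?_ ?_ ?_ ?_ ?_
    · simp only [integral_const_mul, hmom, mul_zero] at hs
      exact hs.unique hasSum_zero
    · intro k
      refine AEStronglyMeasurable.const_mul (AEStronglyMeasurable.mul ?_ hGm) _
      exact Continuous.aestronglyMeasurable (by fun_prop)
    · intro k
      refine Eventually.of_forall fun x => ?_
      have e : (∑ j, x j * w j) = inner ℝ x w := by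
        simp [PiLp.inner_apply, mul_comm]
      rw [e]
      have h1 : |inner ℝ x w| ≤ ‖x‖ * ‖w‖ := abs_real_inner_le_norm x w
      simp only [norm_mul, norm_inv, norm_pow, Complex.norm_real, norm_neg, Complex.norm_I,
        RCLike.norm_natCast, Complex.norm_ofNat, mul_one]
      have h2 : ‖π‖ = π := Real.norm_of_nonneg pi_pos.le
      rw [h2, ← mul_assoc, Real.norm_eq_abs]
      refine mul_le_mul_of_nonneg_right ?_ (norm_nonneg _)
      rw [mul_assoc, ← mul_pow, div_eq_inv_mul]
      refine mul_le_mul_of_nonneg_left ?_ (by positivity)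
      refine pow_le_pow_left₀ (by positivity) ?_ _
      calc 2 * π * |inner ℝ x w| ≤ 2 * π * (‖x‖ * ‖w‖) := by gcongr
        _ = _ := by ring
    · refine Eventually.of_forall fun x => ?_
      exact (Real.summable_pow_div_factorial _).mul_right _
    · have := gauss_int n ε hε (2 * π * ‖w‖) g
      refine this.congr (Eventually.of_forall fun x => ?_)
      simp only
      rw [tsum_mul_right, hnG, Real.exp_eq_exp_ℝ, NormedSpace.exp_eq_tsum_div]
      ring
    · refine Eventually.of_forall fun x => ?_
      have e : (∑ j, x j * w j) = inner ℝ x w := by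
        simp [PiLp.inner_apply, mul_comm]
      simp only [e, smul_eq_mul]
      have h1 := NormedSpace.expSeries_div_hasSum_exp
        ((↑(-2 * π * inner ℝ x w) * Complex.I : ℂ))
      rw [← Complex.exp_eq_exp_ℂ] at h1
      have h2 := h1.mul_right (G x)
      refine h2.congr_fun ?_ |> fun h => h
      intro k
      push_cast
      rw [div_eq_inv_mul, mul_pow, mul_pow, mul_pow, mul_pow, mul_pow]
      ring
  have hz := zero_of_fourier_zero G hGint hF
  refine (Lp.eq_zero_iff_ae_eq_zero).2 ?_
  filter_upwards [hz] with x hx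
  simp only [hGdef, mul_eq_zero] at hx
  rcases hx with hx | hx
  · simpa using hx
  · exact absurd (by exact_mod_cast hx) (gpos x).ne'

/-- Hermite spaces in L². -/
def Pp (n : ℕ) (ε : ℝ) (hε : 0 < ε) (m : ℕ) : Submodule ℂ (Lp ℂ 2 (volume : Measure (Rn n))) :=
  (Sp n ε hε m).map (SchwartzMap.toLpCLM ℂ ℂ 2 volume).toLinearMap

instance Pp_fin (n : ℕ) (ε : ℝ) (hε : 0 < ε) (m : ℕ) : FiniteDimensional ℂ (Pp n ε hε m) := by
  unfold Pp; infer_instance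

lemma Pp_tendsto (n : ℕ) (ε : ℝ) (hε : 0 < ε) (x : Lp ℂ 2 (volume : Measure (Rn n))) :
    Tendsto (fun m => (Pp n ε hε m).starProjection x) atTop (𝓝 x) := by
  refine Submodule.starProjection_tendsto_self _ ?_ x ?_
  · refine monotone_nat_of_le_succ fun m => Submodule.map_mono (Sp_mono_succ n ε hε m)
  · rw [Submodule.topologicalClosure_eq_top_iff.2]
    rw [Submodule.eq_bot_iff]
    intro g hg
    refine Sp_dense0 n ε hε g fun m φ hφ => ?_
    rw [Submodule.mem_orthogonal] at hg
    exact hg _ (Submodule.mem_iSup_of_mem m ⟨φ, hφ, rfl⟩)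


lemma cut_temperate {n : ℕ} (ψ : Sn n) (r : ℝ) :
    Function.HasTemperateGrowth (fun x : Rn n => ψ (r • x)) := by
  have h1 : Function.HasTemperateGrowth (⇑ψ) := ψ.hasTemperateGrowth
  have h2 : Function.HasTemperateGrowth (fun x : Rn n => r • x) :=
    (r • ContinuousLinearMap.id ℝ (Rn n)).hasTemperateGrowth
  exact h1.comp h2

/-- multiplication by `ψ(r x)` -/
def cut {n : ℕ} (ψ : Sn n) (r : ℝ) : Sn n →L[ℂ] Sn n :=
  SchwartzMap.smulLeftCLM ℂ (fun x : Rn n => ψ (r • x))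

lemma cut_apply {n : ℕ} (ψ : Sn n) (r : ℝ) (φ : Sn n) (x : Rn n) :
    cut ψ r φ x = ψ (r • x) * φ x := by
  unfold cut
  rw [SchwartzMap.smulLeftCLM_apply_apply (cut_temperate ψ r)]
  rfl

lemma X_cut {n : ℕ} (ψ : Sn n) (r : ℝ) (j : Fin n) (φ : Sn n) :
    Xo j (cut ψ r φ) = cut ψ r (Xo j φ) := by
  ext x; simp only [Xo_apply, cut_apply]; ring

lemma D_cut {n : ℕ} (ψ : Sn n) (r : ℝ) (j : Fin n) (φ : Sn n) :
    Do j (cut ψ r φ) = cut ψ r (Do j φ) + (r : ℂ) • cut (Do j ψ) r φ := by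
  ext x
  rw [Do_apply]
  have h1 : (⇑(cut ψ r φ) : Rn n → ℂ) = fun x => ψ (r • x) * φ x := by
    ext x; exact cut_apply ψ r φ x
  rw [h1]
  have h3 : HasFDerivAt (fun x : Rn n => ψ (r • x)) ((fderiv ℝ ψ (r • x)).comp
      (r • ContinuousLinearMap.id ℝ (Rn n))) x :=
    (ψ.hasFDerivAt (r • x)).comp x ((r • ContinuousLinearMap.id ℝ (Rn n)).hasFDerivAt)
  have h2 : HasFDerivAt (fun x : Rn n => ψ (r • x) * φ x) _ x := h3.mul (φ.hasFDerivAt x)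
  rw [HasFDerivAt.fderiv h2]
  simp only [SchwartzMap.add_apply, SchwartzMap.smul_apply, cut_apply, Do_apply]
  simp
  ring

/-- L² norm squared. -/
def nsq {n : ℕ} (f : Rn n → ℂ) : ℝ := ∫ x, ‖f x‖ ^ 2

lemma nsq_nonneg {n : ℕ} (f : Rn n → ℂ) : 0 ≤ nsq f := integral_nonneg fun _ => by positivity

lemma nsq_toLp {n : ℕ} (f : Rn n → ℂ) (hf : MemLp f 2 volume) : nsq f = ‖hf.toLp f‖ ^ 2 := by
  have h := @inner_self_eq_norm_sq ℂ _ _ _ _ (hf.toLp f)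
  rw [← h, L2.inner_def]
  have : (∫ (a : Rn n), inner ℂ ((hf.toLp f) a) ((hf.toLp f) a)) = ((nsq f : ℝ) : ℂ) := by
    unfold nsq
    rw [← integral_complex_ofReal]
    refine integral_congr_ae ?_
    filter_upwards [hf.coeFn_toLp] with x hx
    rw [hx, inner_self_eq_norm_sq_to_K]; simp
  rw [this]; simp

lemma nsq_eq_normS {n : ℕ} (f : Sn n) : nsq f = ‖f.toLp 2 volume‖ ^ 2 :=
  nsq_toLp f (f.memLp 2 volume)

lemma ip_toLp {n : ℕ} (f g : Rn n → ℂ) (hf : MemLp f 2 volume) (hg : MemLp g 2 volume) :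
    ip f g = inner ℂ (hf.toLp f) (hg.toLp g) := by
  rw [L2.inner_def]
  refine integral_congr_ae ?_
  filter_upwards [hf.coeFn_toLp, hg.coeFn_toLp] with x h1 h2
  rw [h1, h2]; simp [mul_comm]

lemma norm_ip_le {n : ℕ} (f g : Rn n → ℂ) (hf : MemLp f 2 volume) (hg : MemLp g 2 volume) :
    ‖ip f g‖ ≤ √(nsq f) * √(nsq g) := by
  rw [ip_toLp f g hf hg, nsq_toLp f hf, nsq_toLp g hg, Real.sqrt_sq (norm_nonneg _),
    Real.sqrt_sq (norm_nonneg _)]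
  exact norm_inner_le_norm _ _

lemma cut_tendsto {n : ℕ} (ψ : Sn n) (φ : Sn n) :
    Tendsto (fun r : ℝ => (cut ψ r φ).toLp 2 volume) (𝓝 0) (𝓝 ((ψ 0 • φ).toLp 2 volume)) := by
  rw [tendsto_iff_norm_sub_tendsto_zero]
  have key : Tendsto (fun r : ℝ => nsq (cut ψ r φ - ψ 0 • φ : Sn n)) (𝓝 0) (𝓝 0) := by
    unfold nsq
    obtain ⟨C, hC0, hC⟩ := ψ.decay 0 0
    have hb : ∀ x, ‖ψ x‖ ≤ C := by intro x; simpa using hC x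
    have : (0:ℝ) = ∫ x : Rn n, (0:ℝ) := by simp
    conv => rhs; rw [this]
    refine tendsto_integral_filter_of_dominated_convergence (fun x => (2 * C) ^ 2 * ‖φ x‖ ^ 2)
      ?_ ?_ ?_ ?_
    · refine Eventually.of_forall fun r => ?_
      exact ((SchwartzMap.continuous _).norm.pow 2).aestronglyMeasurable
    · refine Eventually.of_forall fun r => Eventually.of_forall fun x => ?_
      rw [Real.norm_of_nonneg (by positivity), SchwartzMap.sub_apply, cut_apply,
        SchwartzMap.smul_apply, smul_eq_mul, ← sub_mul, norm_mul, mul_pow]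
      gcongr
      calc _ ≤ ‖ψ (r • x)‖ + ‖ψ 0‖ := norm_sub_le _ _
        _ ≤ 2 * C := by linarith [hb (r • x), hb 0]
    · refine Integrable.const_mul ?_ _
      exact (φ.memLp 2 volume).integrable_norm_pow (by norm_num)
    · refine Eventually.of_forall fun x => ?_
      have h1 : Continuous fun r : ℝ => ‖(cut ψ r φ - ψ 0 • φ : Sn n) x‖ ^ 2 := by
        simp only [SchwartzMap.sub_apply, cut_apply, SchwartzMap.smul_apply]
        have := ψ.continuous
        fun_prop
      have h2 := h1.tendsto 0
      simpa [cut_apply] using h2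
  have h2 : ∀ r, ‖(cut ψ r φ).toLp 2 volume - (ψ 0 • φ).toLp 2 volume‖
      = √(nsq (cut ψ r φ - ψ 0 • φ : Sn n)) := by
    intro r
    rw [nsq_eq_normS, Real.sqrt_sq (norm_nonneg _)]
    congr 1
  simp only [h2]
  have := (Real.continuous_sqrt.tendsto 0).comp key
  simpa using! this

/-- abbreviation: Schwartz to L² -/
abbrev tl {n : ℕ} : Sn n →L[ℂ] Lp ℂ 2 (volume : Measure (Rn n)) := SchwartzMap.toLpCLM ℂ ℂ 2 volume

lemma cut_tendsto' {n : ℕ} (ψ : Sn n) (φ : Sn n) :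
    Tendsto (fun r : ℝ => tl (cut ψ r φ)) (𝓝 0) (𝓝 (ψ 0 • tl φ)) := by
  have := cut_tendsto ψ φ
  rw [← map_smul]
  exact this

lemma H_cut_tendsto {n : ℕ} (ε : ℝ) (ψ : Sn n) (h0 : ψ 0 = 1) (φ : Sn n) :
    Tendsto (fun r : ℝ => tl (Ho ε (cut ψ r φ))) (𝓝 0) (𝓝 (tl (Ho ε φ))) := by
  simp only [Ho_eq, map_sum, map_add, map_smul]
  refine tendsto_finset_sum _ fun j _ => ?_
  refine Tendsto.add (Tendsto.const_smul ?_ _) (Tendsto.const_smul ?_ _)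
  · have e : ∀ r, tl (Do j (Do j (cut ψ r φ))) = tl (cut ψ r (Do j (Do j φ)))
        + (r : ℂ) • (tl (cut (Do j ψ) r (Do j φ)) + tl (cut (Do j ψ) r (Do j φ)) +
          (r : ℂ) • tl (cut (Do j (Do j ψ)) r φ)) := by
      intro r
      rw [D_cut, map_add, D_cut, map_smul, D_cut]
      simp only [map_add, map_smul, smul_add]
      abel
    simp only [e]
    have hr : Tendsto (fun r : ℝ => (r : ℂ)) (𝓝 0) (𝓝 0) := by
      simpa using! Complex.continuous_ofReal.tendsto 0
    have := (cut_tendsto' ψ (Do j (Do j φ))).add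
      (hr.smul (((cut_tendsto' (Do j ψ) (Do j φ)).add (cut_tendsto' (Do j ψ) (Do j φ))).add
        (hr.smul (cut_tendsto' (Do j (Do j ψ)) φ))))
    simpa [h0] using this
  · simp only [X_cut]
    have := cut_tendsto' ψ (Xo j (Xo j φ))
    simpa [h0] using this

lemma exists_bump (n : ℕ) : ∃ ψ : Sn n, ψ 0 = 1 ∧ HasCompactSupport (⇑ψ) ∧
    (∀ x, conj (ψ x) = ψ x) ∧ (∀ x, ‖ψ x‖ ≤ 1) := by
  let b : ContDiffBump (0 : Rn n) := ⟨1, 2, by norm_num, by norm_num⟩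
  have hc : ContDiff ℝ (⊤ : ℕ∞) (fun x => ((b x : ℝ) : ℂ)) :=
    Complex.ofRealCLM.contDiff.comp b.contDiff
  have hs : HasCompactSupport (fun x => ((b x : ℝ) : ℂ)) :=
    b.hasCompactSupport.comp_left (g := fun r : ℝ => (r : ℂ)) (by simp)
  refine ⟨hs.toSchwartzMap hc, ?_, hs, ?_, ?_⟩
  · change ((b 0 : ℝ) : ℂ) = 1
    rw [b.one_of_mem_closedBall (by simp [b])]; simp
  · intro x; exact Complex.conj_ofReal _
  · intro x
    change ‖((b x : ℝ) : ℂ)‖ ≤ 1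
    rw [Complex.norm_real, Real.norm_of_nonneg b.nonneg]
    exact b.le_one

lemma cut_compact {n : ℕ} (ψ : Sn n) (hψ : HasCompactSupport (⇑ψ)) (r : ℝ) (hr : r ≠ 0)
    (φ : Sn n) : HasCompactSupport (⇑(cut ψ r φ)) := by
  have h1 : HasCompactSupport (fun x : Rn n => ψ (r • x)) :=
    hψ.comp_homeomorph (Homeomorph.smulOfNeZero r hr)
  have h2 : (⇑(cut ψ r φ) : Rn n → ℂ) = fun x => ψ (r • x) * φ x := by
    ext x; exact cut_apply ψ r φ x
  rw [h2]
  exact h1.mul_right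


/-- Evolution equation `iε ∂ₜU = H U + F`. -/
structure Evol {n : ℕ} (ε : ℝ) (U : ℝ → Sn n) (F : ℝ → Rn n → ℂ) : Prop where
  smooth : ContDiff ℝ (⊤ : ℕ∞) (fun p : ℝ × Rn n => U p.1 p.2)
  eq : ∀ t x, HasDerivAt (fun s => U s x) (-(Complex.I / ε) * (F t x + Ho ε (U t) x)) t

lemma slice_deriv {n : ℕ} {u : ℝ × Rn n → ℂ} (hu : ContDiff ℝ (⊤ : ℕ∞) u) (t : ℝ) (x : Rn n) :
    HasDerivAt (fun s => u (s, x)) (fderiv ℝ u (t, x) (1, 0)) t := by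
  have h1 : HasFDerivAt u (fderiv ℝ u (t, x)) (t, x) :=
    (hu.differentiable (by simp)).differentiableAt.hasFDerivAt
  have h2 : HasDerivAt (fun s : ℝ => (s, x)) ((1 : ℝ), (0 : Rn n)) t :=
    (hasDerivAt_id t).prodMk (hasDerivAt_const t x)
  exact h1.comp_hasDerivAt t h2

lemma Evol.deriv_eq {n : ℕ} {ε : ℝ} {U : ℝ → Sn n} {F : ℝ → Rn n → ℂ} (h : Evol ε U F)
    (t : ℝ) (x : Rn n) : fderiv ℝ (fun p : ℝ × Rn n => U p.1 p.2) (t, x) (1, 0) =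
      -(Complex.I / ε) * (F t x + Ho ε (U t) x) :=
  (slice_deriv h.smooth t x).unique (h.eq t x)

lemma Evol.F_eq {n : ℕ} {ε : ℝ} (hε : 0 < ε) {U : ℝ → Sn n} {F : ℝ → Rn n → ℂ} (h : Evol ε U F)
    (t : ℝ) (x : Rn n) : F t x = Complex.I * ε *
      fderiv ℝ (fun p : ℝ × Rn n => U p.1 p.2) (t, x) (1, 0) - Ho ε (U t) x := by
  rw [h.deriv_eq]
  have : (ε : ℂ) ≠ 0 := by exact_mod_cast hε.ne'
  field_simp
  rw [Complex.I_sq]; ring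

/-- derivative of the pairing with a compactly supported function -/
lemma pairing_deriv_compact {n : ℕ} {ε : ℝ} {U : ℝ → Sn n} {F : ℝ → Rn n → ℂ}
    (h : Evol ε U F) (φ : Sn n) (hφ : HasCompactSupport (⇑φ)) (t : ℝ) :
    HasDerivAt (fun s => ip φ (U s))
      (∫ x, conj (φ x) * fderiv ℝ (fun p : ℝ × Rn n => U p.1 p.2) (t, x) (1, 0)) t := by
  have hc : Continuous (fun p : ℝ × Rn n => fderiv ℝ (fun p : ℝ × Rn n => U p.1 p.2) p (1, 0)) := by
    have := h.smooth.continuous_fderiv (by simp)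
    fun_prop
  obtain ⟨C, hC⟩ := ((isCompact_Icc (a := t - 1) (b := t + 1)).prod hφ).exists_bound_of_continuousOn
    hc.continuousOn
  unfold ip
  refine (hasDerivAt_integral_of_dominated_loc_of_deriv_le (μ := (volume : Measure (Rn n)))
    (F := fun s x => conj (φ x) * U s x)
    (F' := fun s x => conj (φ x) * fderiv ℝ (fun p : ℝ × Rn n => U p.1 p.2) (s, x) (1, 0))
    (s := Set.Ioo (t - 1) (t + 1))
    (bound := fun x => ‖φ x‖ * C)
    (Ioo_mem_nhds (by linarith) (by linarith)) ?_ ?_ ?_ ?_ ?_ ?_).2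
  · refine Eventually.of_forall fun s => Continuous.aestronglyMeasurable ?_
    have h1 := φ.continuous
    have h2 := (U s).continuous
    fun_prop
  · have h1 := ((φ.memLp 2 volume).star).integrable_mul ((U t).memLp 2 volume)
    exact h1
  · have h1 := φ.continuous
    exact Continuous.aestronglyMeasurable ((Complex.continuous_conj.comp h1).mul
      (hc.comp (by fun_prop : Continuous fun x : Rn n => (t, x))))
  · refine Eventually.of_forall fun x s hs => ?_
    rw [norm_mul, RCLike.norm_conj]
    by_cases hx : x ∈ tsupport φ
    · exact mul_le_mul_of_nonneg_left (hC (s, x) ⟨⟨hs.1.le, hs.2.le⟩, hx⟩) (norm_nonneg _)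
    · have : φ x = 0 := image_eq_zero_of_notMem_tsupport hx
      simp [this]
  · exact φ.integrable.norm.mul_const _
  · refine Eventually.of_forall fun x s hs => ?_
    exact (slice_deriv h.smooth s x).const_mul _

lemma pairing_deriv_compact_cont {n : ℕ} {ε : ℝ} {U : ℝ → Sn n} {F : ℝ → Rn n → ℂ}
    (h : Evol ε U F) (φ : Sn n) (hφ : HasCompactSupport (⇑φ)) :
    Continuous (fun t => ∫ x, conj (φ x) *
      fderiv ℝ (fun p : ℝ × Rn n => U p.1 p.2) (t, x) (1, 0)) := by
  have hc : Continuous (fun p : ℝ × Rn n => fderiv ℝ (fun p : ℝ × Rn n => U p.1 p.2) p (1, 0)) := by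
    have := h.smooth.continuous_fderiv (by simp)
    fun_prop
  have h1 := φ.continuous
  refine continuous_parametric_integral_of_continuous (μ := (volume : Measure (Rn n)))
    (f := fun t x => conj (φ x) * fderiv ℝ (fun p : ℝ × Rn n => U p.1 p.2) (t, x) (1, 0))
    ?_ (s := tsupport φ) hφ |>.congr ?_
  · exact (Complex.continuous_conj.comp (h1.comp continuous_snd)).mul hc
  · intro t
    refine setIntegral_eq_integral_of_forall_compl_eq_zero fun x hx => ?_
    simp [image_eq_zero_of_notMem_tsupport hx]

lemma pairing_value {n : ℕ} {ε : ℝ} {U : ℝ → Sn n} {F : ℝ → Rn n → ℂ}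
    (h : Evol ε U F) (φ : Sn n) (t : ℝ) (hF : MemLp (F t) 2 volume) :
    ∫ x, conj (φ x) * fderiv ℝ (fun p : ℝ × Rn n => U p.1 p.2) (t, x) (1, 0) =
      -(Complex.I / ε) * (inner ℂ (tl φ) (hF.toLp (F t)) + inner ℂ (tl (Ho ε φ)) (tl (U t))) := by
  have e1 : inner ℂ (tl φ) (hF.toLp (F t)) = ip φ (F t) :=
    (ip_toLp φ (F t) (φ.memLp 2 volume) hF).symm
  have e2 : inner ℂ (tl (Ho ε φ)) (tl (U t)) = ip φ (Ho ε (U t)) := by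
    rw [ip_H]
    exact (ip_toLp _ _ ((Ho ε φ).memLp 2 volume) ((U t).memLp 2 volume)).symm
  rw [e1, e2]
  unfold ip
  rw [← integral_add, ← integral_const_mul]
  · refine integral_congr_ae (Eventually.of_forall fun x => ?_)
    simp only
    rw [h.deriv_eq]; ring
  · exact ((φ.memLp 2 volume).star).integrable_mul hF
  · exact ((φ.memLp 2 volume).star).integrable_mul ((Ho ε (U t)).memLp 2 volume)

lemma ip_tl {n : ℕ} (f g : Sn n) : ip f g = inner ℂ (tl f) (tl g) := ip_eq_inner f g

/-- derivative of the pairing with a Schwartz function -/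
lemma pairing_deriv {n : ℕ} {ε : ℝ} {U : ℝ → Sn n} {F : ℝ → Rn n → ℂ}
    (hε : 0 < ε) (h : Evol ε U F) (φ : Sn n) {s T K : ℝ}
    (hU : ∀ τ ∈ Set.Icc s T, ‖tl (U τ)‖ ≤ K)
    (f : ℝ → Lp ℂ 2 (volume : Measure (Rn n)))
    (hFm : ∀ τ ∈ Set.Icc s T, MemLp (F τ) 2 volume)
    (hf : ∀ τ (hτ : τ ∈ Set.Icc s T), f τ = (hFm τ hτ).toLp (F τ))
    (hF : ∀ τ ∈ Set.Icc s T, ‖f τ‖ ≤ K) :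
    ContinuousOn (fun τ => ip φ (U τ)) (Set.Icc s T) ∧
    ContinuousOn (fun τ => inner ℂ (tl φ) (f τ) + inner ℂ (tl (Ho ε φ)) (tl (U τ)))
      (Set.Icc s T) ∧
    ∀ t ∈ Set.Ioo s T, HasDerivAt (fun τ => ip φ (U τ))
      (-(Complex.I / ε) * (inner ℂ (tl φ) (f t) + inner ℂ (tl (Ho ε φ)) (tl (U t)))) t := by
  obtain ⟨ψ, hψ0, hψc, -, -⟩ := exists_bump n
  let r : ℕ → ℝ := fun m => 1 / ((m : ℝ) + 1)
  have hr0 : ∀ m, r m ≠ 0 := fun m => by simp only [r]; positivity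
  have hr : Tendsto r atTop (𝓝 0) := tendsto_one_div_add_atTop_nhds_zero_nat
  let φm : ℕ → Sn n := fun m => cut ψ (r m) φ
  have hφc : ∀ m, HasCompactSupport (⇑(φm m)) := fun m => cut_compact ψ hψc (r m) (hr0 m) φ
  have l1 : Tendsto (fun m => tl (φm m)) atTop (𝓝 (tl φ)) := by
    have := (cut_tendsto' ψ φ).comp hr
    simpa [hψ0] using! this
  have l2 : Tendsto (fun m => tl (Ho ε (φm m))) atTop (𝓝 (tl (Ho ε φ))) :=
    (H_cut_tendsto ε ψ hψ0 φ).comp hr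
  have u1 : TendstoUniformlyOn (fun m τ => ip (φm m) (U τ)) (fun τ => ip φ (U τ)) atTop
      (Set.Icc s T) := by
    rw [Metric.tendstoUniformlyOn_iff]
    intro δ hδ
    have h1 : Tendsto (fun m => ‖tl φ - tl (φm m)‖ * K) atTop (𝓝 0) := by
      have := (tendsto_const_nhds (x := tl φ)).sub l1
      simpa using this.norm.mul_const K
    filter_upwards [h1.eventually (gt_mem_nhds hδ)] with m hm τ hτ
    rw [dist_eq_norm, ip_tl, ip_tl, ← inner_sub_left]
    refine lt_of_le_of_lt (norm_inner_le_norm _ _) (lt_of_le_of_lt ?_ hm)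
    exact mul_le_mul_of_nonneg_left (hU τ hτ) (norm_nonneg _)
  have u2 : TendstoUniformlyOn (fun m τ => inner ℂ (tl (φm m)) (f τ) +
      inner ℂ (tl (Ho ε (φm m))) (tl (U τ)))
      (fun τ => inner ℂ (tl φ) (f τ) + inner ℂ (tl (Ho ε φ)) (tl (U τ))) atTop
      (Set.Icc s T) := by
    rw [Metric.tendstoUniformlyOn_iff]
    intro δ hδ
    have h1 : Tendsto (fun m => ‖tl φ - tl (φm m)‖ * K + ‖tl (Ho ε φ) - tl (Ho ε (φm m))‖ * K)
        atTop (𝓝 0) := by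
      have a1 := (tendsto_const_nhds (x := tl φ)).sub l1
      have a2 := (tendsto_const_nhds (x := tl (Ho ε φ))).sub l2
      simpa using (a1.norm.mul_const K).add (a2.norm.mul_const K)
    filter_upwards [h1.eventually (gt_mem_nhds hδ)] with m hm τ hτ
    rw [dist_eq_norm, add_sub_add_comm, ← inner_sub_left, ← inner_sub_left]
    refine lt_of_le_of_lt (norm_add_le _ _) (lt_of_le_of_lt ?_ hm)
    refine add_le_add ?_ ?_
    · exact (norm_inner_le_norm _ _).trans
        (mul_le_mul_of_nonneg_left (hF τ hτ) (norm_nonneg _))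
    · exact (norm_inner_le_norm _ _).trans
        (mul_le_mul_of_nonneg_left (hU τ hτ) (norm_nonneg _))
  have hval : ∀ m, ∀ τ ∈ Set.Icc s T, ∫ x, conj (φm m x) *
      fderiv ℝ (fun p : ℝ × Rn n => U p.1 p.2) (τ, x) (1, 0) =
      -(Complex.I / ε) * (inner ℂ (tl (φm m)) (f τ) +
        inner ℂ (tl (Ho ε (φm m))) (tl (U τ))) := by
    intro m τ hτ
    rw [pairing_value h (φm m) τ (hFm τ hτ), hf τ hτ]
  have u3 : TendstoUniformlyOn (fun m τ => -(Complex.I / ε) * (inner ℂ (tl (φm m)) (f τ) +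
      inner ℂ (tl (Ho ε (φm m))) (tl (U τ))))
      (fun τ => -(Complex.I / ε) * (inner ℂ (tl φ) (f τ) + inner ℂ (tl (Ho ε φ)) (tl (U τ)))) atTop
      (Set.Icc s T) :=
    (uniformContinuous_const_smul (-(Complex.I / (ε : ℂ)))).comp_tendstoUniformlyOn u2
  refine ⟨?_, ?_, ?_⟩
  · refine u1.continuousOn (Eventually.of_forall fun m => ?_).frequently
    exact fun τ _ => (pairing_deriv_compact h (φm m) (hφc m) τ).continuousAt.continuousWithinAt
  · · have c3 := u3.continuousOn (Eventually.of_forall fun m => by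
        refine ((pairing_deriv_compact_cont h (φm m) (hφc m)).continuousOn (s := Set.Icc s T)).congr
          fun τ hτ => (hval m τ hτ).symm).frequently
      have c4 := c3.const_smul ((-(Complex.I / (ε : ℂ)))⁻¹)
      refine c4.congr fun τ hτ => ?_
      have : -(Complex.I / (ε : ℂ)) ≠ 0 := by simp [hε.ne']
      exact (inv_mul_cancel_left₀ this _).symm
  · intro t ht
    refine hasDerivAt_of_tendstoUniformlyOn (f := fun m τ => ip (φm m) (U τ)) isOpen_Ioo (u3.mono Set.Ioo_subset_Icc_self)
      (Eventually.of_forall fun m τ hτ => ?_) (fun τ hτ => ?_) ht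
    · have := pairing_deriv_compact h (φm m) (hφc m) τ
      rw [hval m τ (Set.Ioo_subset_Icc_self hτ)] at this
      exact this
    · exact u1.tendsto_at (Set.Ioo_subset_Icc_self hτ)


set_option maxHeartbeats 1000000 in
lemma proj_energy {n : ℕ} {ε : ℝ} {U : ℝ → Sn n} {F : ℝ → Rn n → ℂ}
    (hε : 0 < ε) (h : Evol ε U F) {s T K : ℝ} (hsT : s ≤ T)
    (hU : ∀ τ ∈ Set.Icc s T, ‖tl (U τ)‖ ≤ K)
    (f : ℝ → Lp ℂ 2 (volume : Measure (Rn n)))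
    (hFm : ∀ τ ∈ Set.Icc s T, MemLp (F τ) 2 volume)
    (hf : ∀ τ (hτ : τ ∈ Set.Icc s T), f τ = (hFm τ hτ).toLp (F τ))
    (hF : ∀ τ ∈ Set.Icc s T, ‖f τ‖ ≤ K) (m : ℕ) :
    ContinuousOn (fun τ => (inner ℂ ((Pp n ε hε m).starProjection (tl (U τ))) (f τ)).im)
      (Set.Icc s T) ∧
    ‖(Pp n ε hε m).starProjection (tl (U T))‖ ^ 2 - ‖(Pp n ε hε m).starProjection (tl (U s))‖ ^ 2
    = ∫ τ in s..T, 2 / ε * (inner ℂ ((Pp n ε hε m).starProjection (tl (U τ))) (f τ)).im := by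
  classical
  set P := Pp n ε hε m with hP
  let b := stdOrthonormalBasis ℂ P
  have hβ : ∀ i, ∃ β ∈ Sp n ε hε m, tl β = (b i : Lp ℂ 2 (volume : Measure (Rn n))) :=
    fun i => (b i).2
  choose β hβm hβ using hβ
  let c : Fin (Module.finrank ℂ P) → ℝ → ℂ := fun i τ => ip (β i) (U τ)
  have hc : ∀ i τ, c i τ = inner ℂ (b i : Lp ℂ 2 (volume : Measure (Rn n))) (tl (U τ)) := by
    intro i τ
    simp only [c]
    rw [ip_tl, hβ]
  -- projection formula
  have hproj : ∀ v : Lp ℂ 2 (volume : Measure (Rn n)), P.starProjection v =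
      ∑ i, (inner ℂ (b i : Lp ℂ 2 (volume : Measure (Rn n))) v) •
        (b i : Lp ℂ 2 (volume : Measure (Rn n))) := by
    intro v
    rw [Submodule.starProjection_apply, OrthonormalBasis.orthogonalProjectionOnto_apply_eq_sum b]
    simp
  have hon : Orthonormal ℂ (fun i => (b i : Lp ℂ 2 (volume : Measure (Rn n)))) :=
    b.orthonormal.comp_linearIsometry P.subtypeₗᵢ
  have hnorm : ∀ τ, ‖P.starProjection (tl (U τ))‖ ^ 2 = ∑ i, ‖c i τ‖ ^ 2 := by
    intro τ
    have h1 : ((‖P.starProjection (tl (U τ))‖ ^ 2 : ℝ) : ℂ) = ((∑ i, ‖c i τ‖ ^ 2 : ℝ) : ℂ) := by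
      have h2 := inner_self_eq_norm_sq_to_K (𝕜 := ℂ) (P.starProjection (tl (U τ)))
      push_cast
      rw [show ((‖P.starProjection (tl (U τ))‖ : ℂ)) ^ 2 = _ from h2.symm, hproj,
        hon.inner_sum]
      refine Finset.sum_congr rfl fun i _ => ?_
      rw [← hc, ← Complex.normSq_eq_conj_mul_self, Complex.normSq_eq_norm_sq]
      push_cast; rfl
    exact_mod_cast h1
  have key := fun i => pairing_deriv hε h (β i) hU f hFm hf hF
  -- the hamiltonian part is real
  have hreal : ∀ τ, (∑ i, conj (c i τ) * inner ℂ (tl (Ho ε (β i))) (tl (U τ))).im = 0 := by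
    intro τ
    let φ : Sn n := ∑ i, c i τ • β i
    have hφm : φ ∈ Sp n ε hε m :=
      Submodule.sum_mem _ fun i _ => Submodule.smul_mem _ _ (hβm i)
    have e1 : tl φ = P.starProjection (tl (U τ)) := by
      rw [hproj]
      simp only [φ, map_sum, map_smul, hβ, hc]
    have e2 : ∑ i, conj (c i τ) * inner ℂ (tl (Ho ε (β i))) (tl (U τ)) =
        inner ℂ (tl (Ho ε φ)) (tl (U τ)) := by
      simp only [φ, map_sum, map_smul, sum_inner, inner_smul_left]
    have hmem : tl (Ho ε φ) ∈ P := ⟨_, Sp_H n ε hε m φ hφm, rfl⟩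
    have e3 : inner ℂ (tl (Ho ε φ)) (tl (U τ)) = inner ℂ (tl (Ho ε φ)) (tl φ) := by
      rw [e1]
      have : P.starProjection (tl (Ho ε φ)) = tl (Ho ε φ) :=
        Submodule.starProjection_eq_self_iff.2 hmem
      conv_lhs => rw [← this]
      exact Submodule.inner_starProjection_left_eq_right P _ _
    rw [e2, e3]
    have e4 : inner ℂ (tl (Ho ε φ)) (tl φ) = inner ℂ (tl φ) (tl (Ho ε φ)) := by
      rw [← ip_tl, ← ip_tl, ip_H]
    rw [← Complex.conj_eq_iff_im]
    conv_rhs => rw [e4]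
    exact inner_conj_symm _ _
  have hsum : ∀ τ, (∑ i, conj (c i τ) * inner ℂ (tl (β i)) (f τ))
      = inner ℂ (P.starProjection (tl (U τ))) (f τ) := by
    intro τ
    rw [hproj (tl (U τ)), sum_inner]
    refine Finset.sum_congr rfl fun i _ => ?_
    rw [inner_smul_left, hβ, hc]
  have hcont : ContinuousOn (fun τ => (inner ℂ (P.starProjection (tl (U τ))) (f τ)).im)
      (Set.Icc s T) := by
    have h1 : ContinuousOn (fun τ => (∑ i, conj (c i τ) * (inner ℂ (tl (β i)) (f τ) +
        inner ℂ (tl (Ho ε (β i))) (tl (U τ)))).im) (Set.Icc s T) := by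
      refine Complex.continuous_im.comp_continuousOn (continuousOn_finset_sum _ fun i _ => ?_)
      exact (Complex.continuous_conj.comp_continuousOn (key i).1).mul (key i).2.1
    refine h1.congr fun τ hτ => ?_
    simp only [mul_add, Finset.sum_add_distrib, Complex.add_im, hreal, hsum, add_zero]
  refine ⟨hcont, ?_⟩
  rw [intervalIntegral.integral_eq_sub_of_hasDerivAt_of_le hsT
    (f := fun τ => ‖P.starProjection (tl (U τ))‖ ^ 2)]
  · simp only [hnorm]
    exact continuousOn_finset_sum _ fun i _ => ((key i).1.norm).pow 2
  · intro t ht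
    simp only [hnorm]
    have hd : HasDerivAt (fun τ => ∑ i, ‖c i τ‖ ^ 2)
        (∑ i, 2 * inner ℝ (c i t) (-(Complex.I / ε) * (inner ℂ (tl (β i)) (f t) +
        inner ℂ (tl (Ho ε (β i))) (tl (U t))))) t :=
      HasDerivAt.fun_sum fun i _ => ((key i).2.2 t ht).norm_sq
    convert! hd using 1
    have e : ∀ z w : ℂ, inner ℝ z (-(Complex.I / ε) * w) = 1 / ε * (conj z * w).im := by
      intro z w
      rw [Complex.inner]
      simp [Complex.div_re, Complex.div_im, Complex.normSq_ofReal]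
      field_simp
      ring
    simp only [e]
    have e2 : ∑ i, (conj (c i t) * (inner ℂ (tl (β i)) (f t) +
        inner ℂ (tl (Ho ε (β i))) (tl (U t)))).im =
        (inner ℂ (P.starProjection (tl (U t))) (f t)).im := by
      rw [← Complex.im_sum]
      simp only [mul_add, Finset.sum_add_distrib, Complex.add_im, hreal, hsum, add_zero]
    rw [← Finset.mul_sum, ← Finset.mul_sum, e2]
    ring
  · refine ContinuousOn.intervalIntegrable ?_
    rw [Set.uIcc_of_le hsT]
    exact continuousOn_const.mul hcont

lemma norm_tl {n : ℕ} (φ : Sn n) : ‖tl φ‖ = √(nsq φ) := by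
  rw [nsq_eq_normS, Real.sqrt_sq (norm_nonneg _)]
  rfl

/-- The energy identity. -/
theorem energy_id {n : ℕ} {ε : ℝ} {U : ℝ → Sn n} {F : ℝ → Rn n → ℂ}
    (hε : 0 < ε) (h : Evol ε U F) {s T K : ℝ} (hsT : s ≤ T)
    (hU : ∀ τ ∈ Set.Icc s T, nsq (U τ) ≤ K)
    (hFm : ∀ τ ∈ Set.Icc s T, MemLp (F τ) 2 volume)
    (hF : ∀ τ ∈ Set.Icc s T, nsq (F τ) ≤ K) :
    IntervalIntegrable (fun τ => (ip (U τ) (F τ)).im) volume s T ∧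
    nsq (U T) - nsq (U s) = 2 / ε * ∫ τ in s..T, (ip (U τ) (F τ)).im := by
  classical
  let f : ℝ → Lp ℂ 2 (volume : Measure (Rn n)) := fun τ =>
    if hτ : τ ∈ Set.Icc s T then (hFm τ hτ).toLp (F τ) else 0
  have hf : ∀ τ (hτ : τ ∈ Set.Icc s T), f τ = (hFm τ hτ).toLp (F τ) := fun τ hτ => by
    simp only [f, hτ, dif_pos]
  have hU' : ∀ τ ∈ Set.Icc s T, ‖tl (U τ)‖ ≤ √K := fun τ hτ => by
    rw [norm_tl]; exact Real.sqrt_le_sqrt (hU τ hτ)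
  have hF' : ∀ τ ∈ Set.Icc s T, ‖f τ‖ ≤ √K := fun τ hτ => by
    rw [hf τ hτ]
    refine Real.le_sqrt_of_sq_le ?_
    rw [← nsq_toLp]; exact hF τ hτ
  have key := proj_energy hε h hsT hU' f hFm hf hF'
  have hip : ∀ τ ∈ Set.Icc s T, inner ℂ (tl (U τ)) (f τ) = ip (U τ) (F τ) := fun τ hτ => by
    rw [hf τ hτ, ip_toLp _ _ ((U τ).memLp 2 volume) (hFm τ hτ)]
    rfl
  have hlim : ∀ τ, Tendsto (fun m => (inner ℂ ((Pp n ε hε m).starProjection (tl (U τ))) (f τ)).im)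
      atTop (𝓝 (inner ℂ (tl (U τ)) (f τ)).im) := fun τ => by
    have := (Pp_tendsto n ε hε (tl (U τ))).inner (𝕜 := ℂ) (tendsto_const_nhds (x := f τ))
    exact (Complex.continuous_im.tendsto _).comp this
  have hIoc : Set.uIoc s T ⊆ Set.Icc s T := by
    rw [Set.uIoc_of_le hsT]; exact Set.Ioc_subset_Icc_self
  have hbd : ∀ m, ∀ τ ∈ Set.Icc s T,
      ‖(inner ℂ ((Pp n ε hε m).starProjection (tl (U τ))) (f τ)).im‖ ≤ √K * √K := fun m τ hτ => by
    refine (Complex.abs_im_le_norm _).trans ((norm_inner_le_norm _ _).trans ?_)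
    refine mul_le_mul ?_ (hF' τ hτ) (norm_nonneg _) (Real.sqrt_nonneg _)
    exact ((Pp n ε hε m).norm_starProjection_apply_le _).trans (hU' τ hτ)
  have hmeas : ∀ m, AEStronglyMeasurable
      (fun τ => (inner ℂ ((Pp n ε hε m).starProjection (tl (U τ))) (f τ)).im)
      (volume.restrict (Set.uIoc s T)) := fun m =>
    ((key m).1.mono hIoc).aestronglyMeasurable measurableSet_uIoc
  have hintg : IntervalIntegrable (fun τ => (inner ℂ (tl (U τ)) (f τ)).im) volume s T := by
    refine IntervalIntegrable.mono_fun' (g := fun _ => √K * √K) (by simp) ?_ ?_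
    · exact aestronglyMeasurable_of_tendsto_ae atTop hmeas (Eventually.of_forall hlim)
    · refine (ae_restrict_mem measurableSet_uIoc).mono fun τ hτ => ?_
      exact le_of_tendsto (hlim τ).norm (Eventually.of_forall fun m => hbd m τ (hIoc hτ))
  have hI : Tendsto (fun m => ∫ τ in s..T, 2 / ε *
      (inner ℂ ((Pp n ε hε m).starProjection (tl (U τ))) (f τ)).im) atTop
      (𝓝 (∫ τ in s..T, 2 / ε * (inner ℂ (tl (U τ)) (f τ)).im)) := by
    refine intervalIntegral.tendsto_integral_filter_of_dominated_convergence
      (fun _ => 2 / ε * (√K * √K)) ?_ ?_ (by simp) ?_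
    · exact Eventually.of_forall fun m => (hmeas m).const_mul _
    · refine Eventually.of_forall fun m => Eventually.of_forall fun τ hτ => ?_
      rw [norm_mul, Real.norm_of_nonneg (by positivity : 0 ≤ 2 / ε)]
      exact mul_le_mul_of_nonneg_left (hbd m τ (hIoc hτ)) (by positivity)
    · exact Eventually.of_forall fun τ _ => (hlim τ).const_mul _
  have hE : ∀ τ, Tendsto (fun m => ‖(Pp n ε hε m).starProjection (tl (U τ))‖ ^ 2) atTop
      (𝓝 (nsq (U τ))) := fun τ => by
    rw [nsq_eq_normS]
    exact ((Pp_tendsto n ε hε (tl (U τ))).norm).pow 2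
  have hEq : nsq (U T) - nsq (U s) = ∫ τ in s..T, 2 / ε * (inner ℂ (tl (U τ)) (f τ)).im := by
    refine tendsto_nhds_unique ((hE T).sub (hE s)) ?_
    simp only [fun m => (key m).2]
    exact hI
  constructor
  · refine hintg.congr fun τ hτ => ?_
    simp only [hip τ (hIoc hτ)]
  · rw [hEq, intervalIntegral.integral_const_mul]
    congr 1
    refine intervalIntegral.integral_congr fun τ hτ => ?_
    rw [Set.uIcc_of_le hsT] at hτ
    simp only [hip τ hτ]


/-- Schwartz function `conj φ * ψ` -/
def cm {n : ℕ} (φ ψ : Sn n) : Sn n :=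
  SchwartzMap.pairing ((ContinuousLinearMap.mul ℝ ℂ).comp (Complex.conjCLE : ℂ →L[ℝ] ℂ)) φ ψ

lemma cm_apply {n : ℕ} (φ ψ : Sn n) (x : Rn n) : cm φ ψ x = conj (φ x) * ψ x := rfl

lemma S_diff {n : ℕ} (φ : Sn n) (x : Rn n) : HasFDerivAt φ (fderiv ℝ φ x) x :=
  φ.differentiable.differentiableAt.hasFDerivAt

lemma D_cm {n : ℕ} (j : Fin n) (φ ψ : Sn n) : Do j (cm φ ψ) = cm (Do j φ) ψ + cm φ (Do j ψ) := by
  ext x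
  rw [SchwartzMap.add_apply, Do_apply, cm_apply, cm_apply, Do_apply, Do_apply]
  have h1 : HasFDerivAt (fun y => conj (φ y)) _ x :=
    (Complex.conjCLE : ℂ ≃L[ℝ] ℂ).hasFDerivAt.comp x (S_diff φ x)
  have h2 : HasFDerivAt (fun y => conj (φ y) * ψ y) _ x := h1.mul (S_diff ψ x)
  have h3 : (⇑(cm φ ψ)) = fun y => conj (φ y) * ψ y := rfl
  rw [h3, h2.fderiv]
  simp
  ring

lemma kint {n : ℕ} (hn : 2 ≤ n) :
    Integrable (fun y : Rn n => ‖y‖⁻¹ * ((1 + ‖y‖) ^ n)⁻¹) volume := by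
  have : Nonempty (Fin n) := ⟨⟨0, by omega⟩⟩
  have : Nontrivial (Rn n) := inferInstance
  refine (integrable_fun_norm_addHaar (volume : Measure (Rn n))
    (f := fun r : ℝ => r⁻¹ * ((1 + r) ^ n)⁻¹)).2 ?_
  rw [finrank_euclideanSpace, Fintype.card_fin]
  have h0 : Integrable (fun x : ℝ => (1 + ‖x‖) ^ (-(2 : ℝ))) volume :=
    integrable_one_add_norm (by simp)
  refine (h0.integrableOn (s := Set.Ioi (0 : ℝ))).mono' ?_ ?_
  · refine Measurable.aestronglyMeasurable ?_
    simp only [smul_eq_mul]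
    fun_prop
  · refine (ae_restrict_mem measurableSet_Ioi).mono fun r (hr : 0 < r) => ?_
    have e1 : (1 + ‖r‖) ^ (-(2 : ℝ)) = ((1 + r) ^ 2)⁻¹ := by
      rw [Real.norm_of_nonneg hr.le, Real.rpow_neg (by positivity)]
      norm_cast
    rw [e1, Real.norm_of_nonneg (by simp only [smul_eq_mul]; positivity), smul_eq_mul]
    obtain ⟨m, rfl⟩ : ∃ m, n = m + 2 := ⟨n - 2, by omega⟩
    have e2 : r ^ (m + 2 - 1) * (r⁻¹ * ((1 + r) ^ (m + 2))⁻¹) = r ^ m / (1 + r) ^ m * ((1 + r) ^ 2)⁻¹ := by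
      rw [show m + 2 - 1 = m + 1 by omega]
      field_simp
      ring
    rw [e2]
    have : r ^ m / (1 + r) ^ m ≤ 1 := by
      rw [div_le_one (by positivity)]
      exact pow_le_pow_left₀ hr.le (by linarith) m
    have h3 : 0 ≤ ((1 + r) ^ 2)⁻¹ := by positivity
    nlinarith

lemma S_decay {n : ℕ} {G : Type*} [NormedAddCommGroup G] [NormedSpace ℝ G]
    (q : SchwartzMap (Rn n) G) : ∃ C, 0 ≤ C ∧ ∀ x y : Rn n,
    ‖q (x - y)‖ ≤ C * (1 + ‖x‖) ^ n * ((1 + ‖y‖) ^ n)⁻¹ := by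
  refine ⟨2 ^ n * ((Finset.Iic (n, 0)).sup fun m => SchwartzMap.seminorm ℝ m.1 m.2) q, ?_,
    fun x y => ?_⟩
  rotate_left
  · have h := SchwartzMap.one_add_le_sup_seminorm_apply (𝕜 := ℝ) (m := (n, 0)) (k := n) (n := 0)
      le_rfl le_rfl q (x - y)
    rw [norm_iteratedFDeriv_zero] at h
    rw [← div_eq_mul_inv, le_div_iff₀ (by positivity)]
    have h1 : (1 + ‖y‖) ≤ (1 + ‖x‖) * (1 + ‖x - y‖) := by
      have : ‖y‖ ≤ ‖x‖ + ‖x - y‖ := by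
        have := norm_sub_le x (x - y)
        simpa using this
      nlinarith [norm_nonneg x, norm_nonneg (x - y)]
    have h2 : (1 + ‖y‖) ^ n ≤ (1 + ‖x‖) ^ n * (1 + ‖x - y‖) ^ n := by
      rw [← mul_pow]; exact pow_le_pow_left₀ (by positivity) h1 n
    calc ‖q (x - y)‖ * (1 + ‖y‖) ^ n ≤ ‖q (x - y)‖ * ((1 + ‖x‖) ^ n * (1 + ‖x - y‖) ^ n) := by gcongr
      _ = (1 + ‖x‖) ^ n * ((1 + ‖x - y‖) ^ n * ‖q (x - y)‖) := by ring
      _ ≤ (1 + ‖x‖) ^ n * _ := mul_le_mul_of_nonneg_left h (by positivity)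
      _ = _ := by rw [mul_comm]
  · positivity

/-- Newtonian-type potential -/
def pot {n : ℕ} (q : Sn n) (x : Rn n) : ℂ := ∫ y, ((‖x - y‖⁻¹ : ℝ) : ℂ) * q y

lemma pot_eq {n : ℕ} (q : Sn n) (x : Rn n) : pot q x = ∫ y, ((‖y‖⁻¹ : ℝ) : ℂ) * q (x - y) := by
  unfold pot
  rw [← integral_sub_left_eq_self _ volume x]
  simp

lemma kint_q {n : ℕ} (hn : 2 ≤ n) {G : Type*} [NormedAddCommGroup G] [NormedSpace ℝ G]
    (q : SchwartzMap (Rn n) G) (x : Rn n) :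
    Integrable (fun y : Rn n => ‖y‖⁻¹ * ‖q (x - y)‖) volume := by
  obtain ⟨C, hC, h⟩ := S_decay q
  refine ((kint hn).const_mul (C * (1 + ‖x‖) ^ n)).mono' ?_ (Eventually.of_forall fun y => ?_)
  · have := q.continuous
    have h2 : Measurable (fun y => ‖q (x - y)‖) := by
      apply Continuous.measurable; fun_prop
    exact ((measurable_norm.inv).mul h2).aestronglyMeasurable
  · rw [Real.norm_of_nonneg (by positivity)]
    calc ‖y‖⁻¹ * ‖q (x - y)‖ ≤ ‖y‖⁻¹ * (C * (1 + ‖x‖) ^ n * ((1 + ‖y‖) ^ n)⁻¹) := by gcongr; exact h x y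
      _ = _ := by ring

lemma kint_q' {n : ℕ} (hn : 2 ≤ n) {G : Type*} [NormedAddCommGroup G] [NormedSpace ℝ G]
    (q : SchwartzMap (Rn n) G) (x : Rn n) :
    Integrable (fun y : Rn n => ‖x - y‖⁻¹ * ‖q y‖) volume := by
  have := (kint_q hn q x).comp_sub_left x
  simpa using this

lemma pot_int {n : ℕ} (hn : 2 ≤ n) (q : Sn n) (x : Rn n) :
    Integrable (fun y : Rn n => ((‖x - y‖⁻¹ : ℝ) : ℂ) * q y) volume := by
  refine (kint_q' hn q x).mono' ?_ (Eventually.of_forall fun y => ?_)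
  · have := q.continuous.measurable
    refine Measurable.aestronglyMeasurable ?_
    fun_prop
  · simp

lemma pot_fderiv {n : ℕ} (hn : 2 ≤ n) (q : Sn n) (x : Rn n) :
    ∃ L : Rn n →L[ℝ] ℂ, HasFDerivAt (pot q) L x ∧ ∀ j, L (eb j) = pot (Do j q) x := by
  let q' : SchwartzMap (Rn n) (Rn n →L[ℝ] ℂ) := SchwartzMap.fderivCLM ℝ (Rn n) ℂ q
  have hq' : ∀ y, q' y = fderiv ℝ q y := fun y => rfl
  obtain ⟨C, hC, h⟩ := S_decay q'
  have hm : Measurable (fun y : Rn n => ‖y‖⁻¹) := by fun_prop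
  have hmC : Measurable (fun y : Rn n => ((‖y‖⁻¹ : ℝ) : ℂ)) := by fun_prop
  have hcq := q.continuous
  have hcq' := q'.continuous
  have hAS : ∀ z, AEStronglyMeasurable (fun y => ‖y‖⁻¹ • q' (z - y)) (volume : Measure (Rn n)) := by
    intro z
    refine hm.aestronglyMeasurable.smul (Continuous.aestronglyMeasurable ?_)
    fun_prop
  have hintg : Integrable (fun y => ‖y‖⁻¹ • q' (x - y)) (volume : Measure (Rn n)) := by
    refine (kint_q hn q' x).mono' (hAS x) (Eventually.of_forall fun y => ?_)
    rw [norm_smul]; simp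
  have key := hasFDerivAt_integral_of_dominated_of_fderiv_le (𝕜 := ℝ) (μ := (volume : Measure (Rn n)))
    (F := fun z y => ((‖y‖⁻¹ : ℝ) : ℂ) * q (z - y)) (x₀ := x) (s := Metric.ball x 1)
    (F' := fun z y => ‖y‖⁻¹ • q' (z - y))
    (bound := fun y => (C * (1 + (‖x‖ + 1)) ^ n) * (‖y‖⁻¹ * ((1 + ‖y‖) ^ n)⁻¹))
    (Metric.ball_mem_nhds x one_pos) ?_ ?_ (hAS x) ?_ ?_ ?_
  · refine ⟨_, key.congr_of_eventuallyEq (Eventually.of_forall fun z => pot_eq q z), fun j => ?_⟩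
    rw [ContinuousLinearMap.integral_apply hintg, pot_eq]
    congr 1
  · refine Eventually.of_forall fun z => (hmC.aestronglyMeasurable).mul (Continuous.aestronglyMeasurable ?_)
    fun_prop
  · have := (pot_int hn q x).comp_sub_left x
    simpa using this
  · refine Eventually.of_forall fun y z hz => ?_
    rw [norm_smul, norm_inv, norm_norm]
    have hz' : ‖z‖ ≤ ‖x‖ + 1 := by
      have h1 : ‖z - x‖ < 1 := by simpa [dist_eq_norm] using hz
      have h2 := norm_add_le (z - x) x
      simp only [sub_add_cancel] at h2
      linarith
    calc ‖y‖⁻¹ * ‖q' (z - y)‖ ≤ ‖y‖⁻¹ * (C * (1 + ‖z‖) ^ n * ((1 + ‖y‖) ^ n)⁻¹) := by gcongr; exact h z y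
      _ ≤ ‖y‖⁻¹ * (C * (1 + (‖x‖ + 1)) ^ n * ((1 + ‖y‖) ^ n)⁻¹) := by gcongr
      _ = _ := by ring
  · exact (kint hn).const_mul _
  · refine Eventually.of_forall fun y z hz => ?_
    have h1 : HasFDerivAt (fun z => q (z - y)) (q' (z - y)) z := by
      have := (S_diff q (z - y)).comp z ((hasFDerivAt_id z).sub_const y)
      simpa [Function.comp_def, hq'] using this
    have h2 := h1.const_smul (‖y‖⁻¹ : ℝ)
    have e : (fun z => ((‖y‖⁻¹ : ℝ) : ℂ) * q (z - y)) = (‖y‖⁻¹ : ℝ) • fun z => q (z - y) := by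
      ext z; simp
    rw [e]; exact h2

lemma pot_cont {n : ℕ} (hn : 2 ≤ n) (q : Sn n) : Continuous (pot q) :=
  continuous_iff_continuousAt.2 fun x => by
    obtain ⟨L, hL, _⟩ := pot_fderiv hn q x
    exact hL.continuousAt

lemma pot_diff {n : ℕ} (hn : 2 ≤ n) (q : Sn n) : Differentiable ℝ (pot q) := fun x => by
    obtain ⟨L, hL, _⟩ := pot_fderiv hn q x
    exact hL.differentiableAt

lemma pot_D {n : ℕ} (hn : 2 ≤ n) (q : Sn n) (x : Rn n) (j : Fin n) :
    fderiv ℝ (pot q) x (eb j) = pot (Do j q) x := by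
  obtain ⟨L, hL, h⟩ := pot_fderiv hn q x
  rw [hL.fderiv, h]

lemma hart_eq {n : ℕ} (φ : Sn n) (x : Rn n) : hartree 1 φ x = ∫ y, ‖x - y‖⁻¹ * ‖φ y‖ ^ 2 := by
  unfold hartree conv
  simp only [Real.rpow_neg_one, Complex.normSq_eq_norm_sq]

lemma hart_cast {n : ℕ} (φ : Sn n) (x : Rn n) : ((hartree 1 φ x : ℝ) : ℂ) = pot (cm φ φ) x := by
  rw [hart_eq, ← integral_complex_ofReal]
  unfold pot
  congr 1; ext y
  rw [cm_apply, ← Complex.normSq_eq_conj_mul_self, Complex.normSq_eq_norm_sq]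
  push_cast; rfl

lemma hart_nonneg {n : ℕ} (φ : Sn n) (x : Rn n) : 0 ≤ hartree 1 φ x := by
  rw [hart_eq]; exact integral_nonneg fun y => by positivity

lemma hart_int {n : ℕ} (hn : 2 ≤ n) (φ : Sn n) (x : Rn n) :
    Integrable (fun y => ‖x - y‖⁻¹ * ‖φ y‖ ^ 2) volume := by
  have := kint_q' hn (cm φ φ) x
  refine this.congr (Eventually.of_forall fun y => ?_)
  simp [cm_apply, sq]

lemma prod_int {n : ℕ} (hn : 2 ≤ n) (p q : Sn n) :
    Integrable (fun z : Rn n × Rn n => p z.1 * (((‖z.1 - z.2‖⁻¹ : ℝ) : ℂ) * q z.2))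
      ((volume : Measure (Rn n)).prod volume) := by
  have hp := p.continuous.measurable
  have hq := q.continuous.measurable
  have hm : Measurable (fun z : Rn n × Rn n => p z.1 * (((‖z.1 - z.2‖⁻¹ : ℝ) : ℂ) * q z.2)) := by
    fun_prop
  rw [integrable_prod_iff hm.aestronglyMeasurable]
  refine ⟨Eventually.of_forall fun x => (pot_int hn q x).const_mul (p x), ?_⟩
  obtain ⟨C, hC, h⟩ := S_decay q
  set K := ∫ y : Rn n, ‖y‖⁻¹ * ((1 + ‖y‖) ^ n)⁻¹
  have hb : ∀ x, ∫ y, ‖x - y‖⁻¹ * ‖q y‖ ≤ C * (1 + ‖x‖) ^ n * K := by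
    intro x
    rw [← integral_sub_left_eq_self _ volume x]
    simp only [sub_sub_cancel]
    rw [← integral_const_mul]
    refine integral_mono (kint_q hn q x) ((kint hn).const_mul _) fun y => ?_
    calc ‖y‖⁻¹ * ‖q (x - y)‖ ≤ ‖y‖⁻¹ * (C * (1 + ‖x‖) ^ n * ((1 + ‖y‖) ^ n)⁻¹) := by gcongr; exact h x y
      _ = _ := by ring
  have hpw : Integrable (fun x => ‖p x‖ * (1 + ‖x‖) ^ n) volume := by
    have : ∀ x : Rn n, ‖p x‖ * (1 + ‖x‖) ^ n ≤ 2 ^ n * (‖x‖ ^ 0 * ‖p x‖ + ‖x‖ ^ n * ‖p x‖) := by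
      intro x
      have h1 : (1 + ‖x‖) ^ n ≤ 2 ^ (n - 1) * (1 ^ n + ‖x‖ ^ n) := add_pow_le zero_le_one (norm_nonneg x) n
      have h2 : (2 : ℝ) ^ (n - 1) ≤ 2 ^ n := pow_le_pow_right₀ (by norm_num) (by omega)
      calc ‖p x‖ * (1 + ‖x‖) ^ n ≤ ‖p x‖ * (2 ^ n * (1 ^ n + ‖x‖ ^ n)) := by
            refine mul_le_mul_of_nonneg_left (h1.trans ?_) (norm_nonneg _)
            gcongr
        _ = _ := by rw [one_pow, pow_zero]; ring
    refine (((p.integrable_pow_mul volume 0).add (p.integrable_pow_mul volume n)).const_mul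
      (2 ^ n)).mono' ?_ (Eventually.of_forall fun x => ?_)
    · have := p.continuous
      apply Continuous.aestronglyMeasurable; fun_prop
    · rw [Real.norm_of_nonneg (by positivity)]; exact this x
  refine (hpw.const_mul (C * K)).mono' ?_ (Eventually.of_forall fun x => ?_)
  · exact hm.aestronglyMeasurable.norm.integral_prod_right'
  · rw [Real.norm_of_nonneg (integral_nonneg fun _ => norm_nonneg _)]
    simp only [norm_mul, Complex.norm_real, norm_inv, norm_norm]
    rw [integral_const_mul]
    calc _ ≤ ‖p x‖ * (C * (1 + ‖x‖) ^ n * K) := by gcongr; exact hb x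
      _ = _ := by ring

lemma pot_symm {n : ℕ} (hn : 2 ≤ n) (p q : Sn n) :
    ∫ x, p x * pot q x = ∫ x, pot p x * q x := by
  unfold pot
  simp only [← integral_const_mul, ← integral_mul_const]
  rw [integral_integral_swap (prod_int hn p q)]
  congr 1; ext x; congr 1; ext y
  rw [norm_sub_rev]; ring


lemma hardy_field {n : ℕ} (x : Rn n) {δ : ℝ} (hδ : 0 < δ) (j : Fin n) (y : Rn n) :
    ∃ L : Rn n →L[ℝ] ℝ, HasFDerivAt (fun y : Rn n => (y - x) j * (√(‖y - x‖ ^ 2 + δ ^ 2))⁻¹) L y ∧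
    L (eb j) = (√(‖y - x‖ ^ 2 + δ ^ 2))⁻¹ - ((y - x) j) ^ 2 * (√(‖y - x‖ ^ 2 + δ ^ 2))⁻¹ ^ 3 := by
  have h0 : HasFDerivAt (fun y : Rn n => y - x) (ContinuousLinearMap.id ℝ (Rn n)) y :=
    (hasFDerivAt_id y).sub_const x
  have h1 : HasFDerivAt (fun y : Rn n => (y - x) j) _ y :=
    (EuclideanSpace.proj (𝕜 := ℝ) j).hasFDerivAt.comp y h0
  have h2 : HasFDerivAt (fun y : Rn n => ‖y - x‖ ^ 2 + δ ^ 2) _ y := (h0.norm_sq).add_const (δ ^ 2)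
  have hpos : ‖y - x‖ ^ 2 + δ ^ 2 ≠ 0 := by positivity
  have h3 : HasFDerivAt (fun y : Rn n => √(‖y - x‖ ^ 2 + δ ^ 2)) _ y := h2.sqrt hpos
  have hs : √(‖y - x‖ ^ 2 + δ ^ 2) ≠ 0 := by positivity
  have h4 : HasFDerivAt (fun y : Rn n => (√(‖y - x‖ ^ 2 + δ ^ 2))⁻¹) _ y :=
    (hasDerivAt_inv hs).comp_hasFDerivAt y h3
  refine ⟨_, h1.mul h4, ?_⟩
  have e1 : inner ℝ (y - x) (eb j) = (y - x) j := by
    simp [eb, EuclideanSpace.inner_single_right]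
  simp only [ContinuousLinearMap.add_apply, ContinuousLinearMap.smul_apply,
    ContinuousLinearMap.comp_apply, ContinuousLinearMap.id_apply, innerSL_apply_apply, e1, smul_eq_mul]
  have e2 : (EuclideanSpace.proj (𝕜 := ℝ) j) (eb j) = 1 := by simp [eb]
  rw [e2]
  field_simp
  simp
  ring

/-- real part as a Schwartz function -/
def reS {n : ℕ} (q : Sn n) : SchwartzMap (Rn n) ℝ := SchwartzMap.postcompCLM (Complex.reCLM) q

lemma reS_apply {n : ℕ} (q : Sn n) (x : Rn n) : reS q x = (q x).re := rfl

lemma reS_fderiv {n : ℕ} (q : Sn n) (x : Rn n) (j : Fin n) :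
    fderiv ℝ (reS q) x (eb j) = (Do j q x).re := by
  have : HasFDerivAt (fun y => (q y).re) _ x := Complex.reCLM.hasFDerivAt.comp x (S_diff q x)
  have e : ⇑(reS q) = fun y => (q y).re := rfl
  rw [e, this.fderiv]
  rfl

lemma cm_self_re {n : ℕ} (φ : Sn n) (x : Rn n) : (cm φ φ x).re = ‖φ x‖ ^ 2 := by
  rw [cm_apply, ← Complex.normSq_eq_conj_mul_self, Complex.normSq_eq_norm_sq, Complex.ofReal_re]

lemma hardy_reg {n : ℕ} (hn : 2 ≤ n) (φ : Sn n) (x : Rn n) {δ : ℝ} (hδ : 0 < δ) :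
    ∫ y, (√(‖y - x‖ ^ 2 + δ ^ 2))⁻¹ * ‖φ y‖ ^ 2 ≤ ∑ j, ∫ y, ‖Do j (cm φ φ) y‖ := by
  set ρ := reS (cm φ φ) with hρ
  have hρv : ∀ y, ρ y = ‖φ y‖ ^ 2 := fun y => by rw [hρ, reS_apply, cm_self_re]
  set s : Rn n → ℝ := fun y => √(‖y - x‖ ^ 2 + δ ^ 2) with hs
  have hsp : ∀ y, 0 < s y := fun y => by simp only [hs]; positivity
  have hsc : Continuous s := by simp only [hs]; fun_prop
  have hsi : Continuous (fun y => (s y)⁻¹) := hsc.inv₀ fun y => (hsp y).ne'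
  have hs2 : ∀ y, (s y) ^ 2 = ‖y - x‖ ^ 2 + δ ^ 2 := fun y => Real.sq_sqrt (by positivity)
  have hsδ : ∀ y, (s y)⁻¹ ≤ δ⁻¹ := fun y => by
    apply inv_anti₀ hδ
    apply Real.le_sqrt_of_sq_le; nlinarith [sq_nonneg ‖y - x‖]
  let g : Fin n → Rn n → ℝ := fun j y => (y - x) j * (s y)⁻¹
  have hg1 : ∀ j y, |(y - x) j| ≤ s y := fun j y => by
    refine (PiLp.norm_apply_le (y - x) j).trans ?_
    apply Real.le_sqrt_of_sq_le; nlinarith [sq_nonneg δ]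
  have hgb : ∀ j y, ‖g j y‖ ≤ 1 := fun j y => by
    simp only [g]
    rw [norm_mul, norm_inv, Real.norm_of_nonneg (hsp y).le, ← div_eq_mul_inv]
    exact (div_le_one (hsp y)).2 (hg1 j y)
  have hgc : ∀ j, Continuous (g j) := fun j => by
    have : Continuous fun y : Rn n => (y - x) j := by fun_prop
    exact this.mul hsi
  have hgd : ∀ j y, fderiv ℝ (g j) y (eb j) = (s y)⁻¹ - ((y - x) j) ^ 2 * (s y)⁻¹ ^ 3 := fun j y => by
    obtain ⟨L, hL, h⟩ := hardy_field x hδ j y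
    have : fderiv ℝ (g j) y = L := hL.fderiv
    rw [this, h]
  have hgd' : ∀ j y, DifferentiableAt ℝ (g j) y := fun j y => by
    obtain ⟨L, hL, h⟩ := hardy_field x hδ j y
    exact hL.differentiableAt
  have hdb : ∀ j y, ‖fderiv ℝ (g j) y (eb j)‖ ≤ 2 * δ⁻¹ := fun j y => by
    rw [hgd]
    have h1 : ((y - x) j) ^ 2 * (s y)⁻¹ ^ 3 ≤ (s y)⁻¹ := by
      have : ((y - x) j) ^ 2 ≤ s y ^ 2 := by
        rw [← sq_abs]; exact pow_le_pow_left₀ (abs_nonneg _) (hg1 j y) 2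
      calc _ ≤ s y ^ 2 * (s y)⁻¹ ^ 3 := by gcongr
        _ = _ := by have := (hsp y).ne'; field_simp
    have h2 : 0 ≤ ((y - x) j) ^ 2 * (s y)⁻¹ ^ 3 := by have := hsp y; positivity
    have h3 := (inv_pos.2 (hsp y)).le
    rw [Real.norm_eq_abs, abs_le]
    constructor <;> nlinarith [hsδ y]
  have hdc : ∀ j, Continuous (fun y => fderiv ℝ (g j) y (eb j)) := fun j => by
    simp only [hgd]
    have : Continuous fun y : Rn n => (y - x) j := by fun_prop
    exact hsi.sub ((this.pow 2).mul (hsi.pow 3))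
  have hρi : Integrable ρ volume := ρ.integrable
  have hρdi : ∀ j, Integrable (fun y => fderiv ℝ ρ y (eb j)) volume := fun j => by
    simp only [hρ, reS_fderiv]
    exact (Do j (cm φ φ)).integrable.re
  have i1 : ∀ j, Integrable (fun y => fderiv ℝ (g j) y (eb j) * ρ y) volume := fun j =>
    hρi.bdd_mul (hdc j).aestronglyMeasurable (Eventually.of_forall (hdb j))
  have i2 : ∀ j, Integrable (fun y => g j y * fderiv ℝ ρ y (eb j)) volume := fun j =>
    (hρdi j).bdd_mul (hgc j).aestronglyMeasurable (Eventually.of_forall (hgb j))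
  have i3 : ∀ j, Integrable (fun y => g j y * ρ y) volume := fun j =>
    hρi.bdd_mul (hgc j).aestronglyMeasurable (Eventually.of_forall (hgb j))
  have ibp : ∀ j, ∫ y, fderiv ℝ (g j) y (eb j) * ρ y = - ∫ y, g j y * fderiv ℝ ρ y (eb j) := fun j => by
    rw [integral_mul_fderiv_eq_neg_fderiv_mul_of_integrable (i1 j) (i2 j) (i3 j)
      (fun y _ => hgd' j y) (fun y _ => ρ.differentiable.differentiableAt), neg_neg]
  have step1 : ∫ y, (s y)⁻¹ * ‖φ y‖ ^ 2 ≤ ∫ y, ∑ j, fderiv ℝ (g j) y (eb j) * ρ y := by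
    refine integral_mono ?_ (integrable_finset_sum _ fun j _ => i1 j) fun y => ?_
    · have : Integrable (fun y => (s y)⁻¹ * ρ y) volume :=
        hρi.bdd_mul (c := δ⁻¹) hsi.aestronglyMeasurable (Eventually.of_forall fun y => by
          rw [norm_inv, Real.norm_of_nonneg (hsp y).le]; exact hsδ y)
      simpa only [hρv] using this
    · simp only
      rw [← Finset.sum_mul, ← hρv]
      have h0 : 0 ≤ ρ y := by rw [hρv]; positivity
      refine mul_le_mul_of_nonneg_right ?_ h0
      simp only [hgd]
      rw [Finset.sum_sub_distrib, ← Finset.sum_mul]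
      have hnn : ∑ j, ((y - x) j) ^ 2 = ‖y - x‖ ^ 2 := by
        rw [EuclideanSpace.norm_sq_eq]; simp
      rw [hnn]
      simp only [Finset.sum_const, Finset.card_univ, Fintype.card_fin, nsmul_eq_mul]
      have h3 := (inv_pos.2 (hsp y))
      have h4 : ‖y - x‖ ^ 2 * (s y)⁻¹ ^ 3 ≤ (s y)⁻¹ := by
        calc _ ≤ s y ^ 2 * (s y)⁻¹ ^ 3 := by
              refine mul_le_mul_of_nonneg_right ?_ (pow_pos h3 3).le
              rw [hs2]; nlinarith [sq_nonneg δ]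
          _ = _ := by have := (hsp y).ne'; field_simp
      have h5 : (2 : ℝ) ≤ n := by exact_mod_cast hn
      nlinarith
  refine step1.trans ?_
  rw [integral_finset_sum _ fun j _ => i1 j]
  refine Finset.sum_le_sum fun j _ => ?_
  rw [ibp, ← integral_neg]
  refine integral_mono (i2 j).neg (Do j (cm φ φ)).integrable.norm fun y => ?_
  simp only [hρ, reS_fderiv]
  have h1 : |g j y * (Do j (cm φ φ) y).re| ≤ 1 * ‖Do j (cm φ φ) y‖ := by
    rw [abs_mul]
    exact mul_le_mul (hgb j y) (Complex.abs_re_le_norm _) (abs_nonneg _) zero_le_one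
  have := neg_abs_le (g j y * (Do j (cm φ φ) y).re)
  linarith

lemma hardy {n : ℕ} (hn : 2 ≤ n) (φ : Sn n) (x : Rn n) :
    hartree 1 φ x ≤ ∑ j, ∫ y, ‖Do j (cm φ φ) y‖ := by
  rw [hart_eq]
  have hlim : Tendsto (fun m : ℕ => ∫ y, (√(‖y - x‖ ^ 2 + (1 / ((m : ℝ) + 1)) ^ 2))⁻¹ * ‖φ y‖ ^ 2) atTop
      (𝓝 (∫ y, ‖x - y‖⁻¹ * ‖φ y‖ ^ 2)) := by
    have hn1 : Nonempty (Fin n) := ⟨⟨0, by omega⟩⟩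
    have hnt : Nontrivial (Rn n) := inferInstance
    have hae : ∀ᵐ y : Rn n ∂volume, y ≠ x := by
      simp [ae_iff, measure_singleton]
    refine tendsto_integral_of_dominated_convergence (fun y => ‖x - y‖⁻¹ * ‖φ y‖ ^ 2) ?_ (hart_int hn φ x) ?_ ?_
    · intro m
      have := φ.continuous.measurable
      refine Measurable.aestronglyMeasurable ?_
      fun_prop
    · intro m
      refine hae.mono fun y hy => ?_
      rw [Real.norm_of_nonneg (by positivity), norm_sub_rev x y]
      have hp : 0 < ‖y - x‖ := norm_pos_iff.2 (sub_ne_zero.2 hy)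
      gcongr
      apply Real.le_sqrt_of_sq_le; have : 0 ≤ (1 / ((m : ℝ) + 1)) ^ 2 := by positivity
      linarith
    · refine hae.mono fun y hy => ?_
      have hp : 0 < ‖y - x‖ := norm_pos_iff.2 (sub_ne_zero.2 hy)
      have h1 : Tendsto (fun m : ℕ => √(‖y - x‖ ^ 2 + (1 / ((m : ℝ) + 1)) ^ 2)) atTop (𝓝 ‖x - y‖) := by
        have h2 := (tendsto_one_div_add_atTop_nhds_zero_nat (𝕜 := ℝ)).pow 2
        have h3 := (h2.const_add (‖y - x‖ ^ 2)).sqrt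
        rw [norm_sub_rev x y]
        simpa [Real.sqrt_sq hp.le] using h3
      exact (h1.inv₀ (by rw [norm_sub_rev]; exact hp.ne')).mul_const _
  exact le_of_tendsto hlim (Eventually.of_forall fun m => hardy_reg hn φ x (by positivity))

lemma norm_D_cm_le {n : ℕ} (j : Fin n) (φ : Sn n) (y : Rn n) :
    ‖Do j (cm φ φ) y‖ ≤ 2 * (‖φ y‖ * ‖Do j φ y‖) := by
  rw [D_cm, SchwartzMap.add_apply, cm_apply, cm_apply]
  refine (norm_add_le _ _).trans ?_
  simp only [norm_mul, RCLike.norm_conj]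
  linarith

lemma int_norm_mul_le {n : ℕ} (φ ψ : Sn n) :
    ∫ y, ‖φ y‖ * ‖ψ y‖ ≤ √(nsq φ) * √(nsq ψ) := by
  have h := norm_ip_le (fun y => (‖φ y‖ : ℂ)) (fun y => (‖ψ y‖ : ℂ))
    ((φ.memLp 2 volume).norm.ofReal) ((ψ.memLp 2 volume).norm.ofReal)
  have e1 : ip (fun y => (‖φ y‖ : ℂ)) (fun y => (‖ψ y‖ : ℂ)) = ((∫ y, ‖φ y‖ * ‖ψ y‖ : ℝ) : ℂ) := by
    unfold ip
    rw [← integral_complex_ofReal]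
    simp
  have e2 : ∀ χ : Sn n, nsq (fun y => (‖χ y‖ : ℂ)) = nsq χ := fun χ => by simp [nsq]
  rw [e1, e2, e2, Complex.norm_real] at h
  exact (le_abs_self _).trans h

lemma int_norm_mul {n : ℕ} (φ ψ : Sn n) : Integrable (fun y => ‖φ y‖ * ‖ψ y‖) volume := by
  have := (cm φ ψ).integrable (μ := volume).norm
  refine this.congr (Eventually.of_forall fun y => ?_)
  simp [cm_apply]

/-- weighted Hardy -/
lemma hardy_w {n : ℕ} (hn : 2 ≤ n) (φ : Sn n) (v : Fin n → Sn n) (β : ℝ) (hβ : 0 ≤ β)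
    (hv : ∀ j y, β * ‖Do j (cm φ φ) y‖ ≤ 2 * (‖φ y‖ * ‖v j y‖)) (x : Rn n) :
    β * hartree 1 φ x ≤ 2 * √(nsq φ) * ∑ j, √(nsq (v j)) := by
  calc β * hartree 1 φ x ≤ β * ∑ j, ∫ y, ‖Do j (cm φ φ) y‖ := by gcongr; exact hardy hn φ x
    _ = ∑ j, ∫ y, β * ‖Do j (cm φ φ) y‖ := by
        rw [Finset.mul_sum]; simp only [integral_const_mul]
    _ ≤ ∑ j, 2 * (√(nsq φ) * √(nsq (v j))) := by
        refine Finset.sum_le_sum fun j _ => ?_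
        refine (integral_mono ((Do j (cm φ φ)).integrable.norm.const_mul β)
          ((int_norm_mul φ (v j)).const_mul 2) (hv j)).trans ?_
        rw [integral_const_mul]
        have := int_norm_mul_le φ (v j)
        linarith
    _ = _ := by rw [Finset.mul_sum]; refine Finset.sum_congr rfl fun j _ => by ring


lemma cs_kernel {n : ℕ} (hn : 2 ≤ n) (φ v : Sn n) (x : Rn n) :
    (∫ y, ‖x - y‖⁻¹ * (‖φ y‖ * ‖v y‖)) ^ 2 ≤ hartree 1 φ x * hartree 1 v x := by
  have hM : ∀ χ : Sn n, MemLp (fun y => ((√(‖x - y‖⁻¹) * ‖χ y‖ : ℝ) : ℂ)) 2 volume := by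
    intro χ
    refine MemLp.ofReal (f := fun y => √(‖x - y‖⁻¹) * ‖χ y‖) ?_
    have := χ.continuous.measurable
    rw [memLp_two_iff_integrable_sq (by apply Measurable.aestronglyMeasurable; fun_prop)]
    refine (hart_int hn χ x).congr (Eventually.of_forall fun y => ?_)
    simp only [mul_pow]; rw [Real.sq_sqrt (by positivity)]
  have h := norm_ip_le _ _ (hM φ) (hM v)
  have e1 : ip (fun y => ((√(‖x - y‖⁻¹) * ‖φ y‖ : ℝ) : ℂ)) (fun y => ((√(‖x - y‖⁻¹) * ‖v y‖ : ℝ) : ℂ))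
      = ((∫ y, ‖x - y‖⁻¹ * (‖φ y‖ * ‖v y‖) : ℝ) : ℂ) := by
    unfold ip
    rw [← integral_complex_ofReal]
    congr 1; ext y
    rw [Complex.conj_ofReal, ← Complex.ofReal_mul]
    congr 1
    rw [show √(‖x - y‖⁻¹) * ‖φ y‖ * (√(‖x - y‖⁻¹) * ‖v y‖) = (√(‖x - y‖⁻¹)) ^ 2 * (‖φ y‖ * ‖v y‖) by ring,
      Real.sq_sqrt (by positivity)]
  have e2 : ∀ χ : Sn n, nsq (fun y => ((√(‖x - y‖⁻¹) * ‖χ y‖ : ℝ) : ℂ)) = hartree 1 χ x := by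
    intro χ
    rw [hart_eq]; unfold nsq
    congr 1; ext y
    rw [Complex.norm_real, Real.norm_of_nonneg (by positivity), mul_pow, Real.sq_sqrt (by positivity)]
  rw [e1, e2, e2, Complex.norm_real, Real.norm_of_nonneg (integral_nonneg fun _ => by positivity)] at h
  calc _ ≤ (√(hartree 1 φ x) * √(hartree 1 v x)) ^ 2 :=
        pow_le_pow_left₀ (integral_nonneg fun _ => by positivity) h 2
    _ = _ := by rw [mul_pow, Real.sq_sqrt (hart_nonneg _ _), Real.sq_sqrt (hart_nonneg _ _)]

lemma pot_norm_le {n : ℕ} (hn : 2 ≤ n) (q φ v : Sn n) (β : ℂ)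
    (hv : ∀ y, ‖β * q y‖ ≤ 2 * (‖φ y‖ * ‖v y‖)) (x : Rn n) :
    ‖β * pot q x‖ ^ 2 ≤ 4 * (hartree 1 φ x * hartree 1 v x) := by
  have h1 : ‖β * pot q x‖ ≤ 2 * ∫ y, ‖x - y‖⁻¹ * (‖φ y‖ * ‖v y‖) := by
    unfold pot
    rw [← integral_const_mul, ← integral_const_mul]
    refine norm_integral_le_of_norm_le ?_ (Eventually.of_forall fun y => ?_)
    · have := kint_q' hn (cm φ v) x
      refine (this.const_mul 2).congr (Eventually.of_forall fun y => ?_)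
      simp [cm_apply]
    · rw [show β * (((‖x - y‖⁻¹ : ℝ) : ℂ) * q y) = ((‖x - y‖⁻¹ : ℝ) : ℂ) * (β * q y) by ring, norm_mul,
        Complex.norm_real, Real.norm_of_nonneg (by positivity)]
      calc _ ≤ ‖x - y‖⁻¹ * (2 * (‖φ y‖ * ‖v y‖)) := by gcongr; exact hv y
        _ = _ := by ring
  calc ‖β * pot q x‖ ^ 2 ≤ (2 * ∫ y, ‖x - y‖⁻¹ * (‖φ y‖ * ‖v y‖)) ^ 2 := pow_le_pow_left₀ (norm_nonneg _) h1 2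
    _ = 4 * (∫ y, ‖x - y‖⁻¹ * (‖φ y‖ * ‖v y‖)) ^ 2 := by ring
    _ ≤ _ := by gcongr; exact cs_kernel hn φ v x

lemma hart_symm {n : ℕ} (hn : 2 ≤ n) (φ v : Sn n) :
    ∫ x, ‖φ x‖ ^ 2 * hartree 1 v x = ∫ x, ‖v x‖ ^ 2 * hartree 1 φ x := by
  have h := pot_symm hn (cm φ φ) (cm v v)
  have e : ∀ χ : Sn n, ∀ x, cm χ χ x = ((‖χ x‖ ^ 2 : ℝ) : ℂ) := fun χ x => by
    rw [cm_apply, ← Complex.normSq_eq_conj_mul_self, Complex.normSq_eq_norm_sq]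
  simp only [← hart_cast, e, ← Complex.ofReal_mul] at h
  rw [integral_complex_ofReal, integral_complex_ofReal] at h
  have := Complex.ofReal_injective h
  rw [this]; congr 1; ext x; ring

lemma hart_cont {n : ℕ} (hn : 2 ≤ n) (φ : Sn n) : Continuous (hartree 1 φ) := by
  have h := Complex.continuous_re.comp (pot_cont hn (cm φ φ))
  refine h.congr fun x => ?_
  simp only [Function.comp_apply, ← hart_cast, Complex.ofReal_re]

lemma nsq_int {n : ℕ} (φ : Sn n) : Integrable (fun x => ‖φ x‖ ^ 2) volume :=
  (φ.memLp 2 volume).integrable_norm_pow (by norm_num)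

lemma hart_bdd {n : ℕ} (hn : 2 ≤ n) (φ : Sn n) (x : Rn n) :
    hartree 1 φ x ≤ 2 * √(nsq φ) * ∑ j, √(nsq (Do j φ)) := by
  have := hardy_w hn φ (fun j => Do j φ) 1 zero_le_one (fun j y => by
    rw [one_mul]; exact norm_D_cm_le j φ y) x
  simpa using this

/-- multiplication by a bounded potential -/
lemma mul_bdd {n : ℕ} (a : Rn n → ℂ) (ha : Continuous a) {A : ℝ} (hA : ∀ x, ‖a x‖ ≤ A) (φ : Sn n) :
    MemLp (fun x => a x * φ x) 2 volume ∧ nsq (fun x => a x * φ x) ≤ A ^ 2 * nsq φ := by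
  have h1 : MemLp (fun x => a x * φ x) 2 volume := by
    have := (φ.memLp 2 volume).const_mul (A : ℂ)
    refine this.mono ?_ (Eventually.of_forall fun x => ?_)
    · exact (ha.mul φ.continuous).aestronglyMeasurable
    · rw [norm_mul, norm_mul, Complex.norm_real]
      gcongr
      exact (hA x).trans (le_abs_self _)
  refine ⟨h1, ?_⟩
  unfold nsq
  rw [← integral_const_mul]
  refine integral_mono (h1.integrable_norm_pow (by norm_num)) ((nsq_int φ).const_mul _) fun x => ?_
  simp only
  rw [norm_mul, mul_pow]
  gcongr
  exact hA x

/-- Lemma P -/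
lemma lemP {n : ℕ} (hn : 2 ≤ n) (q φ v : Sn n) (β : ℂ) {A : ℝ} (hA : ∀ x, hartree 1 φ x ≤ A)
    (hv : ∀ y, ‖β * q y‖ ≤ 2 * (‖φ y‖ * ‖v y‖)) :
    MemLp (fun x => β * pot q x * φ x) 2 volume ∧
    nsq (fun x => β * pot q x * φ x) ≤ (2 * A) ^ 2 * nsq v := by
  have hA0 : 0 ≤ A := (hart_nonneg φ 0).trans (hA 0)
  have hvb := hart_bdd hn v
  set B := 2 * √(nsq v) * ∑ j, √(nsq (Do j v))
  have hB0 : 0 ≤ B := (hart_nonneg v 0).trans (hvb 0)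
  have hp := pot_norm_le hn q φ v β hv
  have h1 := (mul_bdd (fun x => β * pot q x) (continuous_const.mul (pot_cont hn q)) (A := √(4 * (A * B)))
    (fun x => by
      apply Real.le_sqrt_of_sq_le
      refine (hp x).trans ?_
      have := mul_le_mul (hA x) (hvb x) (hart_nonneg _ _) hA0
      linarith) φ).1
  refine ⟨h1, ?_⟩
  have hi : ∀ χ ψ : Sn n, Integrable (fun x => ‖χ x‖ ^ 2 * hartree 1 ψ x) volume := fun χ ψ => by
    refine (nsq_int χ).mul_bdd (c := 2 * √(nsq ψ) * ∑ j, √(nsq (Do j ψ))) (hart_cont hn ψ).aestronglyMeasurable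
      (Eventually.of_forall fun x => ?_)
    rw [Real.norm_of_nonneg (hart_nonneg _ _)]; exact hart_bdd hn ψ x
  calc nsq (fun x => β * pot q x * φ x) ≤ ∫ x, (4 * A) * (‖φ x‖ ^ 2 * hartree 1 v x) := by
        unfold nsq
        refine integral_mono (h1.integrable_norm_pow (by norm_num)) ((hi φ v).const_mul _) fun x => ?_
        simp only
        rw [norm_mul, mul_pow]
        have h2 := hp x
        have h3 : hartree 1 φ x * hartree 1 v x ≤ A * hartree 1 v x :=
          mul_le_mul_of_nonneg_right (hA x) (hart_nonneg _ _)
        have h4 : ‖β * pot q x‖ ^ 2 ≤ 4 * (A * hartree 1 v x) := by linarith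
        have h5 := mul_le_mul_of_nonneg_right h4 (sq_nonneg ‖φ x‖)
        linarith
    _ = 4 * A * ∫ x, ‖v x‖ ^ 2 * hartree 1 φ x := by
        rw [integral_const_mul, hart_symm hn]
    _ ≤ 4 * A * ∫ x, ‖v x‖ ^ 2 * A := by
        gcongr
        · exact hi v φ
        · exact (nsq_int v).mul_const A
        · intro x
          simp only
          gcongr
          exact hA x
    _ = _ := by rw [integral_mul_const]; unfold nsq; ring


lemma joint_D {n : ℕ} {U : ℝ → Sn n} (hs : ContDiff ℝ (⊤ : ℕ∞) (fun p : ℝ × Rn n => U p.1 p.2))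
    (j : Fin n) (t : ℝ) (x : Rn n) :
    Do j (U t) x = fderiv ℝ (fun p : ℝ × Rn n => U p.1 p.2) (t, x) (0, eb j) := by
  have h1 : HasFDerivAt (fun p : ℝ × Rn n => U p.1 p.2) _ (t, x) :=
    (hs.differentiable (by simp)).differentiableAt.hasFDerivAt
  have h2 : HasFDerivAt (fun y : Rn n => (t, y)) (ContinuousLinearMap.inr ℝ ℝ (Rn n)) x :=
    hasFDerivAt_prodMk_right t x
  have h3 : HasFDerivAt (fun y => U t y) _ x := h1.comp x h2
  rw [Do_apply]
  have : fderiv ℝ (U t) x = _ := h3.fderiv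
  rw [this]; rfl

lemma Evol.F_diff {n : ℕ} {ε : ℝ} (hε : 0 < ε) {U : ℝ → Sn n} {F : ℝ → Rn n → ℂ} (h : Evol ε U F)
    (t : ℝ) : Differentiable ℝ (F t) := by
  have e : F t = fun x => Complex.I * ε *
      fderiv ℝ (fun p : ℝ × Rn n => U p.1 p.2) (t, x) (1, 0) - Ho ε (U t) x := by
    ext x; exact h.F_eq hε t x
  rw [e]
  have h1 : ContDiff ℝ 1 (fun p : ℝ × Rn n => fderiv ℝ (fun p : ℝ × Rn n => U p.1 p.2) p) :=
    h.smooth.fderiv_right (by norm_cast)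
  have h2 := (h1.differentiable one_ne_zero)
  have h3 := (Ho ε (U t)).differentiable
  fun_prop

lemma Evol.D_time {n : ℕ} {ε : ℝ} (hε : 0 < ε) {U : ℝ → Sn n} {F : ℝ → Rn n → ℂ} (h : Evol ε U F)
    (j : Fin n) (t : ℝ) (x : Rn n) :
    HasDerivAt (fun s => Do j (U s) x)
      (-(Complex.I / ε) * (fderiv ℝ (F t) x (eb j) + Do j (Ho ε (U t)) x)) t := by
  set w : ℝ × Rn n → ℂ := fun p => U p.1 p.2 with hw
  have h1 : ContDiff ℝ 1 (fun p : ℝ × Rn n => fderiv ℝ w p) := h.smooth.fderiv_right (by norm_cast)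
  have h2 : HasFDerivAt (fderiv ℝ w) (fderiv ℝ (fderiv ℝ w) (t, x)) (t, x) :=
    (h1.differentiable one_ne_zero).differentiableAt.hasFDerivAt
  have hsym : fderiv ℝ (fderiv ℝ w) (t, x) (1, 0) (0, eb j) =
      fderiv ℝ (fderiv ℝ w) (t, x) (0, eb j) (1, 0) := by
    have := (h.smooth.contDiffAt (x := (t, x))).isSymmSndFDerivAt (by
      simp only [minSmoothness_of_isRCLikeNormedField]; exact WithTop.coe_le_coe.2 (le_top : (2 : ℕ∞) ≤ ⊤))
    exact this.eq _ _
  have h3 : HasDerivAt (fun s : ℝ => (s, x)) ((1 : ℝ), (0 : Rn n)) t :=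
    (hasDerivAt_id t).prodMk (hasDerivAt_const t x)
  have h4 : HasDerivAt (fun s => fderiv ℝ w (s, x)) _ t := h2.comp_hasDerivAt t h3
  have h5 : HasDerivAt (fun s => fderiv ℝ w (s, x) (0, eb j)) _ t := h4.clm_apply (hasDerivAt_const t _)
  have e : (fun s => Do j (U s) x) = fun s => fderiv ℝ w (s, x) (0, eb j) := by
    ext s; exact joint_D h.smooth j s x
  rw [e]
  convert! h5 using 1
  rw [map_zero, add_zero, hsym]
  -- other side
  have h6 : HasFDerivAt (fun y : Rn n => (t, y)) (ContinuousLinearMap.inr ℝ ℝ (Rn n)) x :=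
    hasFDerivAt_prodMk_right t x
  have h7 : HasFDerivAt (fun y => fderiv ℝ w (t, y)) _ x := h2.comp x h6
  have h8 : HasFDerivAt (fun y => fderiv ℝ w (t, y) (1, 0)) _ x := h7.clm_apply (hasFDerivAt_const _ x)
  have h9 : (fun y => fderiv ℝ w (t, y) (1, 0)) = fun y => -(Complex.I / ε) * (F t y + Ho ε (U t) y) := by
    ext y; exact h.deriv_eq t y
  have h10 : HasFDerivAt (fun y => -(Complex.I / ε) * (F t y + Ho ε (U t) y)) _ x :=
    (((h.F_diff hε t).differentiableAt.hasFDerivAt).add (S_diff (Ho ε (U t)) x)).const_mul _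
  rw [h9] at h8
  have h11 := congrArg (fun L : Rn n →L[ℝ] ℂ => L (eb j)) (h8.unique h10)
  simp at h11
  rw [Do_apply, neg_mul, h11]
  ring

lemma smooth_D {n : ℕ} {U : ℝ → Sn n} (hs : ContDiff ℝ (⊤ : ℕ∞) (fun p : ℝ × Rn n => U p.1 p.2))
    (j : Fin n) : ContDiff ℝ (⊤ : ℕ∞) (fun p : ℝ × Rn n => Do j (U p.1) p.2) := by
  have e : (fun p : ℝ × Rn n => Do j (U p.1) p.2) =
      fun p => fderiv ℝ (fun p : ℝ × Rn n => U p.1 p.2) p (0, eb j) := by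
    ext p; exact joint_D hs j p.1 p.2
  rw [e]
  have h1 : ContDiff ℝ (⊤ : ℕ∞) (fun p : ℝ × Rn n => fderiv ℝ (fun p : ℝ × Rn n => U p.1 p.2) p) :=
    hs.fderiv_right (by norm_cast)
  exact h1.clm_apply contDiff_const

lemma smooth_X {n : ℕ} {U : ℝ → Sn n} (hs : ContDiff ℝ (⊤ : ℕ∞) (fun p : ℝ × Rn n => U p.1 p.2))
    (j : Fin n) : ContDiff ℝ (⊤ : ℕ∞) (fun p : ℝ × Rn n => Xo j (U p.1) p.2) := by
  simp only [Xo_apply]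
  have h1 : ContDiff ℝ (⊤ : ℕ∞) (fun p : ℝ × Rn n => ((p.2 j : ℝ) : ℂ)) :=
    ((Complex.ofRealCLM.comp (EuclideanSpace.proj (𝕜 := ℝ) j)).contDiff).comp contDiff_snd
  exact h1.mul hs

theorem Evol.ab {n : ℕ} {ε : ℝ} (hε : 0 < ε) {U : ℝ → Sn n} {F : ℝ → Rn n → ℂ} (h : Evol ε U F)
    (j : Fin n) (a b a' b' : ℝ → ℂ) (ha : ContDiff ℝ (⊤ : ℕ∞) a) (hb : ContDiff ℝ (⊤ : ℕ∞) b)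
    (ha' : ∀ t, HasDerivAt a (a' t) t) (hb' : ∀ t, HasDerivAt b (b' t) t) :
    Evol ε (fun t => a t • Xo j (U t) + b t • Do j (U t))
      (fun t x => a t * ((x j : ℂ) * F t x) + b t * fderiv ℝ (F t) x (eb j)
        + (Complex.I * ε * a' t + b t) * Xo j (U t) x
        + (Complex.I * ε * b' t + ε ^ 2 * a t) * Do j (U t) x) := by
  constructor
  · simp only [SchwartzMap.add_apply, SchwartzMap.smul_apply, smul_eq_mul]
    exact ((ha.comp contDiff_fst).mul (smooth_X h.smooth j)).add
      ((hb.comp contDiff_fst).mul (smooth_D h.smooth j))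
  · intro t x
    simp only [SchwartzMap.add_apply, SchwartzMap.smul_apply, smul_eq_mul]
    have h1 : HasDerivAt (fun s => Xo j (U s) x) ((x j : ℂ) * (-(Complex.I / ε) * (F t x + Ho ε (U t) x))) t := by
      simp only [Xo_apply]
      exact (h.eq t x).const_mul _
    have h2 := ((ha' t).mul h1).add ((hb' t).mul (h.D_time hε j t x))
    convert! h2 using 1
    have hεc : (ε : ℂ) ≠ 0 := by exact_mod_cast hε.ne'
    rw [map_add, map_smul, map_smul, HX, HD]
    simp only [SchwartzMap.add_apply, SchwartzMap.smul_apply, SchwartzMap.sub_apply, smul_eq_mul]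
    have e1 : Xo j (Ho ε (U t)) x = (x j : ℂ) * Ho ε (U t) x := Xo_apply _ _ _
    simp only [e1]
    push_cast
    field_simp
    ring_nf
    simp only [Complex.I_sq]
    ring

/-- nonlinear source term -/
def nl {n : ℕ} (ε α : ℝ) (φ : Sn n) (x : Rn n) : ℂ :=
  ((ε ^ α : ℝ) : ℂ) * ((hartree 1 φ x : ℝ) : ℂ) * φ x

lemma nl_eq {n : ℕ} (ε α : ℝ) (φ : Sn n) (x : Rn n) :
    nl ε α φ x = ((ε ^ α : ℝ) : ℂ) * pot (cm φ φ) x * φ x := by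
  unfold nl; rw [hart_cast]

lemma nl_D {n : ℕ} (hn : 2 ≤ n) (ε α : ℝ) (φ : Sn n) (x : Rn n) (j : Fin n) :
    fderiv ℝ (nl ε α φ) x (eb j) = ((ε ^ α : ℝ) : ℂ) *
      (pot (cm φ φ) x * Do j φ x + pot (Do j (cm φ φ)) x * φ x) := by
  have e : nl ε α φ = fun x => ((ε ^ α : ℝ) : ℂ) * pot (cm φ φ) x * φ x := by
    ext y; exact nl_eq ε α φ y
  have h1 : HasFDerivAt (fun x => ((ε ^ α : ℝ) : ℂ) * pot (cm φ φ) x * φ x) _ x :=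
    (((pot_diff hn (cm φ φ)).differentiableAt.hasFDerivAt).const_mul ((ε ^ α : ℝ) : ℂ)).mul (S_diff φ x)
  rw [e, h1.fderiv]
  simp only [ContinuousLinearMap.add_apply, ContinuousLinearMap.smul_apply, smul_eq_mul, pot_D hn,
    Do_apply]
  ring

/-- Schwartz-valued solution -/
abbrev Sol {n : ℕ} (ε α : ℝ) (U : ℝ → Sn n) : Prop := Evol ε U (fun t => nl ε α (U t))

theorem Sol.ab {n : ℕ} (hn : 2 ≤ n) {ε α : ℝ} (hε : 0 < ε) {U : ℝ → Sn n} (h : Sol ε α U)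
    (j : Fin n) (a b a' b' : ℝ → ℂ) (ha : ContDiff ℝ (⊤ : ℕ∞) a) (hb : ContDiff ℝ (⊤ : ℕ∞) b)
    (ha' : ∀ t, HasDerivAt a (a' t) t) (hb' : ∀ t, HasDerivAt b (b' t) t) :
    Evol ε (fun t => a t • Xo j (U t) + b t • Do j (U t))
      (fun t x => ((ε ^ α : ℝ) : ℂ) * (((hartree 1 (U t) x : ℝ) : ℂ) *
          (a t • Xo j (U t) + b t • Do j (U t) : Sn n) x
          + b t * pot (Do j (cm (U t) (U t))) x * U t x)
        + (Complex.I * ε * a' t + b t) * Xo j (U t) x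
        + (Complex.I * ε * b' t + ε ^ 2 * a t) * Do j (U t) x) := by
  convert! Evol.ab hε h j a b a' b' ha hb ha' hb' using 3 with t x
  rw [nl_D hn, nl_eq, hart_cast]
  simp only [SchwartzMap.add_apply, SchwartzMap.smul_apply, smul_eq_mul, Xo_apply]
  ring


def Bf {n : ℕ} (p q : Sn n) : ℂ := ∫ x, p x * pot q x

lemma Bf_prod {n : ℕ} (hn : 2 ≤ n) (p q : Sn n) :
    Bf p q = ∫ z : Rn n × Rn n, p z.1 * (((‖z.1 - z.2‖⁻¹ : ℝ) : ℂ) * q z.2)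
      ∂((volume : Measure (Rn n)).prod volume) := by
  rw [integral_prod _ (prod_int hn p q)]
  unfold Bf pot
  simp only [← integral_const_mul]

lemma Bf_int {n : ℕ} (hn : 2 ≤ n) (p q : Sn n) : Integrable (fun x => p x * pot q x) volume := by
  have := (prod_int hn p q).integral_prod_left
  refine this.congr (Eventually.of_forall fun x => ?_)
  simp only [integral_const_mul]; rfl

lemma Bf_symm {n : ℕ} (hn : 2 ≤ n) (p q : Sn n) : Bf p q = Bf q p := by
  unfold Bf
  rw [pot_symm hn p q]
  congr 1; ext x; ring

lemma Bf_add_left {n : ℕ} (hn : 2 ≤ n) (p p' q : Sn n) : Bf (p + p') q = Bf p q + Bf p' q := by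
  unfold Bf
  rw [← integral_add (Bf_int hn p q) (Bf_int hn p' q)]
  congr 1; ext x; rw [SchwartzMap.add_apply]; ring

lemma Bf_smul_left {n : ℕ} (c : ℂ) (p q : Sn n) : Bf (c • p) q = c * Bf p q := by
  unfold Bf
  rw [← integral_const_mul]
  congr 1; ext x; rw [SchwartzMap.smul_apply, smul_eq_mul]; ring

lemma Bf_add_right {n : ℕ} (hn : 2 ≤ n) (p q q' : Sn n) : Bf p (q + q') = Bf p q + Bf p q' := by
  rw [Bf_symm hn, Bf_add_left hn, Bf_symm hn q, Bf_symm hn q']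

lemma Bf_smul_right {n : ℕ} (hn : 2 ≤ n) (c : ℂ) (p q : Sn n) : Bf p (c • q) = c * Bf p q := by
  rw [Bf_symm hn, Bf_smul_left, Bf_symm hn q]

lemma Bf_sum_left {n : ℕ} (hn : 2 ≤ n) {ι : Type*} (s : Finset ι) (p : ι → Sn n) (q : Sn n) :
    Bf (∑ j ∈ s, p j) q = ∑ j ∈ s, Bf (p j) q := by
  classical
  induction s using Finset.induction_on with
  | empty => simp [Bf]
  | insert a s ha ih => rw [Finset.sum_insert ha, Finset.sum_insert ha, Bf_add_left hn, ih]

lemma Bf_D {n : ℕ} (hn : 2 ≤ n) (j : Fin n) (p q : Sn n) : Bf (Do j p) q = - Bf p (Do j q) := by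
  have h := integral_mul_fderiv_eq_neg_fderiv_mul_of_integrable (μ := (volume : Measure (Rn n)))
    (f := p) (g := pot q) (v := eb j)
    (Bf_int hn (Do j p) q) (by simp only [pot_D hn]; exact Bf_int hn p (Do j q)) (Bf_int hn p q)
    (fun x _ => p.differentiable.differentiableAt) (fun x _ => pot_diff hn q x)
  simp only [pot_D hn] at h
  unfold Bf
  rw [h, neg_neg]; rfl

lemma Bf_bound {n : ℕ} (hn : 2 ≤ n) (p q φ v w : Sn n) {a b A : ℝ} (ha : 0 ≤ a) (hb : 0 < b)
    (hA : ∀ x, hartree 1 φ x ≤ A) (hp : ∀ x, ‖p x‖ ≤ a * (‖φ x‖ * ‖w x‖))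
    (hq : ∀ x, ‖q x‖ ≤ b * (‖φ x‖ * ‖v x‖)) :
    ‖Bf p q‖ ≤ a * b * A * (√(nsq v) * √(nsq w)) := by
  have hA0 : 0 ≤ A := (hart_nonneg φ 0).trans (hA 0)
  obtain ⟨h1, h2⟩ := lemP hn q φ v ((2 / b : ℝ) : ℂ) hA (fun y => by
    rw [norm_mul, Complex.norm_real, Real.norm_of_nonneg (by positivity)]
    calc 2 / b * ‖q y‖ ≤ 2 / b * (b * (‖φ y‖ * ‖v y‖)) := by gcongr; exact hq y
      _ = _ := by field_simp)
  set g : Rn n → ℂ := fun x => ((2 / b : ℝ) : ℂ) * pot q x * φ x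
  have h3 := norm_ip_le (fun x => (‖w x‖ : ℂ)) (fun x => (‖g x‖ : ℂ))
    ((w.memLp 2 volume).norm.ofReal) (h1.norm.ofReal)
  have e1 : ip (fun y => (‖w y‖ : ℂ)) (fun y => (‖g y‖ : ℂ)) = ((∫ y, ‖w y‖ * ‖g y‖ : ℝ) : ℂ) := by
    unfold ip
    rw [← integral_complex_ofReal]
    simp
  have e2 : nsq (fun y => (‖w y‖ : ℂ)) = nsq w := by simp [nsq]
  have e3 : nsq (fun y => (‖g y‖ : ℂ)) = nsq g := by simp [nsq]
  rw [e1, e2, e3, Complex.norm_real, Real.norm_of_nonneg (integral_nonneg fun _ => by positivity)] at h3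
  have h4 : √(nsq g) ≤ 2 * A * √(nsq v) := by
    refine (Real.sqrt_le_sqrt h2).trans (le_of_eq ?_)
    rw [Real.sqrt_mul (by positivity), Real.sqrt_sq (by positivity)]
  have hintg : Integrable (fun y => ‖w y‖ * ‖g y‖) volume :=
    (w.memLp 2 volume).norm.integrable_mul h1.norm
  have h5 : ‖Bf p q‖ ≤ ∫ y, a * b / 2 * (‖w y‖ * ‖g y‖) := by
    refine norm_integral_le_of_norm_le (hintg.const_mul _) (Eventually.of_forall fun x => ?_)
    have : ‖g x‖ = 2 / b * ‖pot q x‖ * ‖φ x‖ := by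
      simp only [g, norm_mul, Complex.norm_real, Real.norm_of_nonneg (by positivity : 0 ≤ 2 / b)]
    rw [this, norm_mul]
    calc ‖p x‖ * ‖pot q x‖ ≤ a * (‖φ x‖ * ‖w x‖) * ‖pot q x‖ := by gcongr; exact hp x
      _ = _ := by field_simp
  rw [integral_const_mul] at h5
  calc ‖Bf p q‖ ≤ _ := h5
    _ ≤ a * b / 2 * (√(nsq w) * (2 * A * √(nsq v))) := by gcongr; exact h3.trans (by gcongr)
    _ = _ := by ring

lemma S_bdd {n : ℕ} (ψ : Sn n) : ∃ C, 0 < C ∧ ∀ x, ‖ψ x‖ ≤ C := by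
  refine ⟨SchwartzMap.seminorm ℝ 0 0 ψ + 1, ?_, fun x => ?_⟩
  · have := apply_nonneg (SchwartzMap.seminorm ℝ 0 0) ψ; linarith
  · have := ψ.norm_le_seminorm ℝ x; linarith

lemma Bf_cut_tendsto {n : ℕ} (hn : 2 ≤ n) (ψ₁ ψ₂ p q : Sn n) :
    Tendsto (fun r : ℝ => Bf (cut ψ₁ r p) (cut ψ₂ r q)) (𝓝 0) (𝓝 (ψ₁ 0 * ψ₂ 0 * Bf p q)) := by
  obtain ⟨C₁, h₁, hC₁⟩ := S_bdd ψ₁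
  obtain ⟨C₂, h₂, hC₂⟩ := S_bdd ψ₂
  simp only [Bf_prod hn]
  rw [← integral_const_mul]
  refine tendsto_integral_filter_of_dominated_convergence
    (fun z => C₁ * C₂ * ‖p z.1 * (((‖z.1 - z.2‖⁻¹ : ℝ) : ℂ) * q z.2)‖) ?_ ?_
    ((prod_int hn p q).norm.const_mul _) ?_
  · exact Eventually.of_forall fun r => (prod_int hn _ _).aestronglyMeasurable
  · refine Eventually.of_forall fun r => Eventually.of_forall fun z => ?_
    simp only [cut_apply, norm_mul]
    calc _ = ‖ψ₁ (r • z.1)‖ * ‖ψ₂ (r • z.2)‖ * (‖p z.1‖ * (‖((‖z.1 - z.2‖⁻¹ : ℝ) : ℂ)‖ * ‖q z.2‖)) := by ring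
      _ ≤ _ := by gcongr; exacts [hC₁ _, hC₂ _]
  · refine Eventually.of_forall fun z => ?_
    simp only [cut_apply]
    have t : ∀ (ψ : Sn n) (x : Rn n), Tendsto (fun r : ℝ => ψ (r • x)) (𝓝 0) (𝓝 (ψ 0)) := fun ψ x => by
      have : Continuous (fun r : ℝ => ψ (r • x)) := ψ.continuous.comp (by fun_prop)
      simpa using this.tendsto 0
    have := (((t ψ₁ z.1).mul (t ψ₂ z.2)).mul_const (p z.1 * (((‖z.1 - z.2‖⁻¹ : ℝ) : ℂ) * q z.2)))
    refine this.congr fun r => ?_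
    ring


def mc {n : ℕ} (j : Fin n) (φ : Sn n) : Sn n := cm φ (Do j φ) - cm (Do j φ) φ

def Rr {n : ℕ} (ε : ℝ) (φ : Sn n) : Sn n := (Complex.I * ε / 2) • ∑ j, Do j (mc j φ)

lemma D_mc {n : ℕ} (j : Fin n) (φ : Sn n) :
    Do j (mc j φ) = cm φ (Do j (Do j φ)) - cm (Do j (Do j φ)) φ := by
  unfold mc
  rw [map_sub, D_cm, D_cm]; abel

lemma rho_deriv {n : ℕ} {ε α : ℝ} (hε : 0 < ε) {U : ℝ → Sn n} (h : Sol ε α U) (t : ℝ) (x : Rn n) :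
    HasDerivAt (fun s => cm (U s) (U s) x) (Rr ε (U t) x) t := by
  have h1 := h.eq t x
  have h2 : HasDerivAt (fun s => conj (U s x)) _ t :=
    (Complex.conjCLE : ℂ →L[ℝ] ℂ).hasFDerivAt.comp_hasDerivAt t h1
  have h3 : HasDerivAt (fun s => conj (U s x) * U s x) _ t := h2.mul h1
  simp only [cm_apply]
  convert! h3 using 1
  unfold Rr
  simp only [D_mc]
  rw [SchwartzMap.smul_apply, sum_apply_S, Ho_eq, sum_apply_S]
  simp only [SchwartzMap.add_apply, SchwartzMap.smul_apply, SchwartzMap.sub_apply, Xo_apply, cm_apply,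
    smul_eq_mul, Finset.sum_sub_distrib, Finset.sum_add_distrib, ← Finset.mul_sum, ← Finset.sum_mul,
    ← map_sum]
  generalize (∑ i, Do i (Do i (U t)) x) = d
  have e : (∑ i, ((x i : ℝ) : ℂ) * (((x i : ℝ) : ℂ) * U t x)) = ((∑ i, (x i) ^ 2 : ℝ) : ℂ) * U t x := by
    push_cast; rw [Finset.sum_mul]; refine Finset.sum_congr rfl fun i _ => by ring
  rw [e]
  generalize (∑ i, (x i) ^ 2 : ℝ) = X
  unfold nl
  generalize (hartree 1 (U t) x) = V
  generalize U t x = u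
  have : (ε : ℂ) ≠ 0 := by exact_mod_cast hε.ne'
  simp only [ContinuousLinearEquiv.coe_coe, Complex.conjCLE_apply, map_mul, map_neg, map_add, map_div₀, Complex.conj_I,
    Complex.conj_ofReal]
  generalize (ε ^ α : ℝ) = W
  push_cast
  field_simp
  ring

lemma cut_one {n : ℕ} (ψ : Sn n) (hψ : HasCompactSupport (⇑ψ)) (r : ℝ) (hr : r ≠ 0) :
    ∃ χ : Sn n, HasCompactSupport (⇑χ) ∧ ∀ φ, cut ψ r φ = cut χ 1 φ := by
  have h1 : HasCompactSupport (fun x : Rn n => ψ (r • x)) :=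
    hψ.comp_homeomorph (Homeomorph.smulOfNeZero r hr)
  have h2 : ContDiff ℝ (⊤ : ℕ∞) (fun x : Rn n => ψ (r • x)) := (ψ.smooth ⊤).comp (by fun_prop)
  refine ⟨h1.toSchwartzMap h2, h1, fun φ => ?_⟩
  ext x
  rw [cut_apply, cut_apply]
  simp

lemma W_deriv {n : ℕ} (hn : 2 ≤ n) (χ : Sn n) (hχ : HasCompactSupport (⇑χ)) (ρ ρ' : ℝ → Sn n)
    (hρ : Continuous (fun p : ℝ × Rn n => ρ p.1 p.2))
    (hρ' : Continuous (fun p : ℝ × Rn n => ρ' p.1 p.2))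
    (hd : ∀ t x, HasDerivAt (fun s => ρ s x) (ρ' t x) t) (t : ℝ) :
    HasDerivAt (fun s => Bf (cut χ 1 (ρ s)) (cut χ 1 (ρ s)))
      (2 * Bf (cut χ 1 (ρ' t)) (cut χ 1 (ρ t))) t := by
  obtain ⟨C, hC⟩ := ((isCompact_Icc (a := t - 1) (b := t + 1)).prod hχ).exists_bound_of_continuousOn
    hρ.continuousOn
  obtain ⟨C', hC'⟩ := ((isCompact_Icc (a := t - 1) (b := t + 1)).prod hχ).exists_bound_of_continuousOn
    hρ'.continuousOn
  have b1 : ∀ s ∈ Set.Ioo (t - 1) (t + 1), ∀ x, ‖χ x * ρ s x‖ ≤ ‖χ x‖ * C := fun s hs x => by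
    rw [norm_mul]
    by_cases hx : x ∈ tsupport χ
    · exact mul_le_mul_of_nonneg_left (hC (s, x) ⟨⟨hs.1.le, hs.2.le⟩, hx⟩) (norm_nonneg _)
    · have : χ x = 0 := image_eq_zero_of_notMem_tsupport hx
      simp [this]
  have b2 : ∀ s ∈ Set.Ioo (t - 1) (t + 1), ∀ x, ‖χ x * ρ' s x‖ ≤ ‖χ x‖ * C' := fun s hs x => by
    rw [norm_mul]
    by_cases hx : x ∈ tsupport χ
    · exact mul_le_mul_of_nonneg_left (hC' (s, x) ⟨⟨hs.1.le, hs.2.le⟩, hx⟩) (norm_nonneg _)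
    · have : χ x = 0 := image_eq_zero_of_notMem_tsupport hx
      simp [this]
  have key := (hasDerivAt_integral_of_dominated_loc_of_deriv_le
    (μ := (volume : Measure (Rn n)).prod volume)
    (F := fun s z => cut χ 1 (ρ s) z.1 * (((‖z.1 - z.2‖⁻¹ : ℝ) : ℂ) * cut χ 1 (ρ s) z.2))
    (F' := fun s z => cut χ 1 (ρ' s) z.1 * (((‖z.1 - z.2‖⁻¹ : ℝ) : ℂ) * cut χ 1 (ρ s) z.2)
      + cut χ 1 (ρ s) z.1 * (((‖z.1 - z.2‖⁻¹ : ℝ) : ℂ) * cut χ 1 (ρ' s) z.2))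
    (s := Set.Ioo (t - 1) (t + 1)) (x₀ := t)
    (bound := fun z => 2 * C * C' * ‖χ z.1 * (((‖z.1 - z.2‖⁻¹ : ℝ) : ℂ) * χ z.2)‖)
    (Ioo_mem_nhds (by linarith) (by linarith)) ?_ ?_ ?_ ?_ ?_ ?_).2
  · simp only [Bf_prod hn]
    convert! key using 1
    rw [integral_add (prod_int hn _ _) (prod_int hn _ _), ← Bf_prod hn, ← Bf_prod hn, two_mul]
    rw [Bf_symm hn (cut χ 1 (ρ t))]
  · exact Eventually.of_forall fun s => (prod_int hn _ _).aestronglyMeasurable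
  · exact prod_int hn _ _
  · exact (prod_int hn _ _).aestronglyMeasurable.add (prod_int hn _ _).aestronglyMeasurable
  · refine Eventually.of_forall fun z s hs => ?_
    simp only [cut_apply, one_smul]
    refine (norm_add_le _ _).trans ?_
    have c1 := b1 s hs z.1
    have c2 := b1 s hs z.2
    have c3 := b2 s hs z.1
    have c4 := b2 s hs z.2
    have hn' : 0 ≤ ‖((‖z.1 - z.2‖⁻¹ : ℝ) : ℂ)‖ := norm_nonneg _
    have m1 : ‖χ z.1 * ρ' s z.1‖ * ‖χ z.2 * ρ s z.2‖ ≤ (‖χ z.1‖ * C') * (‖χ z.2‖ * C) :=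
      mul_le_mul c3 c2 (norm_nonneg _) ((norm_nonneg _).trans c3)
    have m2 : ‖χ z.1 * ρ s z.1‖ * ‖χ z.2 * ρ' s z.2‖ ≤ (‖χ z.1‖ * C) * (‖χ z.2‖ * C') :=
      mul_le_mul c1 c4 (norm_nonneg _) ((norm_nonneg _).trans c1)
    simp only [norm_mul] at m1 m2 ⊢
    have := mul_le_mul_of_nonneg_left (add_le_add m1 m2) hn'
    nlinarith [this]
  · exact (prod_int hn χ χ).norm.const_mul _
  · refine Eventually.of_forall fun z s hs => ?_
    simp only [cut_apply, one_smul]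
    have d1 := (hd s z.1).const_mul (χ z.1)
    have d2 := ((hd s z.2).const_mul (χ z.2)).const_mul (((‖z.1 - z.2‖⁻¹ : ℝ) : ℂ))
    have := d1.mul d2
    exact this


lemma norm_mc_le {n : ℕ} (j : Fin n) (φ : Sn n) (x : Rn n) :
    ‖mc j φ x‖ ≤ 2 * (‖φ x‖ * ‖Do j φ x‖) := by
  unfold mc
  rw [SchwartzMap.sub_apply, cm_apply, cm_apply]
  refine (norm_sub_le _ _).trans (le_of_eq ?_)
  simp only [norm_mul, RCLike.norm_conj]; ring

lemma G_formula {n : ℕ} (hn : 2 ≤ n) (ε : ℝ) (ψ : Sn n) (r : ℝ) (φ : Sn n) :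
    2 * Bf (cut ψ r (Rr ε φ)) (cut ψ r (cm φ φ)) = -(Complex.I * ε) * ∑ j,
      (Bf (cut ψ r (mc j φ)) (cut ψ r (Do j (cm φ φ)))
        + r * Bf (cut ψ r (mc j φ)) (cut (Do j ψ) r (cm φ φ))
        + r * Bf (cut (Do j ψ) r (mc j φ)) (cut ψ r (cm φ φ))) := by
  have h : ∀ j, Bf (cut ψ r (Do j (mc j φ))) (cut ψ r (cm φ φ)) =
      -(Bf (cut ψ r (mc j φ)) (cut ψ r (Do j (cm φ φ)))
        + r * Bf (cut ψ r (mc j φ)) (cut (Do j ψ) r (cm φ φ))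
        + r * Bf (cut (Do j ψ) r (mc j φ)) (cut ψ r (cm φ φ))) := by
    intro j
    have h1 := Bf_D hn j (cut ψ r (mc j φ)) (cut ψ r (cm φ φ))
    rw [D_cut, D_cut, Bf_add_left hn, Bf_add_right hn, Bf_smul_left, Bf_smul_right hn] at h1
    linear_combination h1
  unfold Rr
  rw [map_smul, map_sum, Bf_smul_left, Bf_sum_left hn]
  simp only [h, Finset.sum_neg_distrib]
  ring

lemma cut_norm_le {n : ℕ} (ψ : Sn n) {C : ℝ} (hC : ∀ x, ‖ψ x‖ ≤ C) (r : ℝ) (p : Sn n) {B : ℝ} {x : Rn n}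
    (hp : ‖p x‖ ≤ B) : ‖cut ψ r p x‖ ≤ C * B := by
  rw [cut_apply, norm_mul]
  exact mul_le_mul (hC _) hp (norm_nonneg _) ((norm_nonneg _).trans (hC 0))

lemma cm_self_norm {n : ℕ} (φ : Sn n) (x : Rn n) : ‖cm φ φ x‖ = ‖φ x‖ * ‖φ x‖ := by
  rw [cm_apply, norm_mul, RCLike.norm_conj]

lemma bumpC {n : ℕ} (ψ : Sn n) : ∃ C, 1 ≤ C ∧ (∀ x, ‖ψ x‖ ≤ C) ∧ ∀ j x, ‖Do j ψ x‖ ≤ C := by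
  obtain ⟨C, h0, hC⟩ := S_bdd ψ
  choose D hD0 hD using fun j : Fin n => S_bdd (Do j ψ)
  have hs : 0 ≤ ∑ j, D j := Finset.sum_nonneg fun j _ => (hD0 j).le
  refine ⟨1 + C + ∑ j, D j, by linarith, fun x => by linarith [hC x], fun j x => ?_⟩
  have := Finset.single_le_sum (fun j _ => (hD0 j).le) (Finset.mem_univ j)
  linarith [hD j x]

lemma G_bound {n : ℕ} (hn : 2 ≤ n) {ε : ℝ} (hε : 0 < ε) (ψ : Sn n) {C : ℝ} (hC1 : 1 ≤ C)
    (hC : ∀ x, ‖ψ x‖ ≤ C) (hD : ∀ j x, ‖Do j ψ x‖ ≤ C) (r : ℝ) (hr : |r| ≤ 1) (φ : Sn n) {A K : ℝ}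
    (hK : nsq φ ≤ K) (hDK : ∀ j, nsq (Do j φ) ≤ K) (hA : ∀ x, hartree 1 φ x ≤ A) :
    ‖2 * Bf (cut ψ r (Rr ε φ)) (cut ψ r (cm φ φ))‖ ≤ ε * (n * (3 * (2 * C * (2 * C) * A * K))) := by
  have hA0 : 0 ≤ A := (hart_nonneg φ 0).trans (hA 0)
  have hK0 : 0 ≤ K := (nsq_nonneg φ).trans hK
  have hsq : ∀ v w : Sn n, nsq v ≤ K → nsq w ≤ K → √(nsq v) * √(nsq w) ≤ K := fun v w h1 h2 => by
    calc √(nsq v) * √(nsq w) ≤ √K * √K := by gcongr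
      _ = K := Real.mul_self_sqrt hK0
  have key : ∀ j : Fin n, ∀ ψ₁ ψ₂ p q v w : Sn n, (∀ x, ‖ψ₁ x‖ ≤ C) → (∀ x, ‖ψ₂ x‖ ≤ C) → nsq v ≤ K → nsq w ≤ K →
      (∀ x, ‖p x‖ ≤ 2 * (‖φ x‖ * ‖w x‖)) → (∀ x, ‖q x‖ ≤ 2 * (‖φ x‖ * ‖v x‖)) →
      ‖Bf (cut ψ₁ r p) (cut ψ₂ r q)‖ ≤ 2 * C * (2 * C) * A * K := by
    intro j ψ₁ ψ₂ p q v w h1 h2 hv hw hp hq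
    refine (Bf_bound hn _ _ φ v w (a := 2 * C) (b := 2 * C) (A := A) (by positivity) (by positivity) hA
      (fun x => ?_) (fun x => ?_)).trans ?_
    · refine (cut_norm_le ψ₁ h1 r p (hp x)).trans (le_of_eq (by ring))
    · refine (cut_norm_le ψ₂ h2 r q (hq x)).trans (le_of_eq (by ring))
    · exact mul_le_mul_of_nonneg_left (hsq v w hv hw) (by positivity)
  rw [G_formula hn, norm_mul, norm_neg, norm_mul, Complex.norm_I, one_mul, Complex.norm_real,
    Real.norm_of_nonneg hε.le]
  refine mul_le_mul_of_nonneg_left ?_ hε.le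
  refine (norm_sum_le _ _).trans ?_
  have hsum : ∀ j ∈ Finset.univ, ‖Bf (cut ψ r (mc j φ)) (cut ψ r (Do j (cm φ φ)))
        + r * Bf (cut ψ r (mc j φ)) (cut (Do j ψ) r (cm φ φ))
        + r * Bf (cut (Do j ψ) r (mc j φ)) (cut ψ r (cm φ φ))‖ ≤ 3 * (2 * C * (2 * C) * A * K) := by
    intro j _
    have hρ : ∀ x, ‖cm φ φ x‖ ≤ 2 * (‖φ x‖ * ‖φ x‖) := fun x => by
      rw [cm_self_norm]; nlinarith [mul_self_nonneg ‖φ x‖]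
    have k1 := key j ψ ψ (mc j φ) (Do j (cm φ φ)) (Do j φ) (Do j φ) hC hC (hDK j) (hDK j)
      (norm_mc_le j φ) (norm_D_cm_le j φ)
    have k2 := key j ψ (Do j ψ) (mc j φ) (cm φ φ) φ (Do j φ) hC (hD j) hK (hDK j)
      (norm_mc_le j φ) hρ
    have k3 := key j (Do j ψ) ψ (mc j φ) (cm φ φ) φ (Do j φ) (hD j) hC hK (hDK j)
      (norm_mc_le j φ) hρ
    have hr' : ∀ z : ℂ, ‖(r : ℂ) * z‖ ≤ ‖z‖ := fun z => by
      rw [norm_mul, Complex.norm_real, Real.norm_eq_abs]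
      exact mul_le_of_le_one_left (norm_nonneg _) hr
    refine (norm_add₃_le).trans ?_
    linarith [hr' (Bf (cut ψ r (mc j φ)) (cut (Do j ψ) r (cm φ φ))),
      hr' (Bf (cut (Do j ψ) r (mc j φ)) (cut ψ r (cm φ φ)))]
  refine (Finset.sum_le_sum hsum).trans (le_of_eq ?_)
  simp

def Gf {n : ℕ} (φ : Sn n) : ℂ := ∑ j, Bf (mc j φ) (Do j (cm φ φ))

lemma G_tendsto {n : ℕ} (hn : 2 ≤ n) (ε : ℝ) (ψ : Sn n) (h0 : ψ 0 = 1) (φ : Sn n) :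
    Tendsto (fun r : ℝ => 2 * Bf (cut ψ r (Rr ε φ)) (cut ψ r (cm φ φ))) (𝓝 0)
      (𝓝 (-(Complex.I * ε) * Gf φ)) := by
  simp only [G_formula hn]
  refine Tendsto.const_mul _ (tendsto_finset_sum _ fun j _ => ?_)
  have hr : Tendsto (fun r : ℝ => (r : ℂ)) (𝓝 0) (𝓝 0) := by
    simpa using Complex.continuous_ofReal.tendsto 0
  have h1 := Bf_cut_tendsto hn ψ ψ (mc j φ) (Do j (cm φ φ))
  have h2 := hr.mul (Bf_cut_tendsto hn ψ (Do j ψ) (mc j φ) (cm φ φ))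
  have h3 := hr.mul (Bf_cut_tendsto hn (Do j ψ) ψ (mc j φ) (cm φ φ))
  have := (h1.add h2).add h3
  simpa [h0] using this

lemma W_id {n : ℕ} (hn : 2 ≤ n) {ε α : ℝ} (hε : 0 < ε) {U : ℝ → Sn n} (h : Sol ε α U) {s t K A : ℝ}
    (hst : s ≤ t) (hK : ∀ τ ∈ Set.Icc s t, nsq (U τ) ≤ K)
    (hDK : ∀ τ ∈ Set.Icc s t, ∀ j, nsq (Do j (U τ)) ≤ K)
    (hA : ∀ τ ∈ Set.Icc s t, ∀ x, hartree 1 (U τ) x ≤ A) :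
    IntervalIntegrable (fun τ => -(Complex.I * ε) * Gf (U τ)) volume s t ∧
    Bf (cm (U t) (U t)) (cm (U t) (U t)) - Bf (cm (U s) (U s)) (cm (U s) (U s)) =
      ∫ τ in s..t, -(Complex.I * ε) * Gf (U τ) := by
  obtain ⟨ψ, h0, hψ, -, -⟩ := exists_bump n
  obtain ⟨C, hC1, hC, hD⟩ := bumpC ψ
  set r : ℕ → ℝ := fun m => 1 / ((m : ℝ) + 1) with hr
  have hr0 : ∀ m, r m ≠ 0 := fun m => by positivity
  have hr1 : ∀ m, |r m| ≤ 1 := fun m => by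
    rw [abs_of_nonneg (by positivity)]
    simp only [hr]
    rw [div_le_one (by positivity)]; linarith [Nat.cast_nonneg (α := ℝ) m]
  have hrt : Tendsto r atTop (𝓝 0) := tendsto_one_div_add_atTop_nhds_zero_nat
  have hIoc : Set.uIoc s t ⊆ Set.Icc s t := by
    rw [Set.uIoc_of_le hst]; exact Set.Ioc_subset_Icc_self
  have hρ : Continuous (fun p : ℝ × Rn n => cm (U p.1) (U p.1) p.2) := by
    simp only [cm_apply]
    have := h.smooth.continuous
    fun_prop
  have hρ' : Continuous (fun p : ℝ × Rn n => Rr ε (U p.1) p.2) := by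
    have e : ∀ p : ℝ × Rn n, Rr ε (U p.1) p.2 =
        fderiv ℝ (fun p : ℝ × Rn n => conj (U p.1 p.2) * U p.1 p.2) p (1, 0) := fun p => by
      have hs : ContDiff ℝ (⊤ : ℕ∞) (fun p : ℝ × Rn n => conj (U p.1 p.2) * U p.1 p.2) :=
        ((Complex.conjCLE : ℂ →L[ℝ] ℂ).contDiff.comp h.smooth).mul h.smooth
      exact (rho_deriv hε h p.1 p.2).unique (slice_deriv hs p.1 p.2)
    simp only [e]
    have hs : ContDiff ℝ (⊤ : ℕ∞) (fun p : ℝ × Rn n => conj (U p.1 p.2) * U p.1 p.2) :=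
      ((Complex.conjCLE : ℂ →L[ℝ] ℂ).contDiff.comp h.smooth).mul h.smooth
    have := hs.continuous_fderiv (by simp)
    fun_prop
  have hW : ∀ m τ, HasDerivAt (fun τ => Bf (cut ψ (r m) (cm (U τ) (U τ))) (cut ψ (r m) (cm (U τ) (U τ))))
      (2 * Bf (cut ψ (r m) (Rr ε (U τ))) (cut ψ (r m) (cm (U τ) (U τ)))) τ := by
    intro m τ
    obtain ⟨χ, hχ, e⟩ := cut_one ψ hψ (r m) (hr0 m)
    simp only [e]
    exact W_deriv hn χ hχ (fun τ => cm (U τ) (U τ)) (fun τ => Rr ε (U τ)) hρ hρ'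
      (fun t x => rho_deriv hε h t x) τ
  set G : ℕ → ℝ → ℂ := fun m τ => 2 * Bf (cut ψ (r m) (Rr ε (U τ))) (cut ψ (r m) (cm (U τ) (U τ))) with hG
  have hmeas : ∀ m, AEStronglyMeasurable (G m) (volume.restrict (Set.uIoc s t)) := fun m => by
    have e : G m = deriv (fun τ => Bf (cut ψ (r m) (cm (U τ) (U τ))) (cut ψ (r m) (cm (U τ) (U τ)))) := by
      ext τ; exact (hW m τ).deriv.symm
    rw [e]
    exact (measurable_deriv _).aestronglyMeasurable
  set M := ε * (n * (3 * (2 * C * (2 * C) * A * K)))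
  have hbd : ∀ m, ∀ τ ∈ Set.Icc s t, ‖G m τ‖ ≤ M := fun m τ hτ =>
    G_bound hn hε ψ hC1 hC hD (r m) (hr1 m) (U τ) (hK τ hτ) (hDK τ hτ) (hA τ hτ)
  have hlim : ∀ τ, Tendsto (fun m => G m τ) atTop (𝓝 (-(Complex.I * ε) * Gf (U τ))) := fun τ =>
    (G_tendsto hn ε ψ h0 (U τ)).comp hrt
  have hGi : ∀ m, IntervalIntegrable (G m) volume s t := fun m => by
    refine IntervalIntegrable.mono_fun' (g := fun _ => M) (by simp) (hmeas m) ?_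
    exact (ae_restrict_mem measurableSet_uIoc).mono fun τ hτ => hbd m τ (hIoc hτ)
  constructor
  · refine IntervalIntegrable.mono_fun' (g := fun _ => M) (by simp) ?_ ?_
    · exact aestronglyMeasurable_of_tendsto_ae atTop hmeas (Eventually.of_forall hlim)
    · refine (ae_restrict_mem measurableSet_uIoc).mono fun τ hτ => ?_
      exact le_of_tendsto (hlim τ).norm (Eventually.of_forall fun m => hbd m τ (hIoc hτ))
  · have hI : Tendsto (fun m => ∫ τ in s..t, G m τ) atTop
        (𝓝 (∫ τ in s..t, -(Complex.I * ε) * Gf (U τ))) := by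
      refine intervalIntegral.tendsto_integral_filter_of_dominated_convergence
        (fun _ => M) (Eventually.of_forall hmeas) ?_ (by simp) (Eventually.of_forall fun τ _ => hlim τ)
      exact Eventually.of_forall fun m => Eventually.of_forall fun τ hτ => hbd m τ (hIoc hτ)
    have hE : ∀ τ, Tendsto (fun m => Bf (cut ψ (r m) (cm (U τ) (U τ))) (cut ψ (r m) (cm (U τ) (U τ))))
        atTop (𝓝 (Bf (cm (U τ) (U τ)) (cm (U τ) (U τ)))) := fun τ => by
      have := (Bf_cut_tendsto hn ψ ψ (cm (U τ) (U τ)) (cm (U τ) (U τ))).comp hrt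
      rw [h0, one_mul, one_mul] at this
      exact this
    refine tendsto_nhds_unique ((hE t).sub (hE s)) (hI.congr fun m => ?_)
    exact intervalIntegral.integral_eq_sub_of_hasDerivAt (fun τ _ => hW m τ) (hGi m)


lemma nsq_add_le {n : ℕ} (f g : Rn n → ℂ) (hf : MemLp f 2 volume) (hg : MemLp g 2 volume) :
    nsq (fun x => f x + g x) ≤ 2 * nsq f + 2 * nsq g := by
  unfold nsq
  have h1 : Integrable (fun x => ‖f x‖ ^ 2) volume := hf.integrable_norm_pow (by norm_num)
  have h2 : Integrable (fun x => ‖g x‖ ^ 2) volume := hg.integrable_norm_pow (by norm_num)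
  rw [← integral_const_mul, ← integral_const_mul, ← integral_add (h1.const_mul 2) (h2.const_mul 2)]
  refine integral_mono ((hf.add hg).integrable_norm_pow (by norm_num))
    ((h1.const_mul 2).add (h2.const_mul 2)) fun x => ?_
  simp only [Pi.add_apply]
  have := norm_add_le (f x) (g x)
  have h3 : ‖f x + g x‖ ^ 2 ≤ (‖f x‖ + ‖g x‖) ^ 2 := by gcongr
  nlinarith [sq_nonneg (‖f x‖ - ‖g x‖)]

lemma nsq_smul {n : ℕ} (c : ℂ) (f : Rn n → ℂ) : nsq (fun x => c * f x) = ‖c‖ ^ 2 * nsq f := by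
  unfold nsq
  rw [← integral_const_mul]
  congr 1; ext x; rw [norm_mul, mul_pow]

lemma ip_add_r {n : ℕ} (f g g' : Rn n → ℂ) (hf : MemLp f 2 volume) (hg : MemLp g 2 volume)
    (hg' : MemLp g' 2 volume) : ip f (fun x => g x + g' x) = ip f g + ip f g' := by
  unfold ip
  rw [← integral_add]
  · congr 1; ext x; ring
  · exact hf.star.integrable_mul hg
  · exact hf.star.integrable_mul hg'

lemma ip_smul_r {n : ℕ} (c : ℂ) (f g : Rn n → ℂ) : ip f (fun x => c * g x) = c * ip f g := by
  unfold ip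
  rw [← integral_const_mul]
  congr 1; ext x; ring

lemma ip_real {n : ℕ} (a : Rn n → ℝ) (f : Rn n → ℂ) :
    ip f (fun x => (a x : ℂ) * f x) = ((∫ x, a x * ‖f x‖ ^ 2 : ℝ) : ℂ) := by
  unfold ip
  rw [← integral_complex_ofReal]
  congr 1; ext x
  push_cast
  rw [← Complex.conj_mul']; ring

lemma ip_symm_im {n : ℕ} (f g : Rn n → ℂ) : (ip g f).im = - (ip f g).im := by
  have : ip g f = conj (ip f g) := by
    unfold ip
    rw [← integral_conj]
    congr 1; ext x; simp; ring
  rw [this, Complex.conj_im]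

lemma V_mem {n : ℕ} (hn : 2 ≤ n) (φ v : Sn n) {A : ℝ} (hA : ∀ x, hartree 1 φ x ≤ A) :
    MemLp (fun x => ((hartree 1 φ x : ℝ) : ℂ) * v x) 2 volume ∧
    nsq (fun x => ((hartree 1 φ x : ℝ) : ℂ) * v x) ≤ A ^ 2 * nsq v := by
  refine mul_bdd (fun x => ((hartree 1 φ x : ℝ) : ℂ)) (Complex.continuous_ofReal.comp (hart_cont hn φ))
    (fun x => ?_) v
  rw [Complex.norm_real, Real.norm_of_nonneg (hart_nonneg φ x)]; exact hA x

lemma F_mem {n : ℕ} (hn : 2 ≤ n) (q φ v : Sn n) (c β : ℂ) {A : ℝ} (hA : ∀ x, hartree 1 φ x ≤ A)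
    (hv : ∀ y, ‖β * q y‖ ≤ 2 * (‖φ y‖ * ‖v y‖)) :
    MemLp (fun x => c * (((hartree 1 φ x : ℝ) : ℂ) * v x + β * pot q x * φ x)) 2 volume ∧
    nsq (fun x => c * (((hartree 1 φ x : ℝ) : ℂ) * v x + β * pot q x * φ x)) ≤
      ‖c‖ ^ 2 * (10 * A ^ 2 * nsq v) ∧
    |(ip v (fun x => c * (((hartree 1 φ x : ℝ) : ℂ) * v x + β * pot q x * φ x))).im| ≤
      ‖c‖ * (3 * A * nsq v) := by
  have hA0 : 0 ≤ A := (hart_nonneg φ 0).trans (hA 0)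
  obtain ⟨a1, a2⟩ := V_mem hn φ v hA
  obtain ⟨b1, b2⟩ := lemP hn q φ v β hA hv
  refine ⟨(a1.add b1).const_mul c, ?_, ?_⟩
  · rw [nsq_smul]
    refine mul_le_mul_of_nonneg_left ?_ (by positivity)
    have := nsq_add_le _ _ a1 b1
    linarith
  · rw [ip_smul_r, ip_add_r _ _ _ (v.memLp 2 volume) a1 b1]
    refine (Complex.abs_im_le_norm _).trans ?_
    rw [norm_mul]
    refine mul_le_mul_of_nonneg_left ((norm_add_le _ _).trans ?_) (norm_nonneg _)
    have h1 := norm_ip_le v _ (v.memLp 2 volume) a1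
    have h2 := norm_ip_le v _ (v.memLp 2 volume) b1
    have s1 : √(A ^ 2 * nsq v) = A * √(nsq v) := by
      rw [Real.sqrt_mul (by positivity), Real.sqrt_sq hA0]
    have s2 : √((2 * A) ^ 2 * nsq v) = 2 * A * √(nsq v) := by
      rw [Real.sqrt_mul (by positivity), Real.sqrt_sq (by positivity)]
    have t1 := Real.sqrt_le_sqrt a2
    have t2 := Real.sqrt_le_sqrt b2
    rw [s1] at t1
    rw [s2] at t2
    have hs := Real.mul_self_sqrt (nsq_nonneg v)
    have u1 := mul_le_mul_of_nonneg_left t1 (Real.sqrt_nonneg (nsq v))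
    have u2 := mul_le_mul_of_nonneg_left t2 (Real.sqrt_nonneg (nsq v))
    have : √(nsq v) * (A * √(nsq v)) = A * nsq v := by linear_combination A * hs
    nlinarith

lemma nl_mem {n : ℕ} (hn : 2 ≤ n) {ε α : ℝ} (hε : 0 < ε) (φ : Sn n) {A : ℝ} (hA : ∀ x, hartree 1 φ x ≤ A) :
    MemLp (nl ε α φ) 2 volume ∧ nsq (nl ε α φ) ≤ (ε ^ α) ^ 2 * (A ^ 2 * nsq φ) ∧
    (ip φ (nl ε α φ)).im = 0 := by
  obtain ⟨a1, a2⟩ := V_mem hn φ φ hA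
  have e : nl ε α φ = fun x => ((ε ^ α : ℝ) : ℂ) * (((hartree 1 φ x : ℝ) : ℂ) * φ x) := by
    ext x; unfold nl; ring
  rw [e]
  refine ⟨a1.const_mul _, ?_, ?_⟩
  · rw [nsq_smul, Complex.norm_real, Real.norm_of_nonneg (by positivity)]
    exact mul_le_mul_of_nonneg_left a2 (by positivity)
  · rw [ip_smul_r, ip_real, ← Complex.ofReal_mul, Complex.ofReal_im]

lemma mass {n : ℕ} (hn : 2 ≤ n) {ε α : ℝ} (hε : 0 < ε) {U : ℝ → Sn n} (h : Sol ε α U) {s t K A : ℝ}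
    (hst : s ≤ t) (hK : ∀ τ ∈ Set.Icc s t, nsq (U τ) ≤ K)
    (hA : ∀ τ ∈ Set.Icc s t, ∀ x, hartree 1 (U τ) x ≤ A) : nsq (U t) = nsq (U s) := by
  have hm := fun τ hτ => nl_mem hn hε (α := α) (U τ) (hA τ hτ)
  have := (energy_id hε h hst (K := max K ((ε ^ α) ^ 2 * (A ^ 2 * K)))
    (fun τ hτ => (hK τ hτ).trans (le_max_left _ _)) (fun τ hτ => (hm τ hτ).1)
    (fun τ hτ => ((hm τ hτ).2.1).trans ((mul_le_mul_of_nonneg_left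
      (mul_le_mul_of_nonneg_left (hK τ hτ) (by positivity)) (by positivity)).trans (le_max_right _ _)))).2
  rw [intervalIntegral.integral_congr (g := fun _ => 0) (fun τ hτ => by
    rw [Set.uIcc_of_le hst] at hτ
    exact (hm τ hτ).2.2)] at this
  simp at this
  linarith

lemma evol_D {n : ℕ} (hn : 2 ≤ n) {ε α : ℝ} (hε : 0 < ε) {U : ℝ → Sn n} (h : Sol ε α U) (j : Fin n) :
    Evol ε (fun t => Do j (U t)) (fun t x => ((ε ^ α : ℝ) : ℂ) *
      (((hartree 1 (U t) x : ℝ) : ℂ) * Do j (U t) x + 1 * pot (Do j (cm (U t) (U t))) x * U t x)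
      + Xo j (U t) x) := by
  have := Sol.ab hn hε h j (fun _ => 0) (fun _ => 1) (fun _ => 0) (fun _ => 0) contDiff_const contDiff_const
    (fun t => hasDerivAt_const t _) (fun t => hasDerivAt_const t _)
  simpa using this

lemma evol_X {n : ℕ} (hn : 2 ≤ n) {ε α : ℝ} (hε : 0 < ε) {U : ℝ → Sn n} (h : Sol ε α U) (j : Fin n) :
    Evol ε (fun t => Xo j (U t)) (fun t x => ((ε ^ α : ℝ) : ℂ) *
      (((hartree 1 (U t) x : ℝ) : ℂ) * Xo j (U t) x) + (ε : ℂ) ^ 2 * Do j (U t) x) := by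
  have := Sol.ab hn hε h j (fun _ => 1) (fun _ => 0) (fun _ => 0) (fun _ => 0) contDiff_const contDiff_const
    (fun t => hasDerivAt_const t _) (fun t => hasDerivAt_const t _)
  simpa using this

lemma conj_pot {n : ℕ} (q : Sn n) (hq : ∀ y, conj (q y) = q y) (x : Rn n) : conj (pot q x) = pot q x := by
  unfold pot
  rw [← integral_conj]
  congr 1; ext y; rw [map_mul, hq, Complex.conj_ofReal]

lemma conj_Drho {n : ℕ} (φ : Sn n) (j : Fin n) (y : Rn n) :
    conj (Do j (cm φ φ) y) = Do j (cm φ φ) y := by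
  rw [D_cm, SchwartzMap.add_apply, cm_apply, cm_apply]
  simp; ring

lemma Bf_mc {n : ℕ} (hn : 2 ≤ n) (φ : Sn n) (j : Fin n) :
    Bf (mc j φ) (Do j (cm φ φ)) = -(2 * Complex.I) *
      ((ip (Do j φ) (fun x => 1 * pot (Do j (cm φ φ)) x * φ x)).im : ℂ) := by
  set z := ip (Do j φ) (fun x => 1 * pot (Do j (cm φ φ)) x * φ x) with hz
  have h1 : Bf (cm (Do j φ) φ) (Do j (cm φ φ)) = z := by
    unfold Bf; rw [hz]; unfold ip
    congr 1; ext x; rw [cm_apply]; ring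
  have h2 : Bf (cm φ (Do j φ)) (Do j (cm φ φ)) = conj z := by
    rw [hz]; unfold Bf ip; rw [← integral_conj]
    congr 1; ext x
    rw [cm_apply]
    simp only [map_mul, map_one, Complex.conj_conj, conj_pot _ (conj_Drho φ j)]; ring
  have h3 : mc j φ = cm φ (Do j φ) + (-1 : ℂ) • cm (Do j φ) φ := by
    unfold mc; simp [sub_eq_add_neg]
  rw [h3, Bf_add_left hn, Bf_smul_left, h1, h2]
  apply Complex.ext <;> simp
  ring

def En {n : ℕ} (ε α : ℝ) (φ : Sn n) : ℝ :=
  ∑ j, (nsq (Xo j φ) + ε ^ 2 * nsq (Do j φ)) + ε ^ α * (Bf (cm φ φ) (cm φ φ)).re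

theorem energy_cons {n : ℕ} (hn : 2 ≤ n) {ε α : ℝ} (hε : 0 < ε) {U : ℝ → Sn n} (h : Sol ε α U)
    {s t K A : ℝ}
    (hst : s ≤ t) (hK : ∀ τ ∈ Set.Icc s t, nsq (U τ) ≤ K)
    (hDK : ∀ τ ∈ Set.Icc s t, ∀ j, nsq (Do j (U τ)) ≤ K)
    (hXK : ∀ τ ∈ Set.Icc s t, ∀ j, nsq (Xo j (U τ)) ≤ K)
    (hA : ∀ τ ∈ Set.Icc s t, ∀ x, hartree 1 (U τ) x ≤ A) : En ε α (U t) = En ε α (U s) := by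
  have hεα : 0 ≤ ε ^ α := by positivity
  have hnc : ‖((ε ^ α : ℝ) : ℂ)‖ = ε ^ α := by rw [Complex.norm_real, Real.norm_of_nonneg hεα]
  have hnc2 : ‖(ε : ℂ) ^ 2‖ = ε ^ 2 := by rw [norm_pow, Complex.norm_real, Real.norm_of_nonneg hε.le]
  have hD : ∀ j, ∀ τ ∈ Set.Icc s t, _ := fun j τ hτ =>
    F_mem hn (Do j (cm (U τ) (U τ))) (U τ) (Do j (U τ)) ((ε ^ α : ℝ) : ℂ) 1 (hA τ hτ)
      (fun y => by rw [one_mul]; exact norm_D_cm_le j (U τ) y)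
  have hX : ∀ j, ∀ τ ∈ Set.Icc s t, _ := fun j τ hτ => V_mem hn (U τ) (Xo j (U τ)) (hA τ hτ)
  set h' : Fin n → ℝ → ℝ := fun j τ =>
    (ip (Do j (U τ)) (fun x => 1 * pot (Do j (cm (U τ) (U τ))) x * U τ x)).im with hh'
  have key : ∀ j, IntervalIntegrable (h' j) volume s t ∧
      (nsq (Xo j (U t)) + ε ^ 2 * nsq (Do j (U t))) - (nsq (Xo j (U s)) + ε ^ 2 * nsq (Do j (U s)))
      = 2 * ε * ε ^ α * ∫ τ in s..t, h' j τ := by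
    intro j
    obtain ⟨i1, e1⟩ := energy_id hε (evol_D hn hε h j) hst
      (K := max K (2 * ((ε ^ α) ^ 2 * (10 * A ^ 2 * K)) + 2 * K))
      (fun τ hτ => (hDK τ hτ j).trans (le_max_left _ _))
      (fun τ hτ => (hD j τ hτ).1.add ((Xo j (U τ)).memLp 2 volume))
      (fun τ hτ => by
        refine (nsq_add_le _ _ (hD j τ hτ).1 ((Xo j (U τ)).memLp 2 volume)).trans
          (le_trans ?_ (le_max_right _ _))
        have a := (hD j τ hτ).2.1
        rw [hnc] at a
        have b := hXK τ hτ j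
        have c : (ε ^ α) ^ 2 * (10 * A ^ 2 * nsq (Do j (U τ))) ≤ (ε ^ α) ^ 2 * (10 * A ^ 2 * K) := by
          gcongr; exact hDK τ hτ j
        linarith)
    obtain ⟨i2, e2⟩ := energy_id hε (evol_X hn hε h j) hst
      (K := max K (2 * ((ε ^ α) ^ 2 * (A ^ 2 * K)) + 2 * ((ε ^ 2) ^ 2 * K)))
      (fun τ hτ => (hXK τ hτ j).trans (le_max_left _ _))
      (fun τ hτ => ((hX j τ hτ).1.const_mul _).add (((Do j (U τ)).memLp 2 volume).const_mul _))
      (fun τ hτ => by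
        refine (nsq_add_le _ _ ((hX j τ hτ).1.const_mul _)
          (((Do j (U τ)).memLp 2 volume).const_mul _)).trans
          (le_trans ?_ (le_max_right _ _))
        rw [nsq_smul, nsq_smul, hnc, hnc2]
        have a := (hX j τ hτ).2
        have b := hXK τ hτ j
        have d := hDK τ hτ j
        have c : A ^ 2 * nsq (Xo j (U τ)) ≤ A ^ 2 * K := by gcongr
        gcongr
        exact a.trans c)
    have p1 : ∀ τ ∈ Set.Icc s t, (ip (Do j (U τ)) (fun x => ((ε ^ α : ℝ) : ℂ) *
      (((hartree 1 (U τ) x : ℝ) : ℂ) * Do j (U τ) x + 1 * pot (Do j (cm (U τ) (U τ))) x * U τ x)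
      + Xo j (U τ) x)).im = ε ^ α * h' j τ + (ip (Do j (U τ)) (Xo j (U τ))).im := by
      intro τ hτ
      rw [ip_add_r _ _ _ ((Do j (U τ)).memLp 2 volume) (hD j τ hτ).1 ((Xo j (U τ)).memLp 2 volume),
        ip_smul_r, ip_add_r _ _ _ ((Do j (U τ)).memLp 2 volume)
          (V_mem hn (U τ) (Do j (U τ)) (hA τ hτ)).1
          (lemP hn (Do j (cm (U τ) (U τ))) (U τ) (Do j (U τ)) 1 (hA τ hτ)
            (fun y => by rw [one_mul]; exact norm_D_cm_le j (U τ) y)).1, ip_real]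
      simp [hh']
    have p2 : ∀ τ ∈ Set.Icc s t, (ip (Xo j (U τ)) (fun x => ((ε ^ α : ℝ) : ℂ) *
      (((hartree 1 (U τ) x : ℝ) : ℂ) * Xo j (U τ) x) + (ε : ℂ) ^ 2 * Do j (U τ) x)).im =
        - (ε ^ 2 * (ip (Do j (U τ)) (Xo j (U τ))).im) := by
      intro τ hτ
      rw [ip_add_r _ _ _ ((Xo j (U τ)).memLp 2 volume) ((hX j τ hτ).1.const_mul _)
        (((Do j (U τ)).memLp 2 volume).const_mul _), ip_smul_r, ip_smul_r, ip_real, ← Complex.ofReal_mul,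
        Complex.add_im, Complex.ofReal_im, zero_add, ← Complex.ofReal_pow, Complex.im_ofReal_mul,
        ip_symm_im (Do j (U τ)) (Xo j (U τ))]
      ring
    have hεα0 : ε ^ α ≠ 0 := by positivity
    have e3 : ∀ τ ∈ Set.Icc s t, h' j τ = (ε ^ α)⁻¹ * ((ip (Do j (U τ)) (fun x => ((ε ^ α : ℝ) : ℂ) *
      (((hartree 1 (U τ) x : ℝ) : ℂ) * Do j (U τ) x + 1 * pot (Do j (cm (U τ) (U τ))) x * U τ x)
      + Xo j (U τ) x)).im + (ε ^ 2)⁻¹ * (ip (Xo j (U τ)) (fun x => ((ε ^ α : ℝ) : ℂ) *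
      (((hartree 1 (U τ) x : ℝ) : ℂ) * Xo j (U τ) x) + (ε : ℂ) ^ 2 * Do j (U τ) x)).im) := by
      intro τ hτ
      rw [p1 τ hτ, p2 τ hτ]
      field_simp; ring
    have i3 := (i1.add (i2.const_mul (ε ^ 2)⁻¹)).const_mul (ε ^ α)⁻¹
    constructor
    · refine i3.congr fun τ hτ => ?_
      rw [Set.uIoc_of_le hst] at hτ
      exact (e3 τ (Set.Ioc_subset_Icc_self hτ)).symm
    · rw [intervalIntegral.integral_congr (fun τ hτ => e3 τ (by rwa [Set.uIcc_of_le hst] at hτ)),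
        intervalIntegral.integral_const_mul, intervalIntegral.integral_add i1 (i2.const_mul _),
        intervalIntegral.integral_const_mul]
      generalize (∫ τ in s..t, (ip (Do j (U τ)) (fun x => ((ε ^ α : ℝ) : ℂ) *
        (((hartree 1 (U τ) x : ℝ) : ℂ) * Do j (U τ) x + 1 * pot (Do j (cm (U τ) (U τ))) x * U τ x)
        + Xo j (U τ) x)).im) = I1 at *
      generalize (∫ τ in s..t, (ip (Xo j (U τ)) (fun x => ((ε ^ α : ℝ) : ℂ) *
        (((hartree 1 (U τ) x : ℝ) : ℂ) * Xo j (U τ) x) + (ε : ℂ) ^ 2 * Do j (U τ) x)).im) = I2 at *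
      have e1' : nsq (Do j (U t)) = nsq (Do j (U s)) + 2 / ε * I1 := by linarith
      have e2' : nsq (Xo j (U t)) = nsq (Xo j (U s)) + 2 / ε * I2 := by linarith
      rw [e1', e2']
      field_simp
      ring
  have hWid := (W_id hn hε h hst hK hDK hA).2
  have eG : ∀ τ, -(Complex.I * ε) * Gf (U τ) = ((-(2 * ε) * ∑ j, h' j τ : ℝ) : ℂ) := by
    intro τ
    unfold Gf
    simp only [Bf_mc hn]
    rw [← Finset.mul_sum]
    push_cast
    simp only [hh']
    linear_combination (2 * ε * ∑ j, ((ip (Do j (U τ)) (fun x => 1 * pot (Do j (cm (U τ) (U τ))) x * U τ x)).im : ℂ)) * Complex.I_mul_I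
  simp only [eG] at hWid
  rw [intervalIntegral.integral_ofReal] at hWid
  have hre := congrArg Complex.re hWid
  rw [Complex.sub_re, Complex.ofReal_re, intervalIntegral.integral_const_mul,
    intervalIntegral.integral_finset_sum (fun j _ => (key j).1)] at hre
  have hsum : ∑ j, (nsq (Xo j (U t)) + ε ^ 2 * nsq (Do j (U t))) -
      ∑ j, (nsq (Xo j (U s)) + ε ^ 2 * nsq (Do j (U s))) = 2 * ε * ε ^ α * ∑ j, ∫ τ in s..t, h' j τ := by
    rw [← Finset.sum_sub_distrib, Finset.mul_sum]
    exact Finset.sum_congr rfl fun j _ => (key j).2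
  unfold En
  linear_combination hsum + ε ^ α * hre


lemma cpt_bdd (N : ℝ → ℝ) {K : Set ℝ} (hK : IsCompact K)
    (h : ∀ t ∈ K, ∃ C, ∀ᶠ τ in 𝓝 t, N τ ≤ C) : ∃ C, ∀ τ ∈ K, N τ ≤ C := by
  refine hK.induction_on (p := fun s => ∃ C, ∀ τ ∈ s, N τ ≤ C) ⟨0, by simp⟩ ?_ ?_ ?_
  · rintro s t hst ⟨C, hC⟩
    exact ⟨C, fun τ hτ => hC τ (hst hτ)⟩
  · rintro s t ⟨C, hC⟩ ⟨D, hD⟩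
    refine ⟨max C D, fun τ hτ => ?_⟩
    rcases hτ with hτ | hτ
    · exact (hC τ hτ).trans (le_max_left _ _)
    · exact (hD τ hτ).trans (le_max_right _ _)
  · intro t ht
    obtain ⟨C, hC⟩ := h t ht
    exact ⟨_, mem_nhdsWithin_of_mem_nhds hC, C, fun τ hτ => hτ⟩

theorem loc_bdd (N : ℝ → ℝ) (hcl : ∀ k : ℝ, IsClosed {t | N t ≤ k}) (Φ : ℝ → ℝ) (hΦ : Monotone Φ)
    (h : ∀ s t, s ≤ t → (∃ K, ∀ τ ∈ Set.Icc s t, N τ ≤ K) → N s ≤ Φ (N t) ∧ N t ≤ Φ (N s)) :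
    ∀ s t, ∃ K, ∀ τ ∈ Set.Icc s t, N τ ≤ K := by
  set G : Set ℝ := {t | ∃ C, ∀ᶠ τ in 𝓝 t, N τ ≤ C} with hG
  have hGo : IsOpen G := by
    rw [isOpen_iff_eventually]
    rintro t ⟨C, hC⟩
    filter_upwards [hC.eventually_nhds] with τ hτ
    exact ⟨C, hτ⟩
  by_cases hB : (Gᶜ).Nonempty
  swap
  · rw [Set.not_nonempty_iff_eq_empty, Set.compl_empty_iff] at hB
    intro s t
    refine cpt_bdd N isCompact_Icc fun τ _ => ?_
    have : τ ∈ G := by rw [hB]; trivial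
    exact this
  exfalso
  have hBc : IsClosed Gᶜ := hGo.isClosed_compl
  have : CompleteSpace ↥(Gᶜ) := hBc.completeSpace_coe
  have : Nonempty ↥(Gᶜ) := hB.to_subtype
  obtain ⟨k, hk⟩ := nonempty_interior_of_iUnion_of_closed (X := ↥(Gᶜ))
    (f := fun k : ℕ => {t | N t ≤ k})
    (fun k => (hcl k).preimage continuous_subtype_val) (by
      refine Set.eq_univ_of_forall fun t => ?_
      obtain ⟨k, hk⟩ := exists_nat_ge (N t)
      exact Set.mem_iUnion.2 ⟨k, hk⟩)
  obtain ⟨b0, hb0⟩ := hk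
  rw [mem_interior_iff_mem_nhds, Metric.mem_nhds_iff] at hb0
  obtain ⟨δ, hδ, hball⟩ := hb0
  have hk : ∀ b ∈ Gᶜ, |b - b0| < δ → N b ≤ k := fun b hb hbd => by
    have : (⟨b, hb⟩ : ↥(Gᶜ)) ∈ Metric.ball b0 δ := by
      rw [Metric.mem_ball, Subtype.dist_eq, Real.dist_eq]; exact hbd
    exact hball this
  have hIco : ∀ s t, Set.Icc s t ⊆ G → ∃ C, ∀ τ ∈ Set.Icc s t, N τ ≤ C := fun s t hst =>
    cpt_bdd N isCompact_Icc fun τ hτ => hst hτ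
  apply b0.2
  refine ⟨max k (Φ k), ?_⟩
  filter_upwards [Metric.ball_mem_nhds (b0 : ℝ) hδ] with t ht
  rw [Metric.mem_ball, Real.dist_eq] at ht
  by_cases htB : t ∈ Gᶜ
  · exact (hk t htB ht).trans (le_max_left _ _)
  refine le_trans ?_ (le_max_right _ _)
  have htb : t ≠ b0 := fun e => htB (e ▸ b0.2)
  rcases lt_or_gt_of_ne htb with hlt | hgt
  · set S := Gᶜ ∩ Set.Icc t b0 with hS
    have hSc : IsCompact S := isCompact_Icc.inter_left hBc
    have hSn : S.Nonempty := ⟨b0, b0.2, hlt.le, le_rfl⟩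
    obtain ⟨b, hbS, hbmin⟩ := hSc.exists_isLeast hSn
    have hIn : ∀ τ, t ≤ τ → τ < b → τ ∈ G := fun τ h1 h2 => by
      by_contra hc
      exact absurd (hbmin ⟨hc, h1, h2.le.trans hbS.2.2⟩) (not_le.2 h2)
    have hbd : ∃ K, ∀ τ ∈ Set.Icc t b, N τ ≤ K := by
      refine ⟨max (Φ (N t)) (N b), fun τ hτ => ?_⟩
      rcases hτ.2.lt_or_eq with h1 | h1
      · refine le_trans ?_ (le_max_left _ _)
        exact (h t τ hτ.1 (hIco t τ fun σ hσ => hIn σ hσ.1 (hσ.2.trans_lt h1))).2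
      · rw [h1]; exact le_max_right _ _
    refine (h t b hbS.2.1 hbd).1.trans (hΦ (hk b hbS.1 ?_))
    rw [abs_lt] at ht ⊢
    constructor <;> linarith [hbS.2.1, hbS.2.2]
  · set S := Gᶜ ∩ Set.Icc b0 t with hS
    have hSc : IsCompact S := isCompact_Icc.inter_left hBc
    have hSn : S.Nonempty := ⟨b0, b0.2, le_rfl, hgt.le⟩
    obtain ⟨b, hbS, hbmax⟩ := hSc.exists_isGreatest hSn
    have hIn : ∀ τ, τ ≤ t → b < τ → τ ∈ G := fun τ h1 h2 => by
      by_contra hc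
      exact absurd (hbmax ⟨hc, hbS.2.1.trans h2.le, h1⟩) (not_le.2 h2)
    have hbd : ∃ K, ∀ τ ∈ Set.Icc b t, N τ ≤ K := by
      refine ⟨max (Φ (N t)) (N b), fun τ hτ => ?_⟩
      rcases hτ.1.lt_or_eq with h1 | h1
      · refine le_trans ?_ (le_max_left _ _)
        exact (h τ t hτ.2 (hIco τ t fun σ hσ => hIn σ hσ.2 (h1.trans_le hσ.1))).1
      · rw [← h1]; exact le_max_right _ _
    refine (h b t hbS.2.2 hbd).2.trans (hΦ (hk b hbS.1 ?_))
    rw [abs_lt] at ht ⊢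
    constructor <;> linarith [hbS.2.1, hbS.2.2]


lemma closed_sub {n : ℕ} (g : ℝ → Rn n → ℝ) (hg : Continuous (fun p : ℝ × Rn n => g p.1 p.2))
    (h0 : ∀ t x, 0 ≤ g t x) (hi : ∀ t, Integrable (g t) volume) (k : ℝ) :
    IsClosed {t | ∫ x, g t x ≤ k} := by
  refine IsSeqClosed.isClosed fun a t ha hat => ?_
  have hk : 0 ≤ k := (integral_nonneg (h0 (a 0))).trans (ha 0)
  have e : ∀ t, ENNReal.ofReal (∫ x, g t x) = ∫⁻ x, ENNReal.ofReal (g t x) := fun t =>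
    ofReal_integral_eq_lintegral_ofReal (hi t) (Eventually.of_forall (h0 t))
  have hc : ∀ t, Continuous (g t) := fun t => hg.comp (by fun_prop : Continuous fun x : Rn n => (t, x))
  have h1 : ∫⁻ x, ENNReal.ofReal (g t x) ≤ ENNReal.ofReal k := by
    calc ∫⁻ x, ENNReal.ofReal (g t x) = ∫⁻ x, liminf (fun m => ENNReal.ofReal (g (a m) x)) atTop := by
          refine lintegral_congr fun x => ?_
          refine (Tendsto.liminf_eq ?_).symm
          refine ENNReal.tendsto_ofReal ?_
          have : Continuous (fun s => g s x) := hg.comp (by fun_prop : Continuous fun s : ℝ => (s, x))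
          exact (this.tendsto t).comp hat
      _ ≤ liminf (fun m => ∫⁻ x, ENNReal.ofReal (g (a m) x)) atTop :=
          lintegral_liminf_le fun m => (hc (a m)).measurable.ennreal_ofReal
      _ ≤ liminf (fun _ : ℕ => ENNReal.ofReal k) atTop := by
          refine liminf_le_liminf (Eventually.of_forall fun m => ?_)
          rw [← e]
          exact ENNReal.ofReal_le_ofReal (ha m)
      _ = _ := by simp
  rw [← e] at h1
  exact (ENNReal.ofReal_le_ofReal_iff hk).1 h1

def Nf {n : ℕ} (φ : Sn n) : ℝ := nsq φ + ∑ j, (nsq (Xo j φ) + nsq (Do j φ))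

lemma Nf_ge {n : ℕ} (φ : Sn n) : nsq φ ≤ Nf φ ∧ (∀ j, nsq (Xo j φ) ≤ Nf φ) ∧ ∀ j, nsq (Do j φ) ≤ Nf φ := by
  unfold Nf
  have h0 : ∀ j ∈ Finset.univ, 0 ≤ nsq (Xo j φ) + nsq (Do j φ) := fun j _ =>
    add_nonneg (nsq_nonneg _) (nsq_nonneg _)
  have h1 := nsq_nonneg φ
  refine ⟨le_add_of_nonneg_right (Finset.sum_nonneg h0), fun j => ?_, fun j => ?_⟩ <;>
  · have := Finset.single_le_sum h0 (Finset.mem_univ j)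
    linarith [nsq_nonneg (Xo j φ), nsq_nonneg (Do j φ)]

lemma Nf_closed {n : ℕ} {U : ℝ → Sn n} (hs : ContDiff ℝ (⊤ : ℕ∞) (fun p : ℝ × Rn n => U p.1 p.2)) (k : ℝ) :
    IsClosed {t | Nf (U t) ≤ k} := by
  have e : ∀ t, Nf (U t) = ∫ x, (‖U t x‖ ^ 2 + ∑ j, (‖Xo j (U t) x‖ ^ 2 + ‖Do j (U t) x‖ ^ 2)) := by
    intro t
    unfold Nf
    have hi : ∀ j, Integrable (fun x => ‖Xo j (U t) x‖ ^ 2 + ‖Do j (U t) x‖ ^ 2) volume :=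
      fun j => (nsq_int _).add (nsq_int _)
    rw [integral_add (nsq_int _) (integrable_finset_sum _ fun j _ => hi j),
      integral_finset_sum _ (fun j _ => hi j)]
    congr 1
    refine Finset.sum_congr rfl fun j _ => ?_
    rw [integral_add (nsq_int _) (nsq_int _)]; rfl
  simp only [e]
  refine closed_sub (fun t x => ‖U t x‖ ^ 2 + ∑ j, (‖Xo j (U t) x‖ ^ 2 + ‖Do j (U t) x‖ ^ 2)) ?_ ?_ ?_ k
  · have h1 := hs.continuous
    have h2 := fun j => (smooth_X hs j).continuous
    have h3 := fun j => (smooth_D hs j).continuous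
    fun_prop
  · intro t x; positivity
  · intro t
    exact (nsq_int _).add (integrable_finset_sum _ fun j _ => (nsq_int _).add (nsq_int _))

lemma hart_Nf {n : ℕ} (hn : 2 ≤ n) (φ : Sn n) (x : Rn n) : hartree 1 φ x ≤ 2 * n * Nf φ := by
  have h0 : 0 ≤ Nf φ := (nsq_nonneg φ).trans (Nf_ge φ).1
  refine (hart_bdd hn φ x).trans ?_
  have h1 : ∑ j, √(nsq (Do j φ)) ≤ n * √(Nf φ) := by
    refine (Finset.sum_le_sum fun j _ => Real.sqrt_le_sqrt ((Nf_ge φ).2.2 j)).trans ?_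
    simp
  calc 2 * √(nsq φ) * ∑ j, √(nsq (Do j φ)) ≤ 2 * √(Nf φ) * (n * √(Nf φ)) := by
        gcongr; exact (Nf_ge φ).1
    _ = 2 * n * (√(Nf φ) * √(Nf φ)) := by ring
    _ = _ := by rw [Real.mul_self_sqrt h0]

lemma Bf_nonneg {n : ℕ} (φ : Sn n) : 0 ≤ (Bf (cm φ φ) (cm φ φ)).re := by
  have e : Bf (cm φ φ) (cm φ φ) = ((∫ x, ‖φ x‖ ^ 2 * hartree 1 φ x : ℝ) : ℂ) := by
    unfold Bf
    rw [← integral_complex_ofReal]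
    congr 1; ext x
    rw [← hart_cast, cm_apply, Complex.conj_mul']
    push_cast; ring
  rw [e, Complex.ofReal_re]
  exact integral_nonneg fun x => mul_nonneg (by positivity) (hart_nonneg φ x)

lemma Bf_le {n : ℕ} (hn : 2 ≤ n) (φ : Sn n) : (Bf (cm φ φ) (cm φ φ)).re ≤ 2 * n * Nf φ ^ 2 := by
  have h0 : 0 ≤ Nf φ := (nsq_nonneg φ).trans (Nf_ge φ).1
  refine (Complex.re_le_norm _).trans ?_
  refine (Bf_bound hn (cm φ φ) (cm φ φ) φ φ φ zero_le_one one_pos (hart_Nf hn φ)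
    (fun x => by rw [one_mul, cm_self_norm]) (fun x => by rw [one_mul, cm_self_norm])).trans ?_
  rw [Real.mul_self_sqrt (nsq_nonneg φ)]
  calc 1 * 1 * (2 * n * Nf φ) * nsq φ ≤ 1 * 1 * (2 * n * Nf φ) * Nf φ := by gcongr; exact (Nf_ge φ).1
    _ = _ := by ring

theorem Sol.bdd {n : ℕ} (hn : 2 ≤ n) {ε α : ℝ} (hε : 0 < ε) {U : ℝ → Sn n} (h : Sol ε α U) (s t : ℝ) :
    ∃ K, ∀ τ ∈ Set.Icc s t, Nf (U τ) ≤ K := by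
  set Φ : ℝ → ℝ := fun y => max y 0 + (1 + (ε ^ 2)⁻¹) * ((1 + ε ^ 2) * max y 0 +
    ε ^ α * (2 * n * (max y 0) ^ 2)) with hΦ
  have hN0 : ∀ φ : Sn n, 0 ≤ Nf φ := fun φ => (nsq_nonneg φ).trans (Nf_ge φ).1
  have hmon : Monotone Φ := by
    intro a b hab
    simp only [hΦ]
    have h0 : 0 ≤ max a 0 := le_max_right _ _
    have h1 : max a 0 ≤ max b 0 := max_le_max_right 0 hab
    have h2 : 0 ≤ ε ^ α := by positivity
    gcongr
  have key : ∀ φ χ : Sn n, nsq φ = nsq χ → En ε α φ = En ε α χ → Nf φ ≤ Φ (Nf χ) := by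
    intro φ χ hm he
    have hεα : 0 ≤ ε ^ α := by positivity
    have a1 : ∑ j, (nsq (Xo j φ) + nsq (Do j φ)) ≤ (1 + (ε ^ 2)⁻¹) * En ε α φ := by
      have b1 : ∑ j, (nsq (Xo j φ) + ε ^ 2 * nsq (Do j φ)) ≤ En ε α φ :=
        le_add_of_nonneg_right (mul_nonneg hεα (Bf_nonneg φ))
      refine le_trans ?_ (mul_le_mul_of_nonneg_left b1 (by positivity))
      rw [Finset.mul_sum]
      refine Finset.sum_le_sum fun j _ => ?_
      have c1 := nsq_nonneg (Xo j φ)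
      have c2 := nsq_nonneg (Do j φ)
      have c3 : (ε ^ 2)⁻¹ * (ε ^ 2 * nsq (Do j φ)) = nsq (Do j φ) := by field_simp
      have c4 : 0 ≤ (ε ^ 2)⁻¹ * nsq (Xo j φ) := by positivity
      have c5 : 0 ≤ ε ^ 2 * nsq (Do j φ) := by positivity
      linarith
    have a2 : En ε α χ ≤ (1 + ε ^ 2) * Nf χ + ε ^ α * (2 * n * Nf χ ^ 2) := by
      unfold En
      refine add_le_add ?_ (mul_le_mul_of_nonneg_left (Bf_le hn χ) hεα)
      have b1 : ∑ j, (nsq (Xo j χ) + nsq (Do j χ)) ≤ Nf χ := le_add_of_nonneg_left (nsq_nonneg χ)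
      refine le_trans ?_ (mul_le_mul_of_nonneg_left b1 (by positivity))
      rw [Finset.mul_sum]
      refine Finset.sum_le_sum fun j _ => ?_
      have c1 := nsq_nonneg (Xo j χ)
      have c2 := nsq_nonneg (Do j χ)
      nlinarith [sq_nonneg ε, mul_nonneg (sq_nonneg ε) c1]
    have a3 : nsq φ ≤ Nf χ := hm ▸ (Nf_ge χ).1
    simp only [hΦ, max_eq_left (hN0 χ)]
    have a4 : Nf φ = nsq φ + ∑ j, (nsq (Xo j φ) + nsq (Do j φ)) := rfl
    rw [a4]
    rw [he] at a1
    exact add_le_add a3 (a1.trans (mul_le_mul_of_nonneg_left a2 (by positivity)))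
  refine loc_bdd (fun t => Nf (U t)) (Nf_closed h.smooth) Φ hmon ?_ s t
  rintro s t hst ⟨K, hK⟩
  have k1 : ∀ τ ∈ Set.Icc s t, nsq (U τ) ≤ K := fun τ hτ => (Nf_ge _).1.trans (hK τ hτ)
  have kA : ∀ τ ∈ Set.Icc s t, ∀ x, hartree 1 (U τ) x ≤ 2 * n * K := fun τ hτ x =>
    (hart_Nf hn _ x).trans (by have := hK τ hτ; gcongr)
  have m := mass hn hε h hst k1 kA
  have e := energy_cons hn hε h hst k1 (fun τ hτ j => ((Nf_ge _).2.2 j).trans (hK τ hτ))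
    (fun τ hτ j => ((Nf_ge _).2.1 j).trans (hK τ hτ)) kA
  exact ⟨key _ _ m.symm e.symm, key _ _ m e⟩

lemma ip_zero_r {n : ℕ} (f : Rn n → ℂ) : ip f (fun _ => 0) = 0 := by simp [ip]

theorem lin_bdd {n : ℕ} {ε : ℝ} (hε : 0 < ε) {U : ℝ → Sn n} (h : Evol ε U (fun _ _ => 0)) (s t : ℝ) :
    ∃ K, ∀ τ ∈ Set.Icc s t, nsq (U τ) ≤ K := by
  refine loc_bdd (fun t => nsq (U t)) ?_ id monotone_id ?_ s t
  · intro k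
    refine closed_sub (fun t x => ‖U t x‖ ^ 2) ?_ (fun t x => by positivity) (fun t => nsq_int _) k
    have := h.smooth.continuous
    fun_prop
  · rintro s t hst ⟨K, hK⟩
    have h0 : nsq (fun _ : Rn n => (0 : ℂ)) = 0 := by simp [nsq]
    have := (energy_id hε h hst (K := K) hK (fun _ _ => MemLp.zero) (fun τ hτ => by
      rw [h0]; exact (nsq_nonneg _).trans (hK τ hτ))).2
    simp only [ip_zero_r, Complex.zero_im, intervalIntegral.integral_zero, mul_zero] at this
    simp only [id]
    constructor <;> linarith



def EB {n : ℕ} (U : ℝ → Sn n) (F : ℝ → Rn n → ℂ) : Prop :=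
  ∀ s t, ∃ K, ∀ τ ∈ Set.Icc s t, nsq (U τ) ≤ K ∧ MemLp (F τ) 2 volume ∧ nsq (F τ) ≤ K

lemma E_bound {n : ℕ} {ε : ℝ} (hε : 0 < ε) {U : ℝ → Sn n} {F : ℝ → Rn n → ℂ} (h : Evol ε U F)
    (hb : EB U F) {s T : ℝ} (hsT : s ≤ T) {g : ℝ → ℝ} (hg : Continuous g)
    (hle : ∀ τ ∈ Set.Icc s T, (ip (U τ) (F τ)).im ≤ g τ) :
    nsq (U T) ≤ nsq (U s) + 2 / ε * ∫ τ in s..T, g τ := by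
  obtain ⟨K, hK⟩ := hb s T
  obtain ⟨h1, h2⟩ := energy_id hε h hsT (K := K) (fun τ hτ => (hK τ hτ).1) (fun τ hτ => (hK τ hτ).2.1)
    (fun τ hτ => (hK τ hτ).2.2)
  have h3 : ∫ τ in s..T, (ip (U τ) (F τ)).im ≤ ∫ τ in s..T, g τ :=
    intervalIntegral.integral_mono_on hsT h1 (hg.intervalIntegrable _ _) hle
  have h4 : 2 / ε * ∫ τ in s..T, (ip (U τ) (F τ)).im ≤ 2 / ε * ∫ τ in s..T, g τ := by gcongr
  linarith

lemma E_lip {n : ℕ} {ε : ℝ} (hε : 0 < ε) {U : ℝ → Sn n} {F : ℝ → Rn n → ℂ} (h : Evol ε U F)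
    {s T K : ℝ} (hsT : s ≤ T)
    (hK : ∀ τ ∈ Set.Icc s T, nsq (U τ) ≤ K ∧ MemLp (F τ) 2 volume ∧ nsq (F τ) ≤ K) :
    |nsq (U T) - nsq (U s)| ≤ 2 / ε * K * (T - s) := by
  obtain ⟨h1, h2⟩ := energy_id hε h hsT (K := K) (fun τ hτ => (hK τ hτ).1) (fun τ hτ => (hK τ hτ).2.1)
    (fun τ hτ => (hK τ hτ).2.2)
  have h3 : ‖∫ τ in s..T, (ip (U τ) (F τ)).im‖ ≤ K * |T - s| := by
    refine intervalIntegral.norm_integral_le_of_norm_le_const fun τ hτ => ?_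
    rw [Set.uIoc_of_le hsT] at hτ
    obtain ⟨a1, a2, a3⟩ := hK τ ⟨hτ.1.le, hτ.2⟩
    have hK0 : 0 ≤ K := (nsq_nonneg _).trans a1
    calc ‖(ip (U τ) (F τ)).im‖ ≤ ‖ip (U τ) (F τ)‖ := Complex.abs_im_le_norm _
      _ ≤ √(nsq (U τ)) * √(nsq (F τ)) := norm_ip_le _ _ ((U τ).memLp 2 volume) a2
      _ ≤ √K * √K := by gcongr
      _ = K := Real.mul_self_sqrt hK0
  rw [abs_of_nonneg (sub_nonneg.2 hsT), Real.norm_eq_abs] at h3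
  rw [h2, abs_mul, abs_of_pos (by positivity : 0 < 2 / ε), mul_assoc]
  gcongr

lemma E_cont {n : ℕ} {ε : ℝ} (hε : 0 < ε) {U : ℝ → Sn n} {F : ℝ → Rn n → ℂ} (h : Evol ε U F)
    (hb : EB U F) : Continuous fun t => nsq (U t) := by
  rw [continuous_iff_continuousAt]
  intro t
  obtain ⟨K, hK⟩ := hb (t - 1) (t + 1)
  have key : ∀ s ∈ Set.Icc (t - 1) (t + 1), |nsq (U s) - nsq (U t)| ≤ 2 / ε * K * |s - t| := by
    intro s hs
    rcases le_total s t with hst | hst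
    · rw [abs_sub_comm, abs_sub_comm s, abs_of_nonneg (sub_nonneg.2 hst)]
      exact E_lip hε h hst fun τ hτ => hK τ ⟨hs.1.trans hτ.1, by linarith [hτ.2]⟩
    · rw [abs_of_nonneg (sub_nonneg.2 hst)]
      exact E_lip hε h hst fun τ hτ => hK τ ⟨by linarith [hτ.1], hτ.2.trans hs.2⟩
  show Tendsto _ _ _
  rw [tendsto_iff_norm_sub_tendsto_zero]
  refine squeeze_zero' (Eventually.of_forall fun _ => norm_nonneg _) (g := fun s => 2 / ε * K * |s - t|) ?_ ?_
  · filter_upwards [Icc_mem_nhds (show t - 1 < t by linarith) (show t < t + 1 by linarith)] with s hs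
    exact key s hs
  · have : Continuous fun s => 2 / ε * K * |s - t| := by fun_prop
    have := this.tendsto t
    simpa using this

lemma bD_le {n : ℕ} (j : Fin n) (φ : Sn n) (a b : ℂ) (ha : conj a = a) (hb : conj b = -b) (y : Rn n) :
    ‖b * Do j (cm φ φ) y‖ ≤ 2 * (‖φ y‖ * ‖(a • Xo j φ + b • Do j φ : Sn n) y‖) := by
  have e : b * Do j (cm φ φ) y = conj (φ y) * (a • Xo j φ + b • Do j φ : Sn n) y
      - φ y * conj ((a • Xo j φ + b • Do j φ : Sn n) y) := by
    have e2 : (a • Xo j φ + b • Do j φ : Sn n) y = a * (((y j : ℝ) : ℂ) * φ y) + b * Do j φ y := by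
      rw [← Xo_apply]; rfl
    have e3 : Do j (cm φ φ) y = conj (Do j φ y) * φ y + conj (φ y) * Do j φ y := by
      rw [D_cm]
      show cm (Do j φ) φ y + cm φ (Do j φ) y = _
      rw [cm_apply, cm_apply]
    rw [e2, e3]
    simp only [map_add, map_mul, ha, hb, Complex.conj_ofReal]
    ring
  rw [e]
  refine (norm_sub_le _ _).trans ?_
  rw [norm_mul, norm_mul, Complex.norm_conj, Complex.norm_conj]
  linarith

/-- The vector-field evolution, with cancelling coefficients. -/
structure VF (ε : ℝ) (a b : ℝ → ℂ) : Prop where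
  ca : ContDiff ℝ (⊤ : ℕ∞) a
  cb : ContDiff ℝ (⊤ : ℕ∞) b
  da : ∀ t, HasDerivAt a (Complex.I * b t / ε) t
  db : ∀ t, HasDerivAt b (Complex.I * ε * a t) t
  ra : ∀ t, conj (a t) = a t
  rb : ∀ t, conj (b t) = -b t

def vf {n : ℕ} (a b : ℝ → ℂ) (U : ℝ → Sn n) (j : Fin n) (t : ℝ) : Sn n := a t • Xo j (U t) + b t • Do j (U t)

def vF {n : ℕ} (ε α : ℝ) (a b : ℝ → ℂ) (U : ℝ → Sn n) (j : Fin n) (t : ℝ) (x : Rn n) : ℂ :=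
  ((ε ^ α : ℝ) : ℂ) * (((hartree 1 (U t) x : ℝ) : ℂ) * vf a b U j t x + b t * pot (Do j (cm (U t) (U t))) x * U t x)

lemma vf_evol {n : ℕ} (hn : 2 ≤ n) {ε α : ℝ} (hε : 0 < ε) {U : ℝ → Sn n} (h : Sol ε α U) {a b : ℝ → ℂ}
    (hv : VF ε a b) (j : Fin n) : Evol ε (vf a b U j) (vF ε α a b U j) := by
  have := Sol.ab hn hε h j a b _ _ hv.ca hv.cb hv.da hv.db
  have hε' : (ε : ℂ) ≠ 0 := by exact_mod_cast hε.ne'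
  have e1 : ∀ t, Complex.I * ↑ε * (Complex.I * b t / ε) + b t = 0 := by
    intro t
    field_simp
    rw [Complex.I_sq]; ring
  have e2 : ∀ t, Complex.I * ↑ε * (Complex.I * ε * a t) + (ε : ℂ) ^ 2 * a t = 0 := by
    intro t
    linear_combination (ε : ℂ) ^ 2 * a t * Complex.I_sq
  simp only [e1, e2, zero_mul, add_zero] at this
  exact this

lemma vf_EB {n : ℕ} (hn : 2 ≤ n) {ε α : ℝ} (hε : 0 < ε) {U : ℝ → Sn n} (h : Sol ε α U) {a b : ℝ → ℂ}
    (hv : VF ε a b) (j : Fin n) : EB (vf a b U j) (vF ε α a b U j) := by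
  intro s t
  obtain ⟨K, hK⟩ := Sol.bdd hn hε h s t
  obtain ⟨Ca, hCa⟩ := (isCompact_Icc (a := s) (b := t)).exists_bound_of_continuousOn hv.ca.continuous.continuousOn
  obtain ⟨Cb, hCb⟩ := (isCompact_Icc (a := s) (b := t)).exists_bound_of_continuousOn hv.cb.continuous.continuousOn
  set K1 : ℝ := 2 * (Ca ^ 2 * K) + 2 * (Cb ^ 2 * K) with hK1
  set K2 : ℝ := ‖((ε ^ α : ℝ) : ℂ)‖ ^ 2 * (10 * (2 * n * K) ^ 2 * K1) with hK2
  have k1 : ∀ τ ∈ Set.Icc s t, nsq (vf a b U j τ) ≤ K1 := by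
    intro τ hτ
    have e := nsq_add_le (fun x => a τ * Xo j (U τ) x) (fun x => b τ * Do j (U τ) x)
      (((Xo j (U τ)).memLp 2 volume).const_mul _) (((Do j (U τ)).memLp 2 volume).const_mul _)
    rw [nsq_smul, nsq_smul] at e
    refine (show nsq (vf a b U j τ) ≤ _ from e).trans ?_
    have a1 := ((Nf_ge (U τ)).2.1 j).trans (hK τ hτ)
    have a2 := ((Nf_ge (U τ)).2.2 j).trans (hK τ hτ)
    have := hCa τ hτ
    have := hCb τ hτ
    have := nsq_nonneg (Xo j (U τ))
    have := nsq_nonneg (Do j (U τ))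
    rw [hK1]
    gcongr
  refine ⟨max K1 K2, fun τ hτ => ?_⟩
  have hA : ∀ x, hartree 1 (U τ) x ≤ 2 * n * K := fun x => (hart_Nf hn _ x).trans (by have := hK τ hτ; gcongr)
  obtain ⟨f1, f2, f3⟩ := F_mem hn (Do j (cm (U τ) (U τ))) (U τ) (vf a b U j τ) ((ε ^ α : ℝ) : ℂ) (b τ) hA
    (bD_le j (U τ) (a τ) (b τ) (hv.ra τ) (hv.rb τ))
  refine ⟨(k1 τ hτ).trans (le_max_left _ _), f1, le_trans f2 (le_trans ?_ (le_max_right _ _))⟩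
  have := k1 τ hτ
  rw [hK2]
  gcongr

lemma vf_im {n : ℕ} (hn : 2 ≤ n) {ε α : ℝ} (hε : 0 < ε) {U : ℝ → Sn n} {a b : ℝ → ℂ}
    (hv : VF ε a b) (j : Fin n) (τ : ℝ) {A : ℝ} (hA : ∀ x, hartree 1 (U τ) x ≤ A) :
    (ip (vf a b U j τ) (vF ε α a b U j τ)).im ≤ ε ^ α * (3 * A * nsq (vf a b U j τ)) := by
  obtain ⟨f1, f2, f3⟩ := F_mem hn (Do j (cm (U τ) (U τ))) (U τ) (vf a b U j τ) ((ε ^ α : ℝ) : ℂ) (b τ) hA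
    (bD_le j (U τ) (a τ) (b τ) (hv.ra τ) (hv.rb τ))
  rw [Complex.norm_real, Real.norm_eq_abs, abs_of_nonneg (by positivity : 0 ≤ ε ^ α)] at f3
  exact (le_abs_self _).trans f3

lemma VF_J {ε : ℝ} (hε : 0 < ε) : VF ε (fun t => ((Real.sin t / ε : ℝ) : ℂ)) (fun t => -Complex.I * ((Real.cos t : ℝ) : ℂ)) where
  ca := Complex.ofRealCLM.contDiff.comp (by fun_prop : ContDiff ℝ (⊤ : ℕ∞) fun t : ℝ => Real.sin t / ε)
  cb := contDiff_const.mul (Complex.ofRealCLM.contDiff.comp Real.contDiff_cos)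
  da t := by
    have := ((Real.hasDerivAt_sin t).div_const ε).ofReal_comp
    convert this using 1
    push_cast
    linear_combination (-((Complex.cos t) / ε)) * Complex.I_sq
  db t := by
    have := ((Real.hasDerivAt_cos t).ofReal_comp).const_mul (-Complex.I)
    have hε' : (ε : ℂ) ≠ 0 := by exact_mod_cast hε.ne'
    have e : Complex.I * (ε : ℂ) * ((Real.sin t / ε : ℝ) : ℂ) = -Complex.I * ((-Real.sin t : ℝ) : ℂ) := by
      push_cast
      field_simp
    rw [e]
    exact this
  ra t := Complex.conj_ofReal _
  rb t := by rw [map_mul, Complex.conj_ofReal]; simp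

lemma VF_H {ε : ℝ} (hε : 0 < ε) : VF ε (fun t => ((Real.cos t : ℝ) : ℂ)) (fun t => Complex.I * ((ε * Real.sin t : ℝ) : ℂ)) where
  ca := Complex.ofRealCLM.contDiff.comp Real.contDiff_cos
  cb := contDiff_const.mul (Complex.ofRealCLM.contDiff.comp (by fun_prop : ContDiff ℝ (⊤ : ℕ∞) fun t : ℝ => ε * Real.sin t))
  da t := by
    have := (Real.hasDerivAt_cos t).ofReal_comp
    convert this using 1
    have hε' : (ε : ℂ) ≠ 0 := by exact_mod_cast hε.ne'
    push_cast
    field_simp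
    rw [Complex.I_sq]; ring
  db t := by
    have := (((Real.hasDerivAt_sin t).const_mul ε).ofReal_comp).const_mul (Complex.I)
    have e : Complex.I * (ε : ℂ) * ((Real.cos t : ℝ) : ℂ) = Complex.I * ((ε * Real.cos t : ℝ) : ℂ) := by
      push_cast
      ring
    rw [e]
    exact this
  ra t := Complex.conj_ofReal _
  rb t := by rw [map_mul, Complex.conj_ofReal]; simp



def Pk (ε τ : ℝ) : ℝ := (|Real.cos τ| + ε)⁻¹

lemma Pk_pos {ε : ℝ} (hε : 0 < ε) (τ : ℝ) : 0 < Pk ε τ := by unfold Pk; positivity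

lemma Pk_cont {ε : ℝ} (hε : 0 < ε) : Continuous (Pk ε) := by
  unfold Pk
  refine Continuous.inv₀ (by fun_prop) fun τ => ?_
  positivity

lemma Pk_half {ε : ℝ} (hε : 0 < ε) (h2 : ε ≤ 1 / 2) :
    ∫ τ in (0:ℝ)..(π / 2), Pk ε τ ≤ π * Real.log (1 / ε) := by
  have hp := Real.pi_pos
  have hpos : ∀ τ ∈ Set.Icc 0 (π / 2), 0 < 1 - 2 / π * τ + ε := by
    intro τ hτ
    have : 2 / π * τ ≤ 2 / π * (π / 2) := by gcongr; exact hτ.2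
    have e : 2 / π * (π / 2) = 1 := by field_simp
    linarith
  have hq : ContinuousOn (fun τ => (1 - 2 / π * τ + ε)⁻¹) (Set.Icc 0 (π / 2)) :=
    ContinuousOn.inv₀ (by fun_prop) fun τ hτ => (hpos τ hτ).ne'
  have hqi : IntervalIntegrable (fun τ => (1 - 2 / π * τ + ε)⁻¹) volume 0 (π / 2) :=
    ContinuousOn.intervalIntegrable (by rwa [Set.uIcc_of_le (by positivity)])
  have h1 : ∫ τ in (0:ℝ)..(π / 2), Pk ε τ ≤ ∫ τ in (0:ℝ)..(π / 2), (1 - 2 / π * τ + ε)⁻¹ := by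
    refine intervalIntegral.integral_mono_on (by positivity) ((Pk_cont hε).intervalIntegrable _ _) hqi ?_
    intro τ hτ
    refine inv_anti₀ (hpos τ hτ) ?_
    have := Real.one_sub_mul_le_cos hτ.1 hτ.2
    linarith [le_abs_self (Real.cos τ)]
  have h2' : ∫ τ in (0:ℝ)..(π / 2), (1 - 2 / π * τ + ε)⁻¹ = π / 2 * (Real.log (1 + ε) - Real.log ε) := by
    rw [intervalIntegral.integral_eq_sub_of_hasDerivAt (f := fun τ => -(π / 2) * Real.log (1 - 2 / π * τ + ε)) _ hqi]
    · have e : 1 - 2 / π * (π / 2) + ε = ε := by field_simp; ring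
      rw [e]
      simp only [mul_zero, sub_zero]
      ring
    · intro τ hτ
      rw [Set.uIcc_of_le (by positivity)] at hτ
      have a1 : HasDerivAt (fun τ : ℝ => 1 - 2 / π * τ + ε) (-(2 / π)) τ := by
        have := (((hasDerivAt_id τ).const_mul (2 / π)).const_sub 1).add_const ε
        simpa using this
      have := (a1.log (hpos τ hτ).ne').const_mul (-(π / 2))
      have e : (1 - 2 / π * τ + ε)⁻¹ = -(π / 2) * (-(2 / π) / (1 - 2 / π * τ + ε)) := by
        have := (hpos τ hτ).ne'
        rw [div_eq_mul_inv (-(2/π))]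
        have e3 : π / 2 * (2 / π) = 1 := by field_simp
        linear_combination (-(1 - 2 / π * τ + ε)⁻¹) * e3
      rw [e]; exact this
  rw [h2'] at h1
  have h3 : Real.log (1 + ε) ≤ Real.log (1 / ε) := by
    refine Real.log_le_log (by linarith) ?_
    rw [le_div_iff₀ hε]; nlinarith
  have h4 : Real.log (1 / ε) = -Real.log ε := by rw [one_div, Real.log_inv]
  refine h1.trans ?_
  nlinarith

lemma Pk_int (T : ℝ) : ∃ C : ℝ, 0 < C ∧ ∀ ε : ℝ, 0 < ε → ε ≤ 1 / 2 → ∀ t ∈ Set.Icc 0 T,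
    ∫ τ in (0:ℝ)..t, Pk ε τ ≤ C * Real.log (1 / ε) := by
  have hp := Real.pi_pos
  obtain ⟨N, hN⟩ := exists_nat_gt (T / π)
  refine ⟨(N + 1) * (2 * π), by positivity, fun ε hε h2 t ht => ?_⟩
  have hi : ∀ a b, IntervalIntegrable (Pk ε) volume a b := (Pk_cont hε).intervalIntegrable
  have hl : 0 ≤ Real.log (1 / ε) := Real.log_nonneg (by rw [le_div_iff₀ hε]; linarith)
  have hper : Function.Periodic (Pk ε) π := by
    intro τ
    simp only [Pk, Real.cos_add_pi, abs_neg]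
  have h1 : ∫ τ in (0:ℝ)..π, Pk ε τ ≤ 2 * π * Real.log (1 / ε) := by
    rw [← intervalIntegral.integral_add_adjacent_intervals (hi 0 (π / 2)) (hi (π / 2) π)]
    have e : ∫ τ in (π / 2)..π, Pk ε τ = ∫ τ in (0:ℝ)..(π / 2), Pk ε τ := by
      have := intervalIntegral.integral_comp_sub_left (a := 0) (b := π / 2) (Pk ε) π
      rw [show π - π / 2 = π / 2 by ring, sub_zero] at this
      rw [← this]
      congr 1; ext τ
      simp only [Pk, Real.cos_pi_sub, abs_neg]
    rw [e]
    linarith [Pk_half hε h2]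
  have h3 : ∫ τ in (0:ℝ)..((N : ℝ) * π), Pk ε τ = N * ∫ τ in (0:ℝ)..π, Pk ε τ := by
    have := hper.intervalIntegral_add_zsmul_eq (N : ℤ) 0 hi
    simpa using this
  have h4 : t ≤ N * π := by
    have := (div_lt_iff₀ hp).1 hN
    linarith [ht.2]
  have h5 : ∫ τ in (0:ℝ)..t, Pk ε τ ≤ ∫ τ in (0:ℝ)..((N : ℝ) * π), Pk ε τ :=
    intervalIntegral.integral_mono_interval le_rfl ht.1 h4
      (Eventually.of_forall fun τ => (Pk_pos hε τ).le) (hi _ _)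
  rw [h3] at h5
  refine h5.trans ?_
  have : (N : ℝ) * ∫ τ in (0:ℝ)..π, Pk ε τ ≤ N * (2 * π * Real.log (1 / ε)) := by gcongr
  nlinarith [mul_nonneg hp.le hl]

lemma boot {Y : ℝ → ℝ} (hY : Continuous Y) {T K' K : ℝ} (hK : K' < K) (h00 : Y 0 ≤ K)
    (h : ∀ t ∈ Set.Icc 0 T, (∀ τ ∈ Set.Icc 0 t, Y τ ≤ K) → Y t ≤ K') :
    ∀ t ∈ Set.Icc 0 T, Y t ≤ K := by
  by_contra! hc
  obtain ⟨t, ht, hYt⟩ := hc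
  have hcpt : IsCompact (Set.Icc 0 T ∩ {t | K ≤ Y t}) :=
    isCompact_Icc.inter_right (isClosed_le continuous_const hY)
  obtain ⟨t0, ht0, hmin⟩ := hcpt.exists_isLeast ⟨t, ht, hYt.le⟩
  have hle : ∀ τ ∈ Set.Ico 0 t0, Y τ ≤ K := by
    intro τ hτ
    by_contra! hc
    exact absurd (hmin ⟨⟨hτ.1, hτ.2.le.trans ht0.1.2⟩, hc.le⟩) (not_le.2 hτ.2)
  have h0K : Y t0 ≤ K := by
    rcases ht0.1.1.eq_or_lt with h0 | h0
    · rw [← h0]; exact h00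
    · have hcl : IsClosed {τ | Y τ ≤ K} := isClosed_le hY continuous_const
      have : Set.Ico 0 t0 ⊆ {τ | Y τ ≤ K} := hle
      have h2 := hcl.closure_subset_iff.2 this
      rw [closure_Ico h0.ne] at h2
      exact h2 ⟨h0.le, le_rfl⟩
  have := h t0 ht0.1 (fun τ hτ => by
    rcases hτ.2.eq_or_lt with h1 | h1
    · rw [h1]; exact h0K
    · exact hle τ ⟨hτ.1, h1⟩)
  exact absurd (ht0.2 : K ≤ Y t0) (not_le.2 (this.trans_lt hK))



def Jv {n : ℕ} (ε : ℝ) (U : ℝ → Sn n) (j : Fin n) (t : ℝ) : Sn n :=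
  vf (fun t => ((Real.sin t / ε : ℝ) : ℂ)) (fun t => -Complex.I * ((Real.cos t : ℝ) : ℂ)) U j t

def Hv {n : ℕ} (ε : ℝ) (U : ℝ → Sn n) (j : Fin n) (t : ℝ) : Sn n :=
  vf (fun t => ((Real.cos t : ℝ) : ℂ)) (fun t => Complex.I * ((ε * Real.sin t : ℝ) : ℂ)) U j t

def Yq {n : ℕ} (ε : ℝ) (U : ℝ → Sn n) (t : ℝ) : ℝ := ∑ j, (nsq (Jv ε U j t) + nsq (Hv ε U j t))

lemma Yq_ge {n : ℕ} (ε : ℝ) (U : ℝ → Sn n) (t : ℝ) :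
    0 ≤ Yq ε U t ∧ (∀ j, nsq (Jv ε U j t) ≤ Yq ε U t) ∧ ∀ j, nsq (Hv ε U j t) ≤ Yq ε U t := by
  unfold Yq
  have h0 : ∀ j ∈ Finset.univ, 0 ≤ nsq (Jv ε U j t) + nsq (Hv ε U j t) := fun j _ =>
    add_nonneg (nsq_nonneg _) (nsq_nonneg _)
  refine ⟨Finset.sum_nonneg h0, fun j => ?_, fun j => ?_⟩ <;>
  · have := Finset.single_le_sum h0 (Finset.mem_univ j)
    linarith [nsq_nonneg (Jv ε U j t), nsq_nonneg (Hv ε U j t)]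

lemma hart_Y {n : ℕ} (hn : 2 ≤ n) {ε : ℝ} (hε : 0 < ε) (h1 : ε ≤ 1) (U : ℝ → Sn n) (τ : ℝ) (x : Rn n) :
    hartree 1 (U τ) x ≤ 8 * n * √(nsq (U τ)) * √(Yq ε U τ) * Pk ε τ := by
  obtain ⟨y0, yJ, yH⟩ := Yq_ge ε U τ
  have a1 : |Real.cos τ| * hartree 1 (U τ) x ≤ 2 * √(nsq (U τ)) * (n * √(Yq ε U τ)) := by
    refine (hardy_w hn (U τ) (fun j => Jv ε U j τ) |Real.cos τ| (abs_nonneg _) ?_ x).trans ?_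
    · intro j y
      have := bD_le j (U τ) _ _ ((VF_J hε).ra τ) ((VF_J hε).rb τ) y
      rw [norm_mul, norm_mul, norm_neg, Complex.norm_I, one_mul, Complex.norm_real, Real.norm_eq_abs] at this
      exact this
    · gcongr
      refine (Finset.sum_le_sum fun j _ => Real.sqrt_le_sqrt (yJ j)).trans ?_
      simp
  have a2 : (ε * |Real.sin τ|) * hartree 1 (U τ) x ≤ 2 * √(nsq (U τ)) * (n * √(Yq ε U τ)) := by
    refine (hardy_w hn (U τ) (fun j => Hv ε U j τ) (ε * |Real.sin τ|) (by positivity) ?_ x).trans ?_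
    · intro j y
      have := bD_le j (U τ) _ _ ((VF_H hε).ra τ) ((VF_H hε).rb τ) y
      rw [norm_mul, norm_mul, Complex.norm_I, one_mul, Complex.norm_real, Real.norm_eq_abs, abs_mul,
        abs_of_pos hε] at this
      exact this
    · gcongr
      refine (Finset.sum_le_sum fun j _ => Real.sqrt_le_sqrt (yH j)).trans ?_
      simp
  have hV := hart_nonneg (U τ) x
  have hsc : 1 ≤ |Real.cos τ| + |Real.sin τ| := by
    have c1 := Real.abs_cos_le_one τ
    have c2 := Real.abs_sin_le_one τ
    have c3 := Real.sin_sq_add_cos_sq τ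
    rw [← sq_abs (Real.sin τ), ← sq_abs (Real.cos τ)] at c3
    nlinarith [abs_nonneg (Real.cos τ), abs_nonneg (Real.sin τ)]
  have a3 : (|Real.cos τ| + ε) * hartree 1 (U τ) x ≤ 8 * n * √(nsq (U τ)) * √(Yq ε U τ) := by
    have d1 : |Real.cos τ| + ε ≤ 2 * (|Real.cos τ| + ε * |Real.sin τ|) := by
      have e1 : ε * 1 ≤ ε * (|Real.cos τ| + |Real.sin τ|) := by gcongr
      have e2 : ε * |Real.cos τ| ≤ 1 * |Real.cos τ| := by gcongr
      have e3 : 0 ≤ ε * |Real.sin τ| := by positivity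
      linarith
    have d2 := mul_le_mul_of_nonneg_right d1 hV
    linarith
  unfold Pk
  rw [← div_eq_mul_inv, le_div_iff₀ (by positivity)]
  linarith

lemma rpow_red {ε α : ℝ} (hε : 0 < ε) : ε ^ α = ε ^ (α - 1) * ε := by
  rw [Real.rpow_sub_one hε.ne']; field_simp

lemma vf_step {n : ℕ} (hn : 2 ≤ n) {ε α : ℝ} (hε : 0 < ε) {U : ℝ → Sn n} (h : Sol ε α U) {a b : ℝ → ℂ}
    (hv : VF ε a b) (j : Fin n) {t D K Ip : ℝ} (ht : 0 ≤ t) (hD : 0 ≤ D) (hK : 0 ≤ K)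
    (hA : ∀ τ ∈ Set.Icc 0 t, ∀ x, hartree 1 (U τ) x ≤ D * Pk ε τ)
    (hY : ∀ τ ∈ Set.Icc 0 t, nsq (vf a b U j τ) ≤ K) (hI : ∫ τ in (0:ℝ)..t, Pk ε τ ≤ Ip) :
    nsq (vf a b U j t) ≤ nsq (vf a b U j 0) + 6 * ε ^ (α - 1) * (D * K * Ip) := by
  have h1 := E_bound hε (vf_evol hn hε h hv j) (vf_EB hn hε h hv j) ht
    (g := fun τ => (ε ^ α * 3 * D * K) * Pk ε τ) ((Pk_cont hε).const_mul _ |> fun h => by simpa using h) (by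
      intro τ hτ
      refine (vf_im hn hε hv j τ (hA τ hτ)).trans ?_
      have := hY τ hτ
      have p := Pk_pos hε τ
      calc ε ^ α * (3 * (D * Pk ε τ) * nsq (vf a b U j τ)) ≤ ε ^ α * (3 * (D * Pk ε τ) * K) := by gcongr
        _ = _ := by ring)
  rw [intervalIntegral.integral_const_mul, rpow_red hε] at h1
  refine h1.trans ?_
  have e : 2 / ε * (ε ^ (α - 1) * ε * 3 * D * K * ∫ τ in (0:ℝ)..t, Pk ε τ) =
      6 * ε ^ (α - 1) * (D * K * ∫ τ in (0:ℝ)..t, Pk ε τ) := by field_simp; ring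
  rw [e]
  gcongr

lemma Y_cont {n : ℕ} (hn : 2 ≤ n) {ε α : ℝ} (hε : 0 < ε) {U : ℝ → Sn n} (h : Sol ε α U) :
    Continuous (Yq ε U) := by
  unfold Yq
  refine continuous_finset_sum _ fun j _ => ?_
  exact (E_cont hε (vf_evol hn hε h (VF_J hε) j) (vf_EB hn hε h (VF_J hε) j)).add
    (E_cont hε (vf_evol hn hε h (VF_H hε) j) (vf_EB hn hε h (VF_H hε) j))

lemma mass' {n : ℕ} (hn : 2 ≤ n) {ε α : ℝ} (hε : 0 < ε) {U : ℝ → Sn n} (h : Sol ε α U) {t : ℝ} (ht : 0 ≤ t) :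
    nsq (U t) = nsq (U 0) := by
  obtain ⟨K, hK⟩ := Sol.bdd hn hε h 0 t
  exact mass hn hε h ht (K := K) (A := 2 * n * K) (fun τ hτ => (Nf_ge _).1.trans (hK τ hτ))
    fun τ hτ x => (hart_Nf hn _ x).trans (by have := hK τ hτ; gcongr)

theorem Y_bdd {n : ℕ} (hn : 2 ≤ n) {ε α : ℝ} (hε : 0 < ε) (h1 : ε ≤ 1) {U : ℝ → Sn n} (h : Sol ε α U)
    {T K D Ip : ℝ} (hK : K = Yq ε U 0 + 1) (hD : D = 8 * n * √(nsq (U 0)) * √K)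
    (hI : ∀ t ∈ Set.Icc 0 T, ∫ τ in (0:ℝ)..t, Pk ε τ ≤ Ip)
    (hsm : 12 * n * ε ^ (α - 1) * (D * K * Ip) ≤ 1 / 2) :
    ∀ t ∈ Set.Icc 0 T, ∀ x, hartree 1 (U t) x ≤ D * Pk ε t := by
  have hK0 : 0 ≤ K := by have := (Yq_ge ε U 0).1; linarith
  have hD0 : 0 ≤ D := by rw [hD]; positivity
  have hA : ∀ τ, 0 ≤ τ → Yq ε U τ ≤ K → ∀ x, hartree 1 (U τ) x ≤ D * Pk ε τ := by
    intro τ h0 hY x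
    refine (hart_Y hn hε h1 U τ x).trans ?_
    have := (Pk_pos hε τ).le
    rw [hD, mass' hn hε h h0]
    gcongr
  have main := boot (Y_cont hn hε h) (T := T) (K' := Yq ε U 0 + 1 / 2) (K := K) (by linarith) (by linarith) ?_
  · exact fun t ht => hA t ht.1 (main t ht)
  intro t ht hY
  have hs : ∀ j, nsq (Jv ε U j t) + nsq (Hv ε U j t) ≤ (nsq (Jv ε U j 0) + nsq (Hv ε U j 0)) +
      12 * ε ^ (α - 1) * (D * K * Ip) := by
    intro j
    have b1 := vf_step hn hε h (VF_J hε) j ht.1 hD0 hK0 (fun τ hτ => hA τ hτ.1 (hY τ hτ))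
      (fun τ hτ => ((Yq_ge ε U τ).2.1 j).trans (hY τ hτ)) (hI t ht)
    have b2 := vf_step hn hε h (VF_H hε) j ht.1 hD0 hK0 (fun τ hτ => hA τ hτ.1 (hY τ hτ))
      (fun τ hτ => ((Yq_ge ε U τ).2.2 j).trans (hY τ hτ)) (hI t ht)
    unfold Jv Hv
    linarith
  have := Finset.sum_le_sum fun (j : Fin n) (_ : j ∈ Finset.univ) => hs j
  rw [Finset.sum_add_distrib (g := fun _ => 12 * ε ^ (α - 1) * (D * K * Ip))] at this
  simp only [Finset.sum_const, Finset.card_univ, Fintype.card_fin, nsmul_eq_mul] at this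
  have e : Yq ε U t ≤ Yq ε U 0 + n * (12 * ε ^ (α - 1) * (D * K * Ip)) := this
  linarith

theorem w_bound {n : ℕ} (hn : 2 ≤ n) {ε α : ℝ} (hε : 0 < ε) {U Uf : ℝ → Sn n} (h : Sol ε α U)
    (hf : Evol ε Uf (fun _ _ => 0)) (h0 : U 0 = Uf 0) {T D Ip : ℝ} (hT : 0 ≤ T) (hD : 0 ≤ D)
    (hA : ∀ t ∈ Set.Icc 0 T, ∀ x, hartree 1 (U t) x ≤ D * Pk ε t)
    (hI : ∀ t ∈ Set.Icc 0 T, ∫ τ in (0:ℝ)..t, Pk ε τ ≤ Ip) :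
    ∀ t ∈ Set.Icc 0 T, √(nsq (U t - Uf t : Sn n)) ≤ 2 * ε ^ (α - 1) * (√(nsq (U 0)) * D * Ip) := by
  have hw : Evol ε (fun t => U t - Uf t) (fun t => nl ε α (U t)) := by
    constructor
    · exact h.smooth.sub hf.smooth
    · intro t x
      have := (h.eq t x).sub (hf.eq t x)
      have e : -(Complex.I / ε) * (nl ε α (U t) x + Ho ε (U t - Uf t) x) =
          -(Complex.I / ε) * (nl ε α (U t) x + Ho ε (U t) x) - -(Complex.I / ε) * (0 + Ho ε (Uf t) x) := by
        rw [map_sub, SchwartzMap.sub_apply]; ring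
      rw [e]
      exact this
  have hb : EB (fun t => U t - Uf t) (fun t => nl ε α (U t)) := by
    intro s t
    obtain ⟨K, hK⟩ := Sol.bdd hn hε h s t
    obtain ⟨K', hK'⟩ := lin_bdd hε hf s t
    refine ⟨max (2 * K + 2 * K') ((ε ^ α) ^ 2 * ((2 * n * K) ^ 2 * K)), fun τ hτ => ?_⟩
    have k1 := (Nf_ge _).1.trans (hK τ hτ)
    obtain ⟨f1, f2, -⟩ := nl_mem (α := α) hn hε (U τ) (A := 2 * n * K) fun x =>
      (hart_Nf hn _ x).trans (by have := hK τ hτ; gcongr)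
    refine ⟨le_trans ?_ (le_max_left _ _), f1, (f2.trans ?_).trans (le_max_right _ _)⟩
    · have e := nsq_add_le (U τ) (-Uf τ : Sn n) ((U τ).memLp 2 volume) ((-Uf τ : Sn n).memLp 2 volume)
      have e2 : nsq (-Uf τ : Sn n) = nsq (Uf τ) := by
        unfold nsq
        congr 1; ext x
        rw [SchwartzMap.neg_apply, norm_neg]
      have e3 : nsq (U τ - Uf τ : Sn n) = nsq (fun x => U τ x + (-Uf τ : Sn n) x) := by
        unfold nsq
        refine integral_congr_ae (Eventually.of_forall fun x => ?_)
        show ‖U τ x - Uf τ x‖ ^ 2 = ‖U τ x + -Uf τ x‖ ^ 2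
        rw [sub_eq_add_neg]
      rw [e3]
      have := hK' τ hτ
      rw [e2] at e
      linarith
    · gcongr
  have hc := E_cont hε hw hb
  have hcs : Continuous fun t => √(nsq (U t - Uf t : Sn n)) := hc.sqrt
  obtain ⟨t0, ht0, hmax⟩ := (isCompact_Icc (a := (0:ℝ)) (b := T)).exists_isMaxOn ⟨0, le_rfl, hT⟩ hcs.continuousOn
  set B := √(nsq (U t0 - Uf t0 : Sn n)) with hB
  have hB0 : 0 ≤ B := Real.sqrt_nonneg _
  have hle : ∀ t ∈ Set.Icc 0 T, √(nsq (U t - Uf t : Sn n)) ≤ B := fun t ht => hmax ht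
  refine fun t ht => (hle t ht).trans ?_
  set m := √(nsq (U 0)) with hm
  have h1 := E_bound hε hw hb ht0.1 (g := fun τ => (ε ^ α * B * D * m) * Pk ε τ)
    (continuous_const.mul (Pk_cont hε)) (by
      intro τ hτ
      have hτT : τ ∈ Set.Icc 0 T := ⟨hτ.1, hτ.2.trans ht0.2⟩
      obtain ⟨f1, f2, -⟩ := nl_mem (α := α) hn hε (U τ) (hA τ hτT)
      have p := (Pk_pos hε τ).le
      have q1 : √(nsq (nl ε α (U τ))) ≤ ε ^ α * (D * Pk ε τ) * m := by
        refine (Real.sqrt_le_sqrt f2).trans ?_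
        rw [mass' hn hε h hτ.1, Real.sqrt_mul (by positivity), Real.sqrt_sq (by positivity),
          Real.sqrt_mul (by positivity), Real.sqrt_sq (by positivity)]
        exact le_of_eq (by ring)
      calc _ ≤ ‖ip (U τ - Uf τ : Sn n) (nl ε α (U τ))‖ := (le_abs_self _).trans (Complex.abs_im_le_norm _)
        _ ≤ √(nsq (U τ - Uf τ : Sn n)) * √(nsq (nl ε α (U τ))) := norm_ip_le _ _ ((U τ - Uf τ : Sn n).memLp 2 volume) f1
        _ ≤ B * (ε ^ α * (D * Pk ε τ) * m) := by
            have := hle τ hτT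
            gcongr
        _ = _ := by ring)
  have hz : nsq (U 0 - Uf 0 : Sn n) = 0 := by
    rw [h0, sub_self]; simp [nsq]
  rw [intervalIntegral.integral_const_mul, rpow_red hε] at h1
  have e : 2 / ε * (ε ^ (α - 1) * ε * B * D * m * ∫ τ in (0:ℝ)..t0, Pk ε τ) =
      (2 * ε ^ (α - 1) * (m * D * ∫ τ in (0:ℝ)..t0, Pk ε τ)) * B := by field_simp
  rw [e, hz, zero_add] at h1
  have hBB : B * B = nsq (U t0 - Uf t0 : Sn n) := Real.mul_self_sqrt (nsq_nonneg _)
  have hm0 : 0 ≤ m := Real.sqrt_nonneg _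
  have h2 : B * B ≤ (2 * ε ^ (α - 1) * (m * D * Ip)) * B := by
    rw [hBB]
    refine h1.trans ?_
    have := hI t0 ht0
    gcongr
  rcases hB0.eq_or_lt with hz | hz
  · rw [← hz]
    have : 0 ≤ Ip := by
      refine le_trans ?_ (hI 0 ⟨le_rfl, hT⟩)
      simp
    positivity
  · exact le_of_mul_le_mul_right h2 hz



lemma eLp_nsq {n : ℕ} (f : Rn n → ℂ) (hf : MemLp f 2 volume) :
    eLpNorm f 2 volume = ENNReal.ofReal √(nsq f) := by
  rw [nsq_toLp f hf, Real.sqrt_sq (norm_nonneg _), Lp.norm_toLp, ENNReal.ofReal_toReal hf.2.ne]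

lemma to_evol {n : ℕ} {ε : ℝ} (hε : 0 < ε) {u : ℝ → Rn n → ℂ} {U : ℝ → Sn n} {F : ℝ → Rn n → ℂ}
    (hU : ∀ t, u t = ⇑(U t)) (hs : ContDiff ℝ (⊤ : ℕ∞) (fun p : ℝ × Rn n => u p.1 p.2))
    (he : ∀ t x, Complex.I * (ε : ℂ) * deriv (fun s => u s x) t + ((ε ^ 2 / 2 : ℝ) : ℂ) * lap (u t) x
      = ((‖x‖ ^ 2 / 2 : ℝ) : ℂ) * u t x + F t x) : Evol ε U F := by
  have hu : u = fun t => ⇑(U t) := funext hU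
  subst hu
  refine ⟨hs, fun t x => ?_⟩
  have h1 := slice_deriv hs t x
  have h2 := he t x
  have hε' : (ε : ℂ) ≠ 0 := by exact_mod_cast hε.ne'
  have h3 := h1.differentiableAt.hasDerivAt
  have e : -(Complex.I / ε) * (F t x + Ho ε (U t) x) = deriv (fun s => (U s) x) t := by
    rw [Ho_apply]
    have h4 : F t x + (-((ε ^ 2 / 2 : ℝ) : ℂ) * lap (U t) x + ((‖x‖ ^ 2 / 2 : ℝ) : ℂ) * U t x) =
        Complex.I * (ε : ℂ) * deriv (fun s => (U s) x) t := by linear_combination -h2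
    rw [h4]
    field_simp
    rw [Complex.I_sq]; ring
  rw [e]
  exact h3

lemma Yq_zero {n : ℕ} (ε : ℝ) (U : ℝ → Sn n) :
    Yq ε U 0 = ∑ j, (nsq (Do j (U 0)) + nsq (Xo j (U 0))) := by
  unfold Yq
  refine Finset.sum_congr rfl fun j _ => ?_
  have e1 : Jv ε U j 0 = (-Complex.I) • Do j (U 0) := by simp [Jv, vf]
  have e2 : Hv ε U j 0 = Xo j (U 0) := by simp [Hv, vf]
  rw [e1, e2]
  congr 1
  unfold nsq
  refine integral_congr_ae (Eventually.of_forall fun x => ?_)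
  show ‖(-Complex.I) * Do j (U 0) x‖ ^ 2 = _
  rw [norm_mul, norm_neg, Complex.norm_I, one_mul]

lemma small_eps {r : ℝ} (hr : 0 < r) {κ : ℝ} : ∃ ε₀ ∈ Set.Ioc (0:ℝ) (1/2), ∀ ε ∈ Set.Ioc 0 ε₀,
    κ * (ε ^ r * Real.log (1 / ε)) ≤ 1 / 2 := by
  have h1 : Tendsto (fun ε : ℝ => κ * (ε ^ r * Real.log (1 / ε))) (𝓝[>] 0) (𝓝 0) := by
    have := (tendsto_log_mul_rpow_nhdsGT_zero hr).const_mul (-κ)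
    rw [mul_zero] at this
    refine this.congr fun ε => ?_
    rw [one_div, Real.log_inv]; ring
  have h2 := h1.eventually (eventually_le_nhds (show (0:ℝ) < 1 / 2 by norm_num))
  rw [eventually_nhdsWithin_iff, Metric.eventually_nhds_iff] at h2
  obtain ⟨δ, hδ, h⟩ := h2
  refine ⟨min (δ / 2) (1 / 2), ⟨by positivity, min_le_right _ _⟩, fun ε hε => h ?_ hε.1⟩
  rw [Real.dist_eq, sub_zero, abs_of_pos hε.1]
  have := hε.2.trans (min_le_left _ _)
  linarith

theorem main6 (n : ℕ) (hn : 2 ≤ n) (α : ℝ) (hα : 1 < α) (f : SchwartzMap (Rn n) ℂ)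
    (u ufree : ℝ → ℝ → Rn n → ℂ)
    (hu : ∀ ε ∈ Set.Ioc (0 : ℝ) 1, IsSolutionH n α 1 ε (⇑f) (u ε))
    (hfree : ∀ ε ∈ Set.Ioc (0 : ℝ) 1, IsLinSol n ε (ufree ε) ∧ ufree ε 0 = ⇑f) :
    ∀ T : ℝ, 0 < T → ∃ C : ℝ, 0 < C ∧ ∃ ε₀ ∈ Set.Ioc (0 : ℝ) 1,
      ∀ ε ∈ Set.Ioc (0 : ℝ) ε₀, ∀ t ∈ Set.Icc (0 : ℝ) T,
        eLpNorm (fun x => u ε t x - ufree ε t x) 2 volume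
          ≤ ENNReal.ofReal (C * ε ^ (α - 1) * Real.log (1 / ε)) := by
  intro T hT
  obtain ⟨CT, hCT, hintg⟩ := Pk_int T
  set K : ℝ := (∑ j, (nsq (Do j f) + nsq (Xo j f))) + 1 with hK
  set D : ℝ := 8 * n * √(nsq f) * √K with hD
  have hD0 : 0 ≤ D := by positivity
  obtain ⟨ε₀, hε₀, hsm⟩ := small_eps (r := α - 1) (by linarith) (κ := 12 * n * (D * K * CT))
  refine ⟨2 * (√(nsq f) * D * CT) + 1, by positivity, ε₀, ⟨hε₀.1, by linarith [hε₀.2]⟩, ?_⟩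
  intro ε hε t ht
  have hεp : 0 < ε := hε.1
  have hε2 : ε ≤ 1 / 2 := hε.2.trans hε₀.2
  have hε1 : ε ∈ Set.Ioc (0:ℝ) 1 := ⟨hεp, by linarith⟩
  have hS := hu ε hε1
  obtain ⟨hL, hL0⟩ := hfree ε hε1
  choose U hU using hS.schwartz
  choose Uf hUf using hL.schwartz
  have sol : Sol ε α U := to_evol hεp hU hS.smooth fun t x => by
    rw [hS.eq t x]
    simp only [nl, hU]
  have lin : Evol ε Uf (fun _ _ => 0) := to_evol hεp hUf hL.smooth fun t x => by
    rw [hL.eq t x, add_zero]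
  have U0 : U 0 = f := by
    apply DFunLike.coe_injective
    rw [← hU, hS.init]
  have Uf0 : Uf 0 = f := by
    apply DFunLike.coe_injective
    rw [← hUf, hL0]
  have hl : 0 ≤ Real.log (1 / ε) := Real.log_nonneg (by rw [le_div_iff₀ hεp]; linarith)
  have hI : ∀ t ∈ Set.Icc 0 T, ∫ τ in (0:ℝ)..t, Pk ε τ ≤ CT * Real.log (1 / ε) := hintg ε hεp hε2
  have hA := Y_bdd hn hεp hε1.2 sol (T := T) (K := K) (D := D) (Ip := CT * Real.log (1 / ε))
    (by rw [Yq_zero, U0]) (by rw [U0]) hI (by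
      refine le_trans (le_of_eq ?_) (hsm ε hε)
      ring)
  have hw := w_bound hn hεp sol lin (by rw [U0, Uf0]) hT.le hD0 hA hI t ht
  have e : (fun x => u ε t x - ufree ε t x) = ⇑(U t - Uf t : Sn n) := by
    ext x
    rw [hU, hUf]; rfl
  rw [e, eLp_nsq _ ((U t - Uf t : Sn n).memLp 2 volume)]
  refine ENNReal.ofReal_le_ofReal (hw.trans ?_)
  rw [U0]
  have p : 0 ≤ ε ^ (α - 1) * Real.log (1 / ε) := by positivity
  calc _ = 2 * (√(nsq f) * D * CT) * (ε ^ (α - 1) * Real.log (1 / ε)) := by ring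
    _ ≤ (2 * (√(nsq f) * D * CT) + 1) * (ε ^ (α - 1) * Real.log (1 / ε)) := by gcongr; linarith
    _ = _ := by ring

/-- in the very-weak-nonlinearity case γ = 1 < α, the solution is
linearizable at the L² level: for every T > 0, for ε small enough,
sup_{0≤t≤T} ‖u^ε(t) − u^ε_free(t)‖_{L²} ≤ C ε^{α−1} log(1/ε). -/
theorem stmt6 (n : ℕ) (hn : 2 ≤ n) (α : ℝ) (hα : 1 < α) (f : SchwartzMap (Rn n) ℂ)
    (u ufree : ℝ → ℝ → Rn n → ℂ)
    (hu : ∀ ε ∈ Set.Ioc (0 : ℝ) 1, IsSolutionH n α 1 ε (⇑f) (u ε))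
    (hfree : ∀ ε ∈ Set.Ioc (0 : ℝ) 1, IsLinSol n ε (ufree ε) ∧ ufree ε 0 = ⇑f) :
    ∀ T : ℝ, 0 < T → ∃ C : ℝ, 0 < C ∧ ∃ ε₀ ∈ Set.Ioc (0 : ℝ) 1,
      ∀ ε ∈ Set.Ioc (0 : ℝ) ε₀, ∀ t ∈ Set.Icc (0 : ℝ) T,
        eLpNorm (fun x => u ε t x - ufree ε t x) 2 volume
          ≤ ENNReal.ofReal (C * ε ^ (α - 1) * Real.log (1 / ε)) := by
  exact main6 n hn α hα f u ufree hu hfree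

end
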